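/- Let A(n) denote the number of locally flat-foldable MV-assignments of the n×n Miura-ori (so the crease pattern has N = n² parallelogram cells). Then A(n)^{1/n²} converges to (4/3)^{3/2} as n → ∞; that is, the number of ways to locally fold flat a Miura-ori crease pattern with N parallelograms grows like (4/3)^{3N/2} for N large. -/

import Mathlib

namespace Miura

/-- The column of the cell with (0-based) boustrophedon index `k` in a grid with `n`
columns: row `k / n` is traversed left-to-right when it is even, right-to-left when odd. -/
def bCol (n k : ℕ) : ℕ := if (k / n) % 2 = 0 then k % n else n - 1 - k % n

/-- The (0-based) boustrophedon index of the cell in row `i` and column `j`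
of a grid with `n` columns. -/
def bIdx (n i j : ℕ) : ℕ := i * n + (if i % 2 = 0 then j else n - 1 - j)

/-- The creases of the `m × n` Miura-ori, dual to the edges of the `m × n` grid graph:
`vert i j` is the crease V(i,j) separating the horizontally adjacent cells `(i, j)` and
`(i, j+1)`, and `horiz i j` is the crease H(i,j) separating the vertically adjacent cells
`(i, j)` (upper) and `(i+1, j)` (lower). -/
inductive Crease (m n : ℕ) : Type
  | vert  (i j : ℕ) (hi : i < m) (hj : j + 1 < n) : Crease m n
  | horiz (i j : ℕ) (hi : i + 1 < m) (hj : j < n) : Crease m n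

/-- A mountain-valley assignment: every crease gets the value `1` (mountain)
or `-1` (valley). -/
def IsMV {m n : ℕ} (μ : Crease m n → ℤ) : Prop := ∀ e : Crease m n, μ e = 1 ∨ μ e = -1

/-- `μ` is a locally flat-foldable MV-assignment of the `m × n` Miura-ori (with the top
row of crease-pattern vertices "pointing left"): it is an MV-assignment, and at each
interior vertex `w(i,j)`, incident to the creases V(i,j), V(i+1,j), H(i,j), H(i,j+1),
the sum `s` of the four MV-values is `2` or `-2` (Maekawa), and the distinguished crease
`e4` (namely H(i,j) for `i` even, H(i,j+1) for `i` odd) satisfies `μ e4 = s / 2`,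
i.e. `2 * μ e4 = s`. -/
def FlatFoldable {m n : ℕ} (μ : Crease m n → ℤ) : Prop :=
  IsMV μ ∧ ∀ i j : ℕ, ∀ hi : i + 1 < m, ∀ hj : j + 1 < n,
    ((μ (.vert i j (by omega) hj) + μ (.vert (i+1) j hi hj)
        + μ (.horiz i j hi (by omega)) + μ (.horiz i (j+1) hi hj) = 2 ∨
      μ (.vert i j (by omega) hj) + μ (.vert (i+1) j hi hj)
        + μ (.horiz i j hi (by omega)) + μ (.horiz i (j+1) hi hj) = -2) ∧
     2 * μ (if i % 2 = 0 then Crease.horiz i j hi (by omega) else Crease.horiz i (j+1) hi hj)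
       = μ (.vert i j (by omega) hj) + μ (.vert (i+1) j hi hj)
          + μ (.horiz i j hi (by omega)) + μ (.horiz i (j+1) hi hj))

lemma bCol_lt {n : ℕ} (k : ℕ) (hn : 0 < n) : bCol n k < n := by
  unfold bCol
  split
  · exact Nat.mod_lt _ hn
  · omega

lemma rowEnd_lt {m n k : ℕ} (hn : 0 < n) (hk : k + 1 < m * n) (h : (k + 1) % n = 0) :
    k / n + 1 < m := by
  obtain ⟨q, hq⟩ := Nat.dvd_of_mod_eq_zero h
  have hqm : q < m := by
    have h1 : n * q < n * m := by rw [← hq, Nat.mul_comm n m]; exact hk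
    exact Nat.lt_of_mul_lt_mul_left h1
  have h2 : n * (q + 1) ≤ n * m := Nat.mul_le_mul_left n hqm
  rw [Nat.mul_succ] at h2
  rw [← Nat.add_div_right k hn]
  rw [Nat.div_lt_iff_lt_mul hn]
  have h3 : n * q = k + 1 := hq.symm
  nlinarith
lemma mod_succ_lt {n k : ℕ} (hn : 2 ≤ n) (h : (k + 1) % n ≠ 0) : k % n + 1 < n := by
  have h1 : k % n < n := Nat.mod_lt _ (by omega)
  by_contra h2
  apply h
  have h3 : k % n + 1 = n := by omega
  have h4 : (k + 1) % n = (k % n + 1 % n) % n := Nat.add_mod k 1 n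
  have h5 : 1 % n = 1 := Nat.mod_eq_of_lt (by omega)
  rw [h5, h3, Nat.mod_self] at h4
  exact h4

/-- The MV-value of the crease `c_{k+1}` separating the cells `v_k` and `v_{k+1}`
(0-based) of the boustrophedon order, and `0` for an out-of-range index. -/
def stepVal (m n : ℕ) (μ : Crease m n → ℤ) (k : ℕ) : ℤ :=
  if h : 2 ≤ n ∧ k + 1 < m * n then
    if hr : (k + 1) % n = 0 then
      μ (Crease.horiz (k / n) (bCol n k) (rowEnd_lt (by omega) h.2 hr) (bCol_lt k (by omega)))
    else if (k / n) % 2 = 0 then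
      μ (Crease.vert (k / n) (k % n)
          ((Nat.div_lt_iff_lt_mul (by omega)).mpr (by omega))
          (mod_succ_lt h.1 hr))
    else
      μ (Crease.vert (k / n) (n - 2 - k % n)
          ((Nat.div_lt_iff_lt_mul (by omega)).mpr (by omega))
          (by omega))
  else 0

/-- The coloring of the boustrophedon path determined by a MV-assignment `μ`:
`c(v_1) = 0` and `c(v_k) = c(v_{k-1}) + μ(c_k) (mod 3)`, in 0-based indexing. -/
def pathColor (m n : ℕ) (μ : Crease m n → ℤ) : ℕ → ZMod 3
  | 0 => 0
  | k + 1 => pathColor m n μ k + ((stepVal m n μ k : ℤ) : ZMod 3)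

/-- The coloring of the cell in row `i`, column `j` determined by the MV-assignment `μ`
via the boustrophedon recursion. -/
def cellColor (m n : ℕ) (μ : Crease m n → ℤ) (i j : ℕ) : ZMod 3 :=
  pathColor m n μ (bIdx n i j)

/-- `c` is a proper 3-coloring of the cells of the `m × n` grid graph (cells indexed
by `ℕ × ℕ`, in range): cells at distance `|i - i'| + |j - j'| = 1` get different colors. -/
def ProperColoringN (m n : ℕ) (c : ℕ → ℕ → ZMod 3) : Prop :=
  ∀ i j i' j' : ℕ, i < m → j < n → i' < m → j' < n →
    (i - i') + (i' - i) + (j - j') + (j' - j) = 1 → c i j ≠ c i' j'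

/-- `c` is a proper 3-coloring of the `m × n` grid graph on vertex set
`Fin m × Fin n`: vertices at distance `|i - i'| + |j - j'| = 1` get different colors. -/
def ProperColoring (m n : ℕ) (c : Fin m × Fin n → ZMod 3) : Prop :=
  ∀ p q : Fin m × Fin n,
    ((p.1 : ℕ) - (q.1 : ℕ)) + ((q.1 : ℕ) - (p.1 : ℕ))
      + ((p.2 : ℕ) - (q.2 : ℕ)) + ((q.2 : ℕ) - (p.2 : ℕ)) = 1 → c p ≠ c q

/-- `1` if `d = 1`, and `-1` otherwise (so `-1` when `d = 2`); encodes the rule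
"`μ = 1` if the color difference is `1 (mod 3)`, `μ = -1` if it is `2 (mod 3)`". -/
def sgn3 (d : ZMod 3) : ℤ := if d = 1 then 1 else -1

/-- The MV-assignment determined by a coloring `c` of the cells: a path crease gets
value `1` resp. `-1` according as the color difference `c(v_k) - c(v_{k-1})` along the
boustrophedon path is `1` resp. `2 (mod 3)`; a non-path crease H(i,j) gets value `1`
resp. `-1` according as `c(i,j) - c(i+1,j)` is `1` resp. `2 (mod 3)`.  (Every vertical
crease V(i,j) lies on the path: in an even row the path crosses it from `(i,j)` to
`(i,j+1)`, in an odd row from `(i,j+1)` to `(i,j)`.  The crease H(i,j) lies on the path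
exactly when `j` is the last column visited in row `i`, i.e. `j = n - 1` for `i` even
and `j = 0` for `i` odd, in which case the path crosses it from `(i,j)` to `(i+1,j)`.) -/
def muOf (m n : ℕ) (c : ℕ → ℕ → ZMod 3) : Crease m n → ℤ
  | .vert i j _ _ =>
      if i % 2 = 0 then sgn3 (c i (j+1) - c i j) else sgn3 (c i j - c i (j+1))
  | .horiz i j _ _ =>
      if j = (if i % 2 = 0 then n - 1 else 0) then sgn3 (c (i+1) j - c i j)
      else sgn3 (c i j - c (i+1) j)

section Monodromy

open Matrix Kronecker

/-- The states of a row of `L` vertical edges. -/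
def Row : ℕ → Type
  | 0 => Unit
  | L + 1 => Bool × Row L

instance Row.instFintype : (L : ℕ) → Fintype (Row L)
  | 0 => inferInstanceAs (Fintype Unit)
  | L + 1 => letI := Row.instFintype L; inferInstanceAs (Fintype (Bool × Row L))

instance Row.instDecidableEq : (L : ℕ) → DecidableEq (Row L)
  | 0 => inferInstanceAs (DecidableEq Unit)
  | L + 1 => letI := Row.instDecidableEq L; inferInstanceAs (DecidableEq (Bool × Row L))

/-- The family of operators obtained by letting the auxiliary edge pass first through the
site `l` and then through the block `M`. -/
def glue {R S S' : Type*} [CommSemiring R] (l : Bool → Bool → Matrix S S R)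
    (M : Bool → Bool → Matrix S' S' R) (p q : Bool) : Matrix (S × S') (S × S') R :=
  ∑ k, l p k ⊗ₖ M k q

/-- The monodromy of `L` copies of the site `l`. -/
def mono {R : Type*} [CommSemiring R] (l : Bool → Bool → Matrix Bool Bool R) :
    (L : ℕ) → Bool → Bool → Matrix (Row L) (Row L) R
  | 0 => fun p q => if p = q then (1 : Matrix (Row 0) (Row 0) R) else 0
  | L + 1 => glue l (mono l L)

/-- The six-vertex weights: `site a b c p q σ τ` is the weight of a vertex with left edge `p`,
right edge `q`, outgoing vertical edge `σ` and incoming vertical edge `τ`. -/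
def site {R : Type*} [Zero R] (a b c : R) (p q : Bool) : Matrix Bool Bool R :=
  fun σ τ => if p = q ∧ σ = τ then (if p = σ then a else b)
    else if p = σ ∧ q = τ then c else 0

/-- The intertwining relation between two families of operators, for the six-vertex
R-matrix with weights `α`, `β`, `γ`. -/
def Intertwines {R S : Type*} [CommSemiring R] [Fintype S] (α β γ : R)
    (M N : Bool → Bool → Matrix S S R) : Prop :=
  ∀ p p' q q', ∑ k, ∑ k', site α β γ p k k' p' • (M k q * N k' q')
    = ∑ k, ∑ k', site α β γ k q q' k' • (N p' k' * M p k)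

theorem Intertwines.glue {R S S' : Type*} [CommSemiring R] [Fintype S] [Fintype S']
    {α β γ : R} {l l' : Bool → Bool → Matrix S S R} {M N : Bool → Bool → Matrix S' S' R}
    (hl : Intertwines α β γ l l') (hM : Intertwines α β γ M N) :
    Intertwines α β γ (glue l M) (glue l' N) := by
  intro p p' q q'
  have e1 : ∀ (X X' : Bool → Matrix S S R) (Y Y' : Bool → Matrix S' S' R),
      (∑ k, X k ⊗ₖ Y k) * (∑ k, X' k ⊗ₖ Y' k) =
        ∑ j, ∑ j', (X j * X' j') ⊗ₖ (Y j * Y' j') := by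
    intro X X' Y Y'
    simp only [Finset.sum_mul_sum, mul_kronecker_mul]
  simp only [Miura.glue, e1]
  calc _ = ∑ j, ∑ j', (∑ k, ∑ k', site α β γ p k k' p' • (l k j * l' k' j')) ⊗ₖ
            (M j q * N j' q') := by
        simp only [Fintype.sum_bool, add_kronecker, smul_kronecker, smul_add]
        abel
    _ = ∑ j, ∑ j', (∑ k, ∑ k', site α β γ k j j' k' • (l' p' k' * l p k)) ⊗ₖ
            (M j q * N j' q') := by simp only [hl p p']
    _ = ∑ k, ∑ k', (l' p' k' * l p k) ⊗ₖ
          (∑ j, ∑ j', site α β γ k j j' k' • (M j q * N j' q')) := by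
        simp only [Fintype.sum_bool, add_kronecker, smul_kronecker, kronecker_add, kronecker_smul]
        abel
    _ = ∑ k, ∑ k', (l' p' k' * l p k) ⊗ₖ
          (∑ j, ∑ j', site α β γ j q q' j' • (N k' j' * M k j)) := by simp only [hM _ _ q q']
    _ = _ := by
        simp only [Fintype.sum_bool, kronecker_add, kronecker_smul, smul_add]
        abel

theorem Intertwines.mono {R : Type*} [CommSemiring R]
    {α β γ : R} {l l' : Bool → Bool → Matrix Bool Bool R} (hl : Intertwines α β γ l l') (L : ℕ) :
    Intertwines α β γ (mono l L) (mono l' L) := by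
  induction L with
  | zero =>
    intro p p' q q'
    cases p <;> cases p' <;> cases q <;> cases q' <;> simp [Miura.mono, site]
  | succ L ih => exact hl.glue ih

/-- The vertex of the six-vertex model with `Δ = 1/2` and spectral parameter `w`. -/
noncomputable def vertexOp (w : ℂ) : Bool → Bool → Matrix Bool Bool ℂ :=
  site (Complex.sin (Real.pi / 3 - w)) (Complex.sin (Real.pi / 3 + w)) (Real.sqrt 3 / 2)

theorem sin_pi_div_three_add (w : ℂ) : Complex.sin (Real.pi / 3 + w) =
    (Real.sqrt 3 / 2) * Complex.cos w + Complex.sin w / 2 := by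
  have h1 : Complex.sin (Real.pi / 3) = Real.sqrt 3 / 2 := by
    exact_mod_cast congrArg Complex.ofReal Real.sin_pi_div_three
  have h2 : Complex.cos (Real.pi / 3) = 1 / 2 := by
    have := congrArg Complex.ofReal Real.cos_pi_div_three
    push_cast at this; exact this
  rw [Complex.sin_add, h1, h2]; ring

theorem sin_pi_div_three_sub (w : ℂ) : Complex.sin (Real.pi / 3 - w) =
    (Real.sqrt 3 / 2) * Complex.cos w - Complex.sin w / 2 := by
  rw [sub_eq_add_neg, sin_pi_div_three_add, Complex.cos_neg, Complex.sin_neg]; ring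

theorem sqrt_three_sq : (Real.sqrt 3 : ℂ) ^ 2 = 3 := by
  exact_mod_cast congrArg Complex.ofReal (Real.sq_sqrt (show (0:ℝ) ≤ 3 by norm_num))

set_option maxHeartbeats 1000000 in
theorem site_intertwines {t su cu sv cv : ℂ} (h3 : t ^ 2 = 3) (hu : su ^ 2 + cu ^ 2 = 1)
    (hv : sv ^ 2 + cv ^ 2 = 1) :
    Intertwines (t / 2 * (cu * cv + su * sv) - (su * cv - cu * sv) / 2) (-(su * cv - cu * sv))
      (t / 2) (site (t / 2 * cu - su / 2) (t / 2 * cu + su / 2) (t / 2))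
      (site (t / 2 * cv - sv / 2) (t / 2 * cv + sv / 2) (t / 2)) := by
  intro p p' q q'
  ext σ τ
  cases p <;> cases p' <;> cases q <;> cases q' <;> cases σ <;> cases τ <;>
    simp only [site, Matrix.mul_apply, Fintype.sum_bool, Matrix.add_apply, Matrix.smul_apply,
      smul_eq_mul, reduceCtorEq, if_true, if_false, and_true, and_false, true_and, false_and,
      mul_zero, zero_mul, add_zero, zero_add] <;> grind

theorem vertexOp_intertwines (u v : ℂ) :
    Intertwines (Complex.sin (Real.pi / 3 - (u - v))) (-Complex.sin (u - v))
      (Real.sqrt 3 / 2) (vertexOp u) (vertexOp v) := by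
  have := site_intertwines sqrt_three_sq (Complex.sin_sq_add_cos_sq u)
    (Complex.sin_sq_add_cos_sq v)
  simpa only [vertexOp, sin_pi_div_three_add, sin_pi_div_three_sub, ← Complex.sin_sub,
    ← Complex.cos_sub] using this

end Monodromy

section Bethe

open Matrix

/-- A family of operators satisfying the Yang–Baxter exchange relations of the
six-vertex model with `Δ = 1/2`. -/
def IsYangBaxter {S : Type*} [Fintype S] (T : ℂ → Bool → Bool → Matrix S S ℂ) : Prop :=
  ∀ u v, Intertwines (Complex.sin (Real.pi / 3 - (u - v))) (-Complex.sin (u - v))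
      (Real.sqrt 3 / 2) (T u) (T v)

theorem sin_pi_div_three : Complex.sin (Real.pi / 3) = Real.sqrt 3 / 2 := by
  simpa using sin_pi_div_three_add 0

theorem sqrt_three_ne_zero : (Real.sqrt 3 : ℂ) ≠ 0 := by
  intro h
  have := sqrt_three_sq
  rw [h] at this
  norm_num at this

namespace IsYangBaxter

variable {S : Type*} [Fintype S] {T : ℂ → Bool → Bool → Matrix S S ℂ}

theorem commute (hT : IsYangBaxter T) (u v : ℂ) :
    Commute (T u true false) (T v true false) := by
  have key : ∀ u v, Complex.sin (Real.pi / 3 - (u - v)) ≠ 0 →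
      T u true false * T v true false = T v true false * T u true false := by
    intro u v h
    have := hT u v true true false false
    simp only [site, Fintype.sum_bool, if_true, if_false, reduceCtorEq, and_true,
      and_false, false_and, and_self, zero_smul, add_zero, zero_add] at this
    exact smul_right_injective _ h this
  by_cases h : Complex.sin (Real.pi / 3 - (u - v)) = 0
  · refine (key v u fun h' => ?_).symm
    rw [show (Real.pi / 3 - (v - u) : ℂ) = Real.pi / 3 + (u - v) by ring,
      sin_pi_div_three_add] at h'
    rw [sin_pi_div_three_sub] at h
    have h1 : Complex.sin (u - v) = 0 := by linear_combination h' - h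
    have h2 : Complex.cos (u - v) = 0 := by
      have : (Real.sqrt 3 : ℂ) * Complex.cos (u - v) = 0 := by linear_combination h' + h
      exact (mul_eq_zero.1 this).resolve_left sqrt_three_ne_zero
    have := Complex.sin_sq_add_cos_sq (u - v)
    rw [h1, h2] at this
    norm_num at this
  · exact key u v h

theorem pairwise_commute {ι : Type*} (hT : IsYangBaxter T) (x : ι → ℂ) (s : Finset ι) :
    (s : Set ι).Pairwise (Function.onFun Commute fun i => T (x i) true false) :=
  fun _ _ _ _ _ => hT.commute _ _

theorem exchange_false (hT : IsYangBaxter T) {u v : ℂ} (h : Complex.sin (u - v) ≠ 0) :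
    T u false false * T v true false =
      (-Complex.sin (Real.pi / 3 - (u - v)) / Complex.sin (u - v)) •
        (T v true false * T u false false) +
      ((Real.sqrt 3 / 2) / Complex.sin (u - v)) • (T u true false * T v false false) := by
  have := hT u v false true false false
  simp only [site, Fintype.sum_bool, if_true, if_false, reduceCtorEq, and_true, true_and,
    and_false, false_and, zero_smul, add_zero, zero_add] at this
  refine smul_right_injective _ h ?_
  simp only [smul_add, smul_smul, mul_div_cancel₀ _ h]
  rw [neg_smul, ← this]
  module

theorem exchange_true (hT : IsYangBaxter T) {u v : ℂ} (h : Complex.sin (u - v) ≠ 0) :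
    T u true true * T v true false =
      (Complex.sin (Real.pi / 3 + (u - v)) / Complex.sin (u - v)) •
        (T v true false * T u true true) +
      (-(Real.sqrt 3 / 2) / Complex.sin (u - v)) • (T u true false * T v true true) := by
  have := hT v u true true false true
  simp only [site, Fintype.sum_bool, if_true, if_false, reduceCtorEq, and_true, true_and,
    and_false, false_and, zero_smul, add_zero, zero_add] at this
  refine smul_right_injective _ h ?_
  simp only [smul_add, smul_smul, mul_div_cancel₀ _ h]
  rw [show (Real.pi / 3 + (u - v) : ℂ) = Real.pi / 3 - (v - u) by ring, this,
    show v - u = -(u - v) by ring, Complex.sin_neg]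
  module

end IsYangBaxter

theorem exchange_coeff {u m k : ℂ} (r p : ℂ) (hum : Complex.sin (u - m) ≠ 0)
    (huk : Complex.sin (u - k) ≠ 0) (hmk : Complex.sin (m - k) ≠ 0) :
    (r * Complex.cos (u - m) + p * Complex.sin (u - m)) / Complex.sin (u - m) /
        Complex.sin (u - k) - r / Complex.sin (u - m) / Complex.sin (m - k) =
    (r * Complex.cos (k - m) + p * Complex.sin (k - m)) / Complex.sin (k - m) /
      Complex.sin (u - k) := by
  have h1 : Complex.sin (k - m) = -Complex.sin (m - k) := by rw [← neg_sub, Complex.sin_neg]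
  have h2 : Complex.sin (u - k) = Complex.sin (u - m) * Complex.cos (m - k) +
      Complex.cos (u - m) * Complex.sin (m - k) := by rw [← Complex.sin_add]; ring_nf
  have h3 : Complex.cos (k - m) = Complex.cos (m - k) := by rw [← neg_sub, Complex.cos_neg]
  rw [h1, h3]
  field_simp
  rw [h2]
  ring

/-- Normal ordering of an operator family `X` against a commuting family `B` of creation
operators with which it satisfies a two-term exchange relation. -/
theorem normal_order {ι E : Type*} [DecidableEq ι] [AddCommGroup E] [Module ℂ E]
    {X B : ℂ → E →ₗ[ℂ] E} {Ω : Finset ι → E} {x : ι → ℂ} {α : ℂ → ℂ} {f g : ℂ → ℂ → ℂ}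
    (hB : ∀ u v e, B u (B v e) = B v (B u e))
    (hX : ∀ u v e, Complex.sin (u - v) ≠ 0 →
      X u (B v e) = f u v • B v (X u e) + g u v • B u (X v e))
    (hΩ : ∀ i s, i ∉ s → Ω (insert i s) = B (x i) (Ω s))
    (hα : ∀ u, X u (Ω ∅) = α u • Ω ∅)
    (hfg : ∀ u m k, Complex.sin (u - m) ≠ 0 → Complex.sin (u - k) ≠ 0 →
      Complex.sin (m - k) ≠ 0 → f u m * g u k + g u m * g m k = g u k * f k m)
    (hx : ∀ i j, i ≠ j → Complex.sin (x i - x j) ≠ 0) (s : Finset ι) :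
    ∀ u, (∀ i ∈ s, Complex.sin (u - x i) ≠ 0) →
    X u (Ω s) = (α u * ∏ j ∈ s, f u (x j)) • Ω s +
      ∑ k ∈ s, (α (x k) * g u (x k) * ∏ j ∈ s.erase k, f (x k) (x j)) •
        B u (Ω (s.erase k)) := by
  induction s using Finset.induction_on with
  | empty => intro u _; simp [hα]
  | insert m s hm ih =>
    intro u hu
    have hum := hu m (Finset.mem_insert_self m s)
    have hus : ∀ i ∈ s, Complex.sin (u - x i) ≠ 0 :=
      fun i hi => hu i (Finset.mem_insert_of_mem hi)
    have hms : ∀ i ∈ s, Complex.sin (x m - x i) ≠ 0 :=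
      fun i hi => hx m i (fun h => hm (h ▸ hi))
    rw [hΩ m s hm, hX _ _ _ hum, ih u hus, ih (x m) hms, Finset.prod_insert hm,
      Finset.sum_insert hm, Finset.erase_insert hm]
    simp only [map_add, map_smul, map_sum, smul_add, Finset.smul_sum, smul_smul]
    have e : ∀ k ∈ s, (α (x k) * g u (x k) * ∏ j ∈ (insert m s).erase k, f (x k) (x j)) •
        B u (Ω ((insert m s).erase k)) =
        (f u (x m) * (α (x k) * g u (x k) * ∏ j ∈ s.erase k, f (x k) (x j))) •
          B (x m) (B u (Ω (s.erase k))) +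
        (g u (x m) * (α (x k) * g (x m) (x k) * ∏ j ∈ s.erase k, f (x k) (x j))) •
          B u (B (x m) (Ω (s.erase k))) := by
      intro k hk
      have hkm : k ≠ m := fun h => hm (h ▸ hk)
      have hmk : m ∉ s.erase k := fun h => hm (Finset.mem_of_mem_erase h)
      rw [Finset.erase_insert_of_ne hkm.symm, Finset.prod_insert hmk, hΩ _ _ hmk,
        hB (x m) u, ← add_smul]
      congr 1
      linear_combination (-(α (x k) * ∏ j ∈ s.erase k, f (x k) (x j))) *
        hfg u (x m) (x k) hum (hus k hk) (hms k hk)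
    rw [Finset.sum_congr rfl e, Finset.sum_add_distrib]
    simp only [mul_left_comm, mul_assoc]
    abel

/-- The vector created from `vac` by the creation operators with parameters `x i`, `i ∈ s`. -/
noncomputable def betheVec {S ι : Type*} [Fintype S] [DecidableEq S]
    {T : ℂ → Bool → Bool → Matrix S S ℂ} (hT : IsYangBaxter T) (vac : S → ℂ) (x : ι → ℂ)
    (s : Finset ι) : S → ℂ :=
  s.noncommProd (fun i => T (x i) true false) (hT.pairwise_commute x s) *ᵥ vac

section

variable {S ι : Type*} [Fintype S] [DecidableEq S]
    {T : ℂ → Bool → Bool → Matrix S S ℂ} (hT : IsYangBaxter T) (vac : S → ℂ) (x : ι → ℂ)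

@[simp]
theorem betheVec_empty : betheVec hT vac x ∅ = vac := by
  rw [betheVec, Finset.noncommProd_empty, one_mulVec]

theorem betheVec_insert [DecidableEq ι] {i : ι} {s : Finset ι} (h : i ∉ s) :
    betheVec hT vac x (insert i s) = T (x i) true false *ᵥ betheVec hT vac x s := by
  rw [betheVec, Finset.noncommProd_insert_of_notMem _ _ _ _ h, betheVec, mulVec_mulVec]

variable {vac} {x} in
theorem betheVec_eigen [DecidableEq ι] {a d : ℂ → ℂ} (ha : ∀ u, T u false false *ᵥ vac = a u • vac)
    (hd : ∀ u, T u true true *ᵥ vac = d u • vac)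
    (hx : ∀ i j, i ≠ j → Complex.sin (x i - x j) ≠ 0) (s : Finset ι)
    (hbethe : ∀ k ∈ s, a (x k) * ∏ j ∈ s, -Complex.sin (Real.pi / 3 - (x k - x j)) +
      d (x k) * ∏ j ∈ s, Complex.sin (Real.pi / 3 + (x k - x j)) = 0)
    (u : ℂ) (hu : ∀ i ∈ s, Complex.sin (u - x i) ≠ 0) :
    (T u false false + T u true true) *ᵥ betheVec hT vac x s =
      ((a u * ∏ j ∈ s, -Complex.sin (Real.pi / 3 - (u - x j)) +
        d u * ∏ j ∈ s, Complex.sin (Real.pi / 3 + (u - x j))) /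
        ∏ j ∈ s, Complex.sin (u - x j)) • betheVec hT vac x s := by
  have hBB : ∀ u v e, (T u true false).mulVecLin ((T v true false).mulVecLin e) =
      (T v true false).mulVecLin ((T u true false).mulVecLin e) := by
    intro u v e
    simp only [mulVecLin_apply, mulVec_mulVec, (hT.commute u v).eq]
  have hins : ∀ i s, i ∉ s → betheVec hT vac x (insert i s) =
      (T (x i) true false).mulVecLin (betheVec hT vac x s) :=
    fun i s hi => betheVec_insert hT vac x hi
  have hA := normal_order (X := fun u => (T u false false).mulVecLin)
    (B := fun u => (T u true false).mulVecLin) (Ω := betheVec hT vac x) (x := x) (α := a)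
    (f := fun u v => -Complex.sin (Real.pi / 3 - (u - v)) / Complex.sin (u - v))
    (g := fun u v => (Real.sqrt 3 / 2) / Complex.sin (u - v)) hBB
    (by
      intro u v e h
      simp only [mulVecLin_apply, mulVec_mulVec, hT.exchange_false h, add_mulVec, smul_mulVec])
    hins (by simpa using ha)
    (by
      intro u m k h1 h2 h3
      have := exchange_coeff (Real.sqrt 3 / 2) (-1 / 2) h1 h2 h3
      simp only [sin_pi_div_three_sub]
      linear_combination (-(Real.sqrt 3 / 2) : ℂ) * this) hx s u hu
  have hD := normal_order (X := fun u => (T u true true).mulVecLin)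
    (B := fun u => (T u true false).mulVecLin) (Ω := betheVec hT vac x) (x := x) (α := d)
    (f := fun u v => Complex.sin (Real.pi / 3 + (u - v)) / Complex.sin (u - v))
    (g := fun u v => -(Real.sqrt 3 / 2) / Complex.sin (u - v)) hBB
    (by
      intro u v e h
      simp only [mulVecLin_apply, mulVec_mulVec, hT.exchange_true h, add_mulVec, smul_mulVec])
    hins (by simpa using hd)
    (by
      intro u m k h1 h2 h3
      have := exchange_coeff (Real.sqrt 3 / 2) (1 / 2) h1 h2 h3
      simp only [sin_pi_div_three_add]
      linear_combination (-(Real.sqrt 3 / 2) : ℂ) * this) hx s u hu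
  simp only [mulVecLin_apply] at hA hD
  rw [add_mulVec, hA, hD, add_add_add_comm, ← Finset.sum_add_distrib, Finset.sum_eq_zero,
    add_zero, ← add_smul, Finset.prod_div_distrib, Finset.prod_div_distrib]
  · congr 1
    ring
  · intro k hk
    have h := hbethe k hk
    rw [← Finset.mul_prod_erase s _ hk, ← Finset.mul_prod_erase s (fun j =>
      Complex.sin (Real.pi / 3 + (x k - x j))) hk, sub_self, sub_zero, add_zero,
      sin_pi_div_three] at h
    rw [← add_smul, Finset.prod_div_distrib, Finset.prod_div_distrib]
    have h0 : ∏ j ∈ s.erase k, Complex.sin (x k - x j) ≠ 0 :=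
      Finset.prod_ne_zero_iff.2 fun j hj => hx k j (Finset.ne_of_mem_erase hj).symm
    have h1 := hu k hk
    convert zero_smul ℂ _
    generalize ∏ j ∈ s.erase k, -Complex.sin (Real.pi / 3 - (x k - x j)) = y at *
    generalize ∏ j ∈ s.erase k, Complex.sin (Real.pi / 3 + (x k - x j)) = z at *
    linear_combination
      (-(Complex.sin (u - x k))⁻¹ * (∏ j ∈ s.erase k, Complex.sin (x k - x j))⁻¹) * h

end

end Bethe

section Components

open Matrix

theorem vertexOp_intertwines_shift (y u v : ℂ) :
    Intertwines (Complex.sin (Real.pi / 3 - (u - v))) (-Complex.sin (u - v))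
      (Real.sqrt 3 / 2) (vertexOp (u - y)) (vertexOp (v - y)) := by
  simpa using vertexOp_intertwines (u - y) (v - y)

/-- A family of operators extended by a first site with inhomogeneity `y`. -/
noncomputable def extend {S : Type*} (y : ℂ) (M : ℂ → Bool → Bool → Matrix S S ℂ) (w : ℂ) :
    Bool → Bool → Matrix (Bool × S) (Bool × S) ℂ :=
  glue (vertexOp (w - y)) (M w)

theorem IsYangBaxter.extend {S : Type*} [Fintype S] {M : ℂ → Bool → Bool → Matrix S S ℂ}
    (hM : IsYangBaxter M) (y : ℂ) : IsYangBaxter (extend y M) :=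
  fun u v => (vertexOp_intertwines_shift y u v).glue (hM u v)

/-- The vector `vac` with an empty first site added. -/
def extendVac {S : Type*} (vac : S → ℂ) (σ : Bool × S) : ℂ := if σ.1 then 0 else vac σ.2

theorem glue_mulVec {S S' : Type*} [Fintype S] [Fintype S']
    (l : Bool → Bool → Matrix S S ℂ) (M : Bool → Bool → Matrix S' S' ℂ) (p q : Bool)
    (v : S × S' → ℂ) (σ : S × S') :
    (glue l M p q *ᵥ v) σ = ∑ k, ∑ τ, l p k σ.1 τ * (M k q *ᵥ fun τ' => v (τ, τ')) σ.2 := by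
  simp only [glue, mulVec, dotProduct, Matrix.sum_apply, Fintype.sum_prod_type, Finset.sum_mul,
    Finset.mul_sum, kroneckerMap_apply, mul_assoc]
  simp only [Fintype.sum_bool, Finset.sum_add_distrib]

section

variable {S : Type*} [Fintype S] (y : ℂ) (M : ℂ → Bool → Bool → Matrix S S ℂ) (w : ℂ)
  (v : Bool × S → ℂ) (σ : S)

theorem extend_true_false_mulVec_false :
    (extend y M w true false *ᵥ v) (false, σ) = Complex.sin (Real.pi / 3 + (w - y)) *
      (M w true false *ᵥ fun τ => v (false, τ)) σ := by
  simp [extend, glue_mulVec, vertexOp, site]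

theorem extend_true_false_mulVec_true :
    (extend y M w true false *ᵥ v) (true, σ) = Complex.sin (Real.pi / 3 - (w - y)) *
      (M w true false *ᵥ fun τ => v (true, τ)) σ +
      Real.sqrt 3 / 2 * (M w false false *ᵥ fun τ => v (false, τ)) σ := by
  simp [extend, glue_mulVec, vertexOp, site]

theorem extend_false_false_mulVec_true :
    (extend y M w false false *ᵥ v) (true, σ) = Complex.sin (Real.pi / 3 + (w - y)) *
      (M w false false *ᵥ fun τ => v (true, τ)) σ := by
  simp [extend, glue_mulVec, vertexOp, site]

theorem extend_false_false_mulVec_false :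
    (extend y M w false false *ᵥ v) (false, σ) = Complex.sin (Real.pi / 3 - (w - y)) *
      (M w false false *ᵥ fun τ => v (false, τ)) σ +
      Real.sqrt 3 / 2 * (M w true false *ᵥ fun τ => v (true, τ)) σ := by
  simp [extend, glue_mulVec, vertexOp, site]
  ring

theorem extend_true_true_mulVec_true :
    (extend y M w true true *ᵥ v) (true, σ) = Complex.sin (Real.pi / 3 - (w - y)) *
      (M w true true *ᵥ fun τ => v (true, τ)) σ +
      Real.sqrt 3 / 2 * (M w false true *ᵥ fun τ => v (false, τ)) σ := by
  simp [extend, glue_mulVec, vertexOp, site]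

theorem extend_true_true_mulVec_false :
    (extend y M w true true *ᵥ v) (false, σ) = Complex.sin (Real.pi / 3 + (w - y)) *
      (M w true true *ᵥ fun τ => v (false, τ)) σ := by
  simp [extend, glue_mulVec, vertexOp, site]

theorem extend_false_true_mulVec_true :
    (extend y M w false true *ᵥ v) (true, σ) = Complex.sin (Real.pi / 3 + (w - y)) *
      (M w false true *ᵥ fun τ => v (true, τ)) σ := by
  simp [extend, glue_mulVec, vertexOp, site]

theorem extend_false_true_mulVec_false :
    (extend y M w false true *ᵥ v) (false, σ) = Complex.sin (Real.pi / 3 - (w - y)) *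
      (M w false true *ᵥ fun τ => v (false, τ)) σ +
      Real.sqrt 3 / 2 * (M w true true *ᵥ fun τ => v (true, τ)) σ := by
  simp [extend, glue_mulVec, vertexOp, site]
  ring

end

/-- `vac` is annihilated by the lower triangular part, and an eigenvector of the diagonal
operators for the eigenvalues of `L` homogeneous sites. -/
structure IsVacuum {S : Type*} [Fintype S] (M : ℂ → Bool → Bool → Matrix S S ℂ) (vac : S → ℂ)
    (L : ℕ) : Prop where
  false_false : ∀ w, M w false false *ᵥ vac = Complex.sin (Real.pi / 3 - w) ^ L • vac
  true_true : ∀ w, M w true true *ᵥ vac = Complex.sin (Real.pi / 3 + w) ^ L • vac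
  false_true : ∀ w, M w false true *ᵥ vac = 0

theorem extendVac_false {S : Type*} (vac : S → ℂ) : (fun τ => extendVac vac (false, τ)) = vac :=
  rfl

theorem extendVac_true {S : Type*} (vac : S → ℂ) : (fun τ => extendVac vac (true, τ)) = 0 :=
  rfl

theorem IsVacuum.extend {S : Type*} [Fintype S] {M : ℂ → Bool → Bool → Matrix S S ℂ}
    {vac : S → ℂ} {L : ℕ} (h : IsVacuum M vac L) :
    IsVacuum (extend 0 M) (extendVac vac) (L + 1) where
  false_false w := by
    ext ⟨σ, τ⟩
    cases σ
    · rw [extend_false_false_mulVec_false, extendVac_false, extendVac_true, h.false_false]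
      simp [extendVac, pow_succ]
      ring
    · rw [extend_false_false_mulVec_true, extendVac_true]
      simp [extendVac]
  true_true w := by
    ext ⟨σ, τ⟩
    cases σ
    · rw [extend_true_true_mulVec_false, extendVac_false, h.true_true]
      simp [extendVac, pow_succ]
      ring
    · rw [extend_true_true_mulVec_true, extendVac_false, extendVac_true, h.false_true]
      simp [extendVac]
  false_true w := by
    ext ⟨σ, τ⟩
    cases σ
    · simp [extend_false_true_mulVec_false, extendVac_false, extendVac_true, h.false_true]
    · simp [extend_false_true_mulVec_true, extendVac_true]

section

variable {S ι : Type*} [Fintype S] [DecidableEq S] [DecidableEq ι]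
  {M : ℂ → Bool → Bool → Matrix S S ℂ} (hM : IsYangBaxter M) (y : ℂ) (vac : S → ℂ) (x : ι → ℂ)

theorem betheVec_extend_false (s : Finset ι) :
    (fun τ => betheVec (hM.extend y) (extendVac vac) x s (false, τ)) =
      (∏ j ∈ s, Complex.sin (Real.pi / 3 + (x j - y))) • betheVec hM vac x s := by
  induction s using Finset.induction_on with
  | empty => simp [extendVac_false]
  | insert i s hi ih =>
    ext τ
    rw [betheVec_insert _ _ _ hi, extend_true_false_mulVec_false, ih,
      betheVec_insert _ _ _ hi, Finset.prod_insert hi, mulVec_smul]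
    simp [mul_assoc]

theorem betheVec_extend_true_insert {s : Finset ι} {i : ι} (hi : i ∉ s) :
    (fun τ => betheVec (hM.extend y) (extendVac vac) x (insert i s) (true, τ)) =
      Complex.sin (Real.pi / 3 - (x i - y)) • (M (x i) true false *ᵥ
        fun τ => betheVec (hM.extend y) (extendVac vac) x s (true, τ)) +
      (Real.sqrt 3 / 2 * ∏ j ∈ s, Complex.sin (Real.pi / 3 + (x j - y))) •
        (M (x i) false false *ᵥ betheVec hM vac x s) := by
  ext τ
  rw [betheVec_insert _ _ _ hi, extend_true_false_mulVec_true,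
    betheVec_extend_false hM,
    mulVec_smul]
  simp [mul_assoc]

/-- Freezing of the first site when `b` vanishes there. -/
theorem betheVec_extend_true_add {L : ℕ} (h : IsVacuum M vac L) {i : ι} {s : Finset ι}
    (hi : i ∉ s) :
    (fun τ => betheVec (hM.extend (x i + Real.pi / 3)) (extendVac vac) x (insert i s)
        (true, τ)) =
      (Real.sqrt 3 / 2 * Complex.sin (Real.pi / 3 - x i) ^ L *
        ∏ j ∈ s, Complex.sin (Real.pi / 3 + (x j - x i))) • betheVec hM vac x s := by
  induction s using Finset.induction_on with
  | empty =>
    rw [betheVec_extend_true_insert hM _ vac x hi]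
    simp [extendVac_true, h.false_false, smul_smul]
  | insert k s hk ih =>
    have hki : k ≠ i := fun h => hi (h ▸ Finset.mem_insert_self k s)
    have his : i ∉ s := fun h => hi (Finset.mem_insert_of_mem h)
    have hk' : k ∉ insert i s := by simp [hki, hk]
    rw [Finset.insert_comm, betheVec_extend_true_insert hM _ vac x hk', ih his,
      Finset.prod_insert his, Finset.prod_insert hk, betheVec_insert _ _ _ hk,
      show (Real.pi / 3 + (x i - (x i + Real.pi / 3)) : ℂ) = 0 by ring, Complex.sin_zero,
      show (Real.pi / 3 - (x k - (x i + Real.pi / 3)) : ℂ) =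
        Real.pi - (Real.pi / 3 + (x k - x i)) by ring, Complex.sin_pi_sub, mulVec_smul,
      zero_mul, mul_zero, zero_smul, add_zero, smul_smul]
    congr 1
    ring

/-- Freezing of the first site when `a` vanishes there. -/
theorem betheVec_extend_true_sub {i : ι} {s : Finset ι} (hi : i ∉ s) :
    (fun τ => betheVec (hM.extend (x i - Real.pi / 3)) (extendVac vac) x (insert i s)
        (true, τ)) =
      (Real.sqrt 3 / 2 * ∏ j ∈ s, Complex.sin (Real.pi / 3 - (x j - x i))) •
        (M (x i) false false *ᵥ betheVec hM vac x s) := by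
  rw [betheVec_extend_true_insert hM _ vac x hi,
    show (Real.pi / 3 - (x i - (x i - Real.pi / 3)) : ℂ) = 0 by ring, Complex.sin_zero,
    zero_smul, zero_add]
  congr 2
  refine Finset.prod_congr rfl fun j _ => ?_
  rw [show (Real.pi / 3 + (x j - (x i - Real.pi / 3)) : ℂ) =
    Real.pi - (Real.pi / 3 - (x j - x i)) by ring, Complex.sin_pi_sub]

end

end Components

section Descartes

open Polynomial

theorem signVariations_add_one_le_card_support {P : ℝ[X]} (hP : P ≠ 0) :
    P.signVariations + 1 ≤ P.support.card := by
  induction h : P.support.card generalizing P with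
  | zero => exact absurd (Polynomial.card_support_eq_zero.1 h) hP
  | succ n ih =>
    by_cases h0 : P.eraseLead = 0
    · have : P = monomial P.natDegree P.leadingCoeff := by
        conv_lhs => rw [← eraseLead_add_monomial_natDegree_leadingCoeff P, h0, zero_add]
      rw [this, signVariations_monomial]
      omega
    · have h1 := ih h0 (card_support_eraseLead' h)
      have h2 := signVariations_le_eraseLead_succ (P := P)
      omega

/-- Descartes' rule of signs, in the form of a bound for the number of monomials. -/
theorem eq_zero_of_prod_dvd_of_card_support_le {P : ℝ[X]} {m : Multiset ℝ} (hm : ∀ a ∈ m, 0 < a)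
    (hdvd : (m.map fun a => X - C a).prod ∣ P) (hcard : P.support.card ≤ m.card) : P = 0 := by
  by_contra hP
  have h1 := signVariations_add_one_le_card_support hP
  have h2 := roots_countP_pos_le_signVariations P
  have h3 : m ≤ P.roots := by
    have := Polynomial.roots.le_of_dvd hP hdvd
    rwa [roots_multiset_prod_X_sub_C] at this
  have h4 := Multiset.countP_le_of_le (0 < ·) h3
  rw [Multiset.countP_eq_card.2 hm] at h4
  omega

/-- The polynomial whose coefficients are the real parts of those of `P`. -/
noncomputable def rePoly (P : ℂ[X]) : ℝ[X] := ∑ k ∈ P.support, monomial k (P.coeff k).re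

theorem coeff_rePoly (P : ℂ[X]) (k : ℕ) : (rePoly P).coeff k = (P.coeff k).re := by
  simp only [rePoly, finsetSum_coeff, coeff_monomial, Finset.sum_ite_eq', mem_support_iff]
  split_ifs with h
  · rfl
  · simp [not_not.1 h]

theorem rePoly_map_mul (D : ℝ[X]) (Q : ℂ[X]) :
    rePoly (D.map Complex.ofRealHom * Q) = D * rePoly Q := by
  ext k
  simp [coeff_rePoly, coeff_mul]

theorem eq_zero_of_map_prod_dvd_of_card_support_le {P : ℂ[X]} {m : Multiset ℝ}
    (hm : ∀ a ∈ m, 0 < a)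
    (hdvd : (m.map fun a => X - C a).prod.map Complex.ofRealHom ∣ P) {K : Finset ℕ}
    (hK : P.support ⊆ K) (hcard : K.card ≤ m.card) : P = 0 := by
  have key : ∀ z : ℂ, rePoly (C z * P) = 0 := by
    intro z
    obtain ⟨Q, rfl⟩ := hdvd
    refine eq_zero_of_prod_dvd_of_card_support_le hm ?_ (le_trans (Finset.card_le_card ?_) hcard)
    · rw [mul_left_comm, rePoly_map_mul]
      exact dvd_mul_right _ _
    · refine subset_trans (fun k hk => ?_) hK
      rw [mem_support_iff, coeff_rePoly, coeff_C_mul] at hk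
      rw [mem_support_iff]
      intro h
      simp [h] at hk
  ext k
  have h1 := congrArg (fun p => p.coeff k) (key 1)
  have h2 := congrArg (fun p => p.coeff k) (key (-Complex.I))
  simp only [coeff_rePoly, coeff_C_mul, coeff_zero] at h1 h2
  apply Complex.ext
  · simpa using h1
  · simpa using h2

theorem sum_range_filter_mod_three {ζ : ℂ} (h3 : ζ ^ 3 = 1) (h1 : 1 + ζ + ζ ^ 2 = 0)
    (c : ℕ → ℂ) (x : ℂ) (N : ℕ) :
    ∑ k ∈ Finset.range (3 * N + 2), c k * x ^ k * (1 + ζ ^ (k + 1) + ζ ^ (2 * (k + 1))) =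
      3 * x ^ 2 * ∑ m ∈ Finset.range N, c (3 * m + 2) * (x ^ 3) ^ m := by
  have key : ∀ m, ζ ^ (3 * m) = 1 := fun m => by rw [pow_mul, h3, one_pow]
  have w0 : ∀ m, 1 + ζ ^ (3 * m + 1) + ζ ^ (2 * (3 * m + 1)) = 0 := fun m => by
    rw [show 2 * (3 * m + 1) = 3 * (2 * m) + 2 by ring, pow_add, pow_add, key, key]
    linear_combination h1
  have w1 : ∀ m, 1 + ζ ^ (3 * m + 2) + ζ ^ (2 * (3 * m + 2)) = 0 := fun m => by
    rw [show 2 * (3 * m + 2) = 3 * (2 * m + 1) + 1 by ring, pow_add, pow_add, key, key]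
    linear_combination h1
  have w2 : ∀ m, 1 + ζ ^ (3 * (m + 1)) + ζ ^ (2 * (3 * (m + 1))) = 3 := fun m => by
    rw [show 2 * (3 * (m + 1)) = 3 * (2 * (m + 1)) by ring, key, key]
    norm_num
  induction N with
  | zero =>
    have := w0 0
    have := w1 0
    simp_all [Finset.sum_range_succ]
  | succ N ih =>
    rw [show 3 * (N + 1) + 2 = 3 * N + 2 + 1 + 1 + 1 by ring, Finset.sum_range_succ,
      Finset.sum_range_succ, Finset.sum_range_succ, ih, Finset.sum_range_succ _ N]
    rw [show 3 * N + 2 + 1 + 1 + 1 = 3 * (N + 1) + 2 by ring,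
      show 3 * N + 2 + 1 + 1 = 3 * (N + 1) + 1 by ring,
      show 3 * N + 2 + 1 = 3 * (N + 1) by ring, w0, w1, w2]
    ring

theorem card_filter_mod_three (N : ℕ) :
    ((Finset.range (3 * N + 2)).filter fun k => k % 3 ≠ 2).card = 2 * (N + 1) := by
  induction N with
  | zero => rfl
  | succ N ih =>
    rw [show 3 * (N + 1) + 2 = 3 * N + 2 + 1 + 1 + 1 by ring, Finset.range_add_one,
      Finset.range_add_one, Finset.range_add_one, Finset.filter_insert, Finset.filter_insert,
      Finset.filter_insert, if_pos (by omega), if_pos (by omega), if_neg (by omega),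
      Finset.card_insert_of_notMem (by simp), Finset.card_insert_of_notMem (by simp), ih]
    ring

/-- A polynomial of degree at most `3N + 1` which satisfies a three-term relation at `N + 1`
positive points, and vanishes there and to order `N + 1` at `1`, is zero. -/
theorem eq_zero_of_three_term {ι : Type*} {ζ : ℂ} (h3 : ζ ^ 3 = 1) (h1 : 1 + ζ + ζ ^ 2 = 0)
    {P : ℂ[X]} {N : ℕ} (hP : P.natDegree < 3 * N + 2) {s : Finset ι} (hs : s.card = N + 1)
    {r : ι → ℝ} (hr : ∀ i, 0 < r i) (hinj : Function.Injective r)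
    (hrel : ∀ i ∈ s, P.eval (r i : ℂ) + ζ * P.eval (ζ * r i) + ζ ^ 2 * P.eval (ζ ^ 2 * r i) = 0)
    (hdvd : (∏ i ∈ s, (X - C (r i : ℂ))) * (X - C 1) ^ (N + 1) ∣ P) : P = 0 := by
  classical
  have hcoef : ∀ m < N, P.coeff (3 * m + 2) = 0 := by
    set R : ℂ[X] := ∑ m ∈ Finset.range N, C (P.coeff (3 * m + 2)) * X ^ m with hR
    have hR0 : R = 0 := by
      refine eq_zero_of_natDegree_lt_card_of_eval_eq_zero' R
        (s.image fun i => ((r i : ℂ) ^ 3)) ?_ ?_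
      · intro z hz
        obtain ⟨i, hi, rfl⟩ := Finset.mem_image.1 hz
        have h := sum_range_filter_mod_three h3 h1 P.coeff (r i) N
        have hne : (3 * (r i : ℂ) ^ 2) ≠ 0 :=
          mul_ne_zero three_ne_zero (pow_ne_zero 2 (Complex.ofReal_ne_zero.2 (hr i).ne'))
        have hl : ∑ k ∈ Finset.range (3 * N + 2),
            P.coeff k * (r i : ℂ) ^ k * (1 + ζ ^ (k + 1) + ζ ^ (2 * (k + 1))) = 0 := by
          rw [← hrel i hi, eval_eq_sum_range' hP, eval_eq_sum_range' hP, eval_eq_sum_range' hP,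
            Finset.mul_sum, Finset.mul_sum, ← Finset.sum_add_distrib, ← Finset.sum_add_distrib]
          refine Finset.sum_congr rfl fun k _ => ?_
          ring
        rw [hl] at h
        simp only [hR, eval_finsetSum, eval_mul, eval_C, eval_pow, eval_X]
        exact (mul_eq_zero.1 h.symm).resolve_left hne
      · rw [Finset.card_image_of_injective, hs]
        · refine lt_of_le_of_lt (natDegree_sum_le_of_forall_le (n := N) _ _ fun m hm => ?_)
            (Nat.lt_succ_self N)
          exact (natDegree_C_mul_X_pow_le _ _).trans (Finset.mem_range.1 hm).le
        · intro i j hij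
          have hij' : (r i : ℂ) ^ 3 = (r j : ℂ) ^ 3 := hij
          exact hinj ((pow_left_inj₀ (hr i).le (hr j).le three_ne_zero).1 (by exact_mod_cast hij'))
    intro m hm
    have := congrArg (fun p => p.coeff m) hR0
    simpa [hR, finsetSum_coeff, coeff_C_mul, coeff_X_pow, hm] using this
  refine eq_zero_of_map_prod_dvd_of_card_support_le (m := s.val.map r + Multiset.replicate (N + 1) 1)
    ?_ ?_ (K := (Finset.range (3 * N + 2)).filter fun k => k % 3 ≠ 2) ?_ ?_
  · intro a ha
    rcases Multiset.mem_add.1 ha with h | h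
    · obtain ⟨i, _, rfl⟩ := Multiset.mem_map.1 h
      exact hr i
    · rw [Multiset.eq_of_mem_replicate h]
      exact one_pos
  · convert hdvd using 1
    rw [Multiset.map_add, Multiset.prod_add, Multiset.map_map, Multiset.map_replicate,
      Multiset.prod_replicate, Polynomial.map_mul, Polynomial.map_pow]
    congr 1
    · change (Finset.prod s fun i => (X - C (r i))).map _ = _
      rw [Polynomial.map_prod]
      simp
    · simp
  · intro k hk
    have hk' := mem_support_iff.1 hk
    have hlt : k < 3 * N + 2 := lt_of_le_of_lt (le_natDegree_of_ne_zero hk') hP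
    refine Finset.mem_filter.2 ⟨Finset.mem_range.2 hlt, fun hmod => hk' ?_⟩
    rw [show k = 3 * (k / 3) + 2 by omega]
    exact hcoef _ (by omega)
  · rw [card_filter_mod_three]
    simp [hs]
    omega

end Descartes

section Nonvanishing

open Matrix Polynomial

/-- The linear polynomial representing `sin (t + y)` in the variable `exp (2 i y)`. -/
noncomputable def linFactor (t : ℂ) : ℂ[X] :=
  C (Complex.exp (Complex.I * t) / (2 * Complex.I)) * (X - C (Complex.exp (-(2 * Complex.I * t))))

theorem eval_linFactor (t y : ℂ) :
    (linFactor t).eval (Complex.exp (Complex.I * y) ^ 2) =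
      Complex.sin (t + y) * Complex.exp (Complex.I * y) := by
  have h : Complex.exp (Complex.I * t) ≠ 0 := Complex.exp_ne_zero _
  have h' : Complex.exp (Complex.I * y) ≠ 0 := Complex.exp_ne_zero _
  simp only [linFactor, eval_mul, eval_C, eval_sub, eval_X, Complex.sin]
  rw [show -(t + y) * Complex.I = -(Complex.I * t + Complex.I * y) by ring,
    show (t + y) * Complex.I = Complex.I * t + Complex.I * y by ring,
    show -(2 * Complex.I * t) = -(Complex.I * t + Complex.I * t) by ring,
    Complex.exp_neg, Complex.exp_neg, Complex.exp_add, Complex.exp_add]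
  have hI : Complex.I ≠ 0 := Complex.I_ne_zero
  field_simp
  rw [Complex.I_sq]
  ring

theorem natDegree_linFactor_le (t : ℂ) : (linFactor t).natDegree ≤ 1 :=
  (natDegree_C_mul_le _ _).trans (natDegree_X_sub_C_le _)

theorem linFactor_ne_zero (t : ℂ) : linFactor t ≠ 0 :=
  mul_ne_zero (C_ne_zero.2 (div_ne_zero (Complex.exp_ne_zero _) (by simp))) (X_sub_C_ne_zero _)

theorem X_sub_C_dvd_linFactor (t : ℂ) :
    X - C (Complex.exp (-(2 * Complex.I * t))) ∣ linFactor t := dvd_mul_left _ _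

theorem natDegree_prod_linFactor_le {ι : Type*} (s : Finset ι) (t : ι → ℂ) :
    (∏ j ∈ s, linFactor (t j)).natDegree ≤ s.card := by
  refine (natDegree_prod_le _ _).trans ((Finset.sum_le_card_nsmul _ _ 1 fun j _ =>
    natDegree_linFactor_le _).trans (by simp))

theorem sin_ne_zero_of_re {z : ℂ} (h0 : 0 < z.re) (h1 : z.re < Real.pi) : Complex.sin z ≠ 0 := by
  rw [Complex.sin_ne_zero_iff]
  intro k hk
  rw [hk] at h0 h1
  simp only [Complex.mul_re, Complex.intCast_re, Complex.ofReal_re, Complex.intCast_im,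
    Complex.ofReal_im, mul_zero, sub_zero] at h0 h1
  have hpi := Real.pi_pos
  have h2 : (0 : ℝ) < k := by
    by_contra h
    exact absurd h0 (not_lt.2 (mul_nonpos_of_nonpos_of_nonneg (not_lt.1 h) hpi.le))
  have h3 : (k : ℝ) < 1 := by
    by_contra h
    nlinarith
  have h4 : 0 < k := by exact_mod_cast h2
  have h5 : k < 1 := by exact_mod_cast h3
  omega

variable {S ι : Type*} [Fintype S] [DecidableEq S] [DecidableEq ι]
  {M : ℂ → Bool → Bool → Matrix S S ℂ} (hM : IsYangBaxter M) (vac : S → ℂ) (x : ι → ℂ)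

theorem exists_polynomial_betheVec (s : Finset ι) : ∀ τ : S, ∃ P ∈ degreeLT ℂ s.card, ∀ y,
    betheVec (hM.extend y) (extendVac vac) x s (true, τ) * Complex.exp (Complex.I * y) ^ s.card =
      Complex.exp (Complex.I * y) * P.eval (Complex.exp (Complex.I * y) ^ 2) := by
  induction s using Finset.induction_on with
  | empty =>
    intro τ
    exact ⟨0, Submodule.zero_mem _, fun y => by simp [extendVac]⟩
  | insert i s hi ih =>
    choose Q hQ hQe using ih
    intro τ
    refine ⟨∑ τ', C (M (x i) true false τ τ') * (linFactor (Real.pi / 3 - x i) * Q τ') +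
      C (Real.sqrt 3 / 2 * (M (x i) false false *ᵥ betheVec hM vac x s) τ * (-1) ^ s.card) *
        ∏ j ∈ s, linFactor (-(Real.pi / 3 + x j)), ?_, fun y => ?_⟩
    · rw [Finset.card_insert_of_notMem hi]
      refine Submodule.add_mem _ (Submodule.sum_mem _ fun τ' _ => ?_) ?_
      · rw [← smul_eq_C_mul]
        refine Submodule.smul_mem _ _ (mem_degreeLT.2 ?_)
        by_cases h : Q τ' = 0
        · rw [h, mul_zero, degree_zero]
          exact WithBot.bot_lt_coe _
        · have h1 := mem_degreeLT.1 (hQ τ')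
          rw [degree_eq_natDegree h] at h1
          have h2 : (Q τ').natDegree < s.card := by exact_mod_cast h1
          have h3 : (linFactor (Real.pi / 3 - x i) * Q τ').natDegree < s.card + 1 := by
            have h4 := natDegree_mul_le (p := linFactor (Real.pi / 3 - x i)) (q := Q τ')
            have h5 := natDegree_linFactor_le (Real.pi / 3 - x i)
            omega
          exact lt_of_le_of_lt degree_le_natDegree (by exact_mod_cast h3)
      · rw [← smul_eq_C_mul]
        refine Submodule.smul_mem _ _ (mem_degreeLT.2 ?_)
        have := Nat.lt_succ_of_le (natDegree_prod_linFactor_le s fun j => -(Real.pi / 3 + x j))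
        exact lt_of_le_of_lt degree_le_natDegree (by exact_mod_cast this)
    · have h := congrFun (betheVec_extend_true_insert hM y vac x hi) τ
      simp only [Pi.add_apply, Pi.smul_apply, smul_eq_mul] at h
      rw [h, Finset.card_insert_of_notMem hi, eval_add, eval_finsetSum, eval_mul, eval_C,
        eval_prod, add_mul, mul_add]
      simp only [eval_mul, eval_C, eval_linFactor]
      congr 1
      · rw [mulVec, dotProduct, Finset.mul_sum, Finset.sum_mul, Finset.mul_sum]
        refine Finset.sum_congr rfl fun τ' _ => ?_
        rw [pow_succ]
        have := hQe τ' y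
        rw [show (Real.pi / 3 - x i + y : ℂ) = Real.pi / 3 - (x i - y) by ring]
        linear_combination Complex.sin (Real.pi / 3 - (x i - y)) * M (x i) true false τ τ' *
          Complex.exp (Complex.I * y) * this
      · rw [Finset.prod_mul_distrib, Finset.prod_const]
        have : ∏ j ∈ s, Complex.sin (-(Real.pi / 3 + x j) + y) =
            (-1) ^ s.card * ∏ j ∈ s, Complex.sin (Real.pi / 3 + (x j - y)) := by
          rw [← Finset.prod_const, ← Finset.prod_mul_distrib]
          refine Finset.prod_congr rfl fun j _ => ?_
          rw [show (-(Real.pi / 3 + x j) + y : ℂ) = -(Real.pi / 3 + (x j - y)) by ring,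
            Complex.sin_neg]
          ring
        have hs : ((-1 : ℂ) ^ s.card) * (-1) ^ s.card = 1 := by
          rw [← mul_pow]; norm_num
        rw [this, pow_succ]
        linear_combination (-(Real.sqrt 3 / 2) * (∏ j ∈ s, Complex.sin (Real.pi / 3 + (x j - y))) *
          (M (x i) false false *ᵥ betheVec hM vac x s) τ *
          Complex.exp (Complex.I * y) ^ s.card * Complex.exp (Complex.I * y)) * hs

theorem betheVec_extend_add_sub {N : ℕ} (hv : IsVacuum M vac N) {top : S}
    (htop : ∀ w v, (M w false false *ᵥ v) top = Complex.sin (Real.pi / 3 + w) ^ N * v top)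
    {s : Finset ι} (hs : s.card = N + 1) {i : ι} (hi : i ∈ s) :
    betheVec (hM.extend (x i + Real.pi / 3)) (extendVac vac) x s (true, top) *
        (∏ j ∈ s, Complex.sin (-x j + (x i + Real.pi / 3))) *
          Complex.sin (0 + (x i + Real.pi / 3)) ^ N +
      betheVec (hM.extend (x i - Real.pi / 3)) (extendVac vac) x s (true, top) *
        (∏ j ∈ s, Complex.sin (-x j + (x i - Real.pi / 3))) *
          Complex.sin (0 + (x i - Real.pi / 3)) ^ N = 0 := by
  have hni := Finset.notMem_erase i s
  have h1 := congrFun (betheVec_extend_true_add hM vac x hv hni) top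
  have h2 := congrFun (betheVec_extend_true_sub hM vac x hni) top
  rw [Finset.insert_erase hi] at h1 h2
  simp only [Pi.smul_apply, smul_eq_mul, htop] at h1 h2
  have hcard : (s.erase i).card = N := by rw [Finset.card_erase_of_mem hi, hs]; simp
  have h3 : ∏ j ∈ s, Complex.sin (-x j + (x i + Real.pi / 3)) =
      Complex.sin (Real.pi / 3) * ∏ j ∈ s.erase i, Complex.sin (Real.pi / 3 - (x j - x i)) := by
    rw [← Finset.mul_prod_erase s _ hi]
    congr 1
    · ring_nf
    · exact Finset.prod_congr rfl fun j _ => by ring_nf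
  have h4 : ∏ j ∈ s, Complex.sin (-x j + (x i - Real.pi / 3)) =
      -Complex.sin (Real.pi / 3) * ((-1) ^ N *
        ∏ j ∈ s.erase i, Complex.sin (Real.pi / 3 + (x j - x i))) := by
    rw [← Finset.mul_prod_erase s _ hi, ← hcard, ← Finset.prod_const, ← Finset.prod_mul_distrib]
    congr 1
    · rw [← Complex.sin_neg]; ring_nf
    · refine Finset.prod_congr rfl fun j _ => ?_
      rw [neg_one_mul, ← Complex.sin_neg]; ring_nf
  have h5 : Complex.sin (0 + (x i - Real.pi / 3)) = -1 * Complex.sin (Real.pi / 3 - x i) := by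
    rw [neg_one_mul, ← Complex.sin_neg]; ring_nf
  have h6 : Complex.sin (0 + (x i + Real.pi / 3)) = Complex.sin (Real.pi / 3 + x i) := by
    ring_nf
  have hsq : ((-1 : ℂ) ^ N) * (-1) ^ N = 1 := by
    rw [← mul_pow]; norm_num
  rw [h1, h2, h3, h4, h5, h6, mul_pow]
  generalize (∏ j ∈ s.erase i, Complex.sin (Real.pi / 3 + (x j - x i))) = p1
  generalize (∏ j ∈ s.erase i, Complex.sin (Real.pi / 3 - (x j - x i))) = p2
  linear_combination (-(Real.sqrt 3 / 2) * p1 * p2 * Complex.sin (Real.pi / 3) *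
    Complex.sin (Real.pi / 3 + x i) ^ N * Complex.sin (Real.pi / 3 - x i) ^ N *
    betheVec hM vac x (s.erase i) top) * hsq

theorem betheVec_extend_ne_zero {N : ℕ} (hv : IsVacuum M vac N) {top : S}
    (htop : ∀ w v, (M w false false *ᵥ v) top = Complex.sin (Real.pi / 3 + w) ^ N * v top)
    {α : ι → ℝ} (hα : Function.Injective α) (hx : ∀ j, x j = Complex.I * α j)
    {s : Finset ι} (hs : s.card = N + 1)
    (hne : ∀ i ∈ s, betheVec hM vac x (s.erase i) top ≠ 0) :
    betheVec (hM.extend 0) (extendVac vac) x s (true, top) ≠ 0 := by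
  intro h0
  obtain ⟨Q, hQ, hQe⟩ := exists_polynomial_betheVec hM vac x s top
  set E : ℂ → ℂ := fun y => Complex.exp (Complex.I * y) with hE
  have hE0 : ∀ y, E y ≠ 0 := fun y => Complex.exp_ne_zero _
  have hQe' : ∀ y, Q.eval (E y ^ 2) =
      betheVec (hM.extend y) (extendVac vac) x s (true, top) * E y ^ N := by
    intro y
    have := hQe y
    rw [hs, pow_succ, ← mul_assoc, mul_comm _ (Complex.exp _)] at this
    exact (mul_left_cancel₀ (hE0 y) this).symm
  set P : ℂ[X] := Q * ((∏ j ∈ s, linFactor (-x j)) * linFactor 0 ^ N) with hP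
  have hPe : ∀ y, P.eval (E y ^ 2) = betheVec (hM.extend y) (extendVac vac) x s (true, top) *
      (∏ j ∈ s, Complex.sin (-x j + y)) * Complex.sin (0 + y) ^ N * E y ^ (3 * N + 1) := by
    intro y
    rw [hP, eval_mul, hQe', eval_mul, eval_prod, eval_pow]
    simp only [hE, eval_linFactor, Finset.prod_mul_distrib, Finset.prod_const, hs]
    ring
  have hr : ∀ j, ((Real.exp (-2 * α j) : ℝ) : ℂ) = E (x j) ^ 2 := by
    intro j
    simp only [hE]
    rw [hx, ← Complex.exp_nat_mul, Complex.ofReal_exp]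
    congr 1
    push_cast
    linear_combination (-2 * α j : ℂ) * Complex.I_sq
  set e : ℂ := E (Real.pi / 3) with he
  have he3 : e ^ 3 = -1 := by
    rw [he]
    simp only [hE]
    rw [← Complex.exp_nat_mul, ← Complex.exp_pi_mul_I]
    congr 1
    push_cast
    ring
  have hEadd : ∀ y z, E (y + z) = E y * E z := fun y z => by
    simp only [hE]; rw [mul_add, Complex.exp_add]
  have he1 : 1 + e ^ 2 + (e ^ 2) ^ 2 = 0 := by
    have h1 : (e + 1) * (e ^ 2 - e + 1) = 0 := by linear_combination he3
    have h2 : e + 1 ≠ 0 := by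
      intro h
      have := congrArg Complex.im (eq_neg_of_add_eq_zero_left h)
      simp only [he, hE, Complex.exp_im, Complex.neg_im, Complex.one_im, neg_zero] at this
      have hre : (Complex.I * (Real.pi / 3)).im = Real.pi / 3 := by
        simp
      rw [hre, Real.sin_pi_div_three] at this
      have h3 : (0 : ℝ) < Real.sqrt 3 := by positivity
      have h4 := Real.exp_pos (Complex.I * (Real.pi / 3)).re
      nlinarith [mul_pos h3 h4]
    have h3 := (mul_eq_zero.1 h1).resolve_left h2
    linear_combination (e ^ 2 + e + 1) * h3
  have hQdeg : Q.natDegree < N + 1 := by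
    rw [← hs]
    by_cases hQ0 : Q = 0
    · rw [hQ0, natDegree_zero, hs]; omega
    · exact (natDegree_lt_iff_degree_lt hQ0).2 (mem_degreeLT.1 hQ)
  have hPzero : P = 0 := by
    refine eq_zero_of_three_term (ζ := e ^ 2) (N := N) (s := s)
      (r := fun j => Real.exp (-2 * α j)) ?_ he1 ?_ hs (fun j => Real.exp_pos _) ?_ ?_ ?_
    · linear_combination (e ^ 3 - 1) * he3
    · have h1 := natDegree_mul_le (p := Q) (q := (∏ j ∈ s, linFactor (-x j)) * linFactor 0 ^ N)
      have h2 := natDegree_mul_le (p := ∏ j ∈ s, linFactor (-x j)) (q := linFactor 0 ^ N)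
      have h3 := natDegree_prod_linFactor_le s fun j => -x j
      have h4 := natDegree_pow_le_of_le N (natDegree_linFactor_le 0)
      rw [← hP] at h1
      omega
    · intro j k h
      have := Real.exp_injective h
      exact hα (by linarith)
    · intro i hi
      simp only [hr]
      have hp : E (x i + Real.pi / 3) = E (x i) * e := hEadd _ _
      have hm : E (x i - Real.pi / 3) = -E (x i) * e ^ 2 := by
        have h1 : E (x i - Real.pi / 3) * e = E (x i) := by rw [he, ← hEadd]; ring_nf
        have h2 : e ≠ 0 := hE0 _
        refine mul_right_cancel₀ h2 ?_
        rw [h1]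
        linear_combination (E (x i)) * he3
      have h1 : P.eval (E (x i) ^ 2) = 0 := by
        rw [hPe, Finset.prod_eq_zero hi (by simp)]
        ring
      have h2 := hPe (x i + Real.pi / 3)
      have h3 := hPe (x i - Real.pi / 3)
      have h4 := betheVec_extend_add_sub hM vac x hv htop hs hi
      rw [hp] at h2
      rw [hm] at h3
      rw [h1, zero_add, show e ^ 2 * E (x i) ^ 2 = (E (x i) * e) ^ 2 by ring, h2,
        show (e ^ 2) ^ 2 * E (x i) ^ 2 = (-E (x i) * e ^ 2) ^ 2 by ring, h3]
      have h5 : e ^ (3 * N) = (-1) ^ N := by rw [pow_mul, he3]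
      have h6 : (e ^ 2) ^ (3 * N) = 1 := by
        rw [← pow_mul, mul_comm, mul_assoc, mul_comm N, ← mul_assoc, mul_comm 3, mul_assoc,
          mul_comm 2, pow_mul, h5, ← pow_mul]
        simp
      have h7 : (-1 : ℂ) ^ (3 * N) = (-1) ^ N := by rw [pow_mul]; norm_num
      rw [pow_succ (E (x i) * e) (3 * N), pow_succ (-E (x i) * e ^ 2) (3 * N), mul_pow (E (x i)) e,
        mul_pow (-E (x i)), neg_pow (E (x i)), h5, h6, h7]
      have h8 : (e ^ 2) ^ 2 * e ^ 2 = 1 := by linear_combination (e ^ 3 - 1) * he3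
      have h9 : e ^ 2 * e = -1 := by linear_combination he3
      linear_combination (E (x i) ^ (3 * N) * (-1) ^ N * E (x i)) * (-h4 +
        (betheVec (hM.extend (x i + Real.pi / 3)) (extendVac vac) x s (true, top) *
        (∏ j ∈ s, Complex.sin (-x j + (x i + Real.pi / 3))) *
          Complex.sin (0 + (x i + Real.pi / 3)) ^ N) * h9 -
        (betheVec (hM.extend (x i - Real.pi / 3)) (extendVac vac) x s (true, top) *
        (∏ j ∈ s, Complex.sin (-x j + (x i - Real.pi / 3))) *
          Complex.sin (0 + (x i - Real.pi / 3)) ^ N) * h8)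
    · rw [hP, pow_succ', ← mul_assoc, mul_comm (∏ i ∈ s, _) (X - C 1), mul_assoc]
      refine mul_dvd_mul (dvd_iff_isRoot.2 ?_) (mul_dvd_mul
        (Finset.prod_dvd_prod_of_dvd _ _ fun j _ => ?_) (pow_dvd_pow_of_dvd ?_ _))
      · have := hQe' 0
        rw [h0, zero_mul] at this
        simpa [hE] using this
      · convert X_sub_C_dvd_linFactor (-x j) using 3
        rw [hr]
        simp only [hE]
        rw [← Complex.exp_nat_mul]
        congr 1
        push_cast
        ring
      · simpa using X_sub_C_dvd_linFactor 0
  have hQ0 : Q = 0 := by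
    refine (mul_eq_zero.1 hPzero).resolve_right (mul_ne_zero ?_ (pow_ne_zero _ ?_))
    · exact Finset.prod_ne_zero_iff.2 fun j _ => linFactor_ne_zero _
    · exact linFactor_ne_zero _
  obtain ⟨i, hi⟩ : s.Nonempty := Finset.card_pos.1 (by omega)
  have h1 := congrFun (betheVec_extend_true_add hM vac x hv (Finset.notMem_erase i s)) top
  rw [Finset.insert_erase hi] at h1
  have h2 := hQe' (x i + Real.pi / 3)
  rw [hQ0, eval_zero, h1] at h2
  have hpi := Real.pi_pos
  have hre : ∀ z : ℂ, z.re = Real.pi / 3 → Complex.sin z ≠ 0 := fun z hz =>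
    sin_ne_zero_of_re (by rw [hz]; positivity) (by rw [hz]; linarith)
  have hxre : ∀ j, (x j).re = 0 := fun j => by rw [hx]; simp
  have hpi3 : ((Real.pi : ℂ) / 3).re = Real.pi / 3 := by
    rw [show ((Real.pi : ℂ) / 3) = ((Real.pi / 3 : ℝ) : ℂ) by push_cast; rfl, Complex.ofReal_re]
  refine absurd h2.symm (mul_ne_zero (mul_ne_zero (mul_ne_zero (mul_ne_zero ?_ (pow_ne_zero _ ?_))
    ?_) (hne i hi)) (pow_ne_zero _ (hE0 _)))
  · exact div_ne_zero sqrt_three_ne_zero two_ne_zero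
  · exact hre _ (by simp [hpi3, hxre])
  · exact Finset.prod_ne_zero_iff.2 fun j _ => hre _ (by simp [hpi3, hxre])

end Nonvanishing

section Chain

open Matrix

/-- The monodromy of `L` homogeneous sites. -/
noncomputable def chain (L : ℕ) (w : ℂ) : Bool → Bool → Matrix (Row L) (Row L) ℂ :=
  mono (vertexOp w) L

theorem chain_isYangBaxter (L : ℕ) : IsYangBaxter (chain L) :=
  fun u v => (vertexOp_intertwines u v).mono L

theorem chain_succ (L : ℕ) :
    chain (L + 1) = (extend 0 (chain L) : ℂ → Bool → Bool → Matrix (Bool × Row L) _ ℂ) := by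
  funext w
  simp only [extend, sub_zero]
  rfl

/-- The row of `L` edges of which the last `n` are occupied. -/
def stackedRow (n : ℕ) : (L : ℕ) → Row L
  | 0 => ()
  | L + 1 => (decide (L < n), stackedRow n L)

/-- The vector supported on the row of empty edges. -/
def vacuum : (L : ℕ) → Row L → ℂ
  | 0 => fun _ => 1
  | L + 1 => extendVac (vacuum L)

theorem betheVec_congr {S ι : Type*} [Fintype S] [DecidableEq S]
    {T T' : ℂ → Bool → Bool → Matrix S S ℂ} (hT : IsYangBaxter T) (hT' : IsYangBaxter T')
    (h : T = T') (vac : S → ℂ) (x : ι → ℂ) (s : Finset ι) :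
    betheVec hT vac x s = betheVec hT' vac x s := by
  subst h
  rfl

theorem betheVec_chain_succ {ι : Type*} (L : ℕ) (x : ι → ℂ) (s : Finset ι) (σ : Bool × Row L) :
    betheVec (chain_isYangBaxter (L + 1)) (vacuum (L + 1)) x s σ =
      betheVec ((chain_isYangBaxter L).extend 0) (extendVac (vacuum L)) x s σ :=
  congrFun (betheVec_congr (S := Bool × Row L) (chain_isYangBaxter (L + 1))
    ((chain_isYangBaxter L).extend 0) (chain_succ L) (extendVac (vacuum L)) x s) σ

theorem chain_isVacuum (L : ℕ) : IsVacuum (chain L) (vacuum L) L := by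
  induction L with
  | zero =>
    constructor <;> intro w
    · simp [chain, mono]
    · simp [chain, mono]
    · simp [chain, mono]
  | succ L ih =>
    have := ih.extend
    rw [← chain_succ L] at this
    exact this

theorem chain_false_false_mulVec_stackedRow {n L : ℕ} (h : L ≤ n) (w : ℂ) (v : Row L → ℂ) :
    (chain L w false false *ᵥ v) (stackedRow n L) =
      Complex.sin (Real.pi / 3 + w) ^ L * v (stackedRow n L) := by
  induction L with
  | zero => simp [chain, mono]
  | succ L ih =>
    have h1 := extend_false_false_mulVec_true 0 (chain L) w v (stackedRow n L)
    rw [← chain_succ L, sub_zero, ih (by omega)] at h1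
    have h2 : stackedRow n (L + 1) = (true, stackedRow n L) :=
      congrArg (fun b => ((b, stackedRow n L) : Bool × Row L)) (decide_eq_true (show L < n by omega))
    rw [h2, pow_succ', mul_assoc]
    exact h1

theorem betheVec_chain_ne_zero {ι : Type*} [DecidableEq ι] {α : ι → ℝ}
    (hα : Function.Injective α) {x : ι → ℂ} (hx : ∀ j, x j = Complex.I * α j) (n L : ℕ)
    (s : Finset ι) (hs : s.card = min n L) :
    betheVec (chain_isYangBaxter L) (vacuum L) x s (stackedRow n L) ≠ 0 := by
  induction L generalizing s with
  | zero =>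
    have : s = ∅ := by simpa using hs
    subst this
    simp [vacuum]
  | succ L ih =>
    rcases Nat.lt_or_ge L n with h | h
    · have h2 : stackedRow n (L + 1) = (true, stackedRow n L) :=
      congrArg (fun b => ((b, stackedRow n L) : Bool × Row L)) (decide_eq_true h)
      rw [h2, betheVec_chain_succ]
      refine betheVec_extend_ne_zero _ _ _ (chain_isVacuum L)
        (chain_false_false_mulVec_stackedRow h.le) hα hx (by omega) fun i hi => ih _ ?_
      rw [Finset.card_erase_of_mem hi]
      omega
    · have h2 : stackedRow n (L + 1) = (false, stackedRow n L) :=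
      congrArg (fun b => ((b, stackedRow n L) : Bool × Row L)) (decide_eq_false (show ¬ L < n by omega))
      rw [h2, betheVec_chain_succ]
      have h3 := congrFun (betheVec_extend_false (chain_isYangBaxter L) 0 (vacuum L) x s)
        (stackedRow n L)
      rw [h3]
      refine mul_ne_zero (Finset.prod_ne_zero_iff.2 fun j _ => ?_) (ih s (by omega))
      rw [hx]
      apply sin_ne_zero_of_re <;> simp <;> linarith [Real.pi_pos]

end Chain

section Counting

open Matrix

/-- Rows of vertical edges as functions. -/
def rowEquiv : (L : ℕ) → (Fin L → Bool) ≃ Row L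
  | 0 => (Equiv.ofUnique (Fin 0 → Bool) Unit : (Fin 0 → Bool) ≃ Unit)
  | L + 1 => ((Fin.consEquiv fun _ => Bool).symm.trans
      ((Equiv.refl Bool).prodCongr (rowEquiv L)) : (Fin (L + 1) → Bool) ≃ Bool × Row L)

theorem sum_fin_succ {S R : Type*} [Fintype S] [AddCommMonoid R] (n : ℕ)
    (F : (Fin (n + 1) → S) → R) :
    ∑ h, F h = ∑ h : Fin n → S, ∑ a, F (Fin.cons a h) := by
  rw [← (Fin.consEquiv fun _ => S).sum_comp, Fintype.sum_prod_type, Finset.sum_comm]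
  rfl

theorem mono_succ_apply {R : Type*} [CommSemiring R] (l : Bool → Bool → Matrix Bool Bool R) (L : ℕ)
    (p q σ τ : Bool) (σ' τ' : Row L) :
    mono l (L + 1) p q ((σ, σ') : Bool × Row L) ((τ, τ') : Bool × Row L) =
      ∑ k, l p k σ τ * mono l L k q σ' τ' :=
  Matrix.sum_apply (m := Bool × Row L) (n := Bool × Row L) (σ, σ') (τ, τ') Finset.univ
    fun k => kroneckerMap (· * ·) (l p k) (mono l L k q)

theorem sum_mul_mono {R : Type*} [CommSemiring R] (l : Bool → Bool → Matrix Bool Bool R) (L : ℕ)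
    (s t : Fin L → Bool) (f : Bool → R) :
    ∑ p, ∑ q, f p * mono l L p q (rowEquiv L s) (rowEquiv L t) =
      ∑ h : Fin (L + 1) → Bool,
        f (h 0) * ∏ j : Fin L, l (h j.castSucc) (h j.succ) (s j) (t j) := by
  induction L generalizing f with
  | zero =>
    rw [sum_fin_succ]
    have : rowEquiv 0 s = rowEquiv 0 t := congrArg _ (Subsingleton.elim _ _)
    simp [mono, this]
  | succ L ih =>
    obtain ⟨σ, s, rfl⟩ : ∃ σ s', s = Fin.cons σ s' := ⟨s 0, Fin.tail s, (Fin.cons_self_tail s).symm⟩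
    obtain ⟨τ, t, rfl⟩ : ∃ τ t', t = Fin.cons τ t' := ⟨t 0, Fin.tail t, (Fin.cons_self_tail t).symm⟩
    rw [sum_fin_succ]
    simp only [Fin.prod_univ_succ, Fin.cons_zero, Fin.castSucc_zero, Fin.cons_succ,
      ← Fin.succ_castSucc, ← mul_assoc, ← Finset.sum_mul]
    rw [← ih s t fun k => ∑ a, f a * l a k σ τ]
    have h1 : ∀ p q, mono l (L + 1) p q (rowEquiv (L + 1) (Fin.cons σ s))
        (rowEquiv (L + 1) (Fin.cons τ t)) =
        ∑ k, l p k σ τ * mono l L k q (rowEquiv L s) (rowEquiv L t) :=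
      fun p q => mono_succ_apply l L p q σ τ _ _
    simp only [h1, Fintype.sum_bool]
    ring

theorem sum_mul_pow {S R : Type*} [Fintype S] [DecidableEq S] [CommSemiring R] (P : Matrix S S R)
    (n : ℕ) (f : S → R) :
    ∑ σ, ∑ τ, f σ * (P ^ n) σ τ = ∑ h : Fin (n + 1) → S,
        f (h 0) * ∏ j : Fin n, P (h j.castSucc) (h j.succ) := by
  induction n generalizing f with
  | zero =>
    rw [sum_fin_succ]
    simp [Matrix.one_apply]
  | succ n ih =>
    rw [sum_fin_succ]
    simp only [Fin.prod_univ_succ, Fin.cons_zero, Fin.castSucc_zero, Fin.cons_succ,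
      ← Fin.succ_castSucc, ← mul_assoc, ← Finset.sum_mul]
    rw [← ih fun k => ∑ a, f a * P a k]
    simp only [pow_succ', mul_apply, Finset.mul_sum, Finset.sum_mul, ← mul_assoc]
    rw [Finset.sum_comm]
    conv_rhs => rw [Finset.sum_comm]
    refine Finset.sum_congr rfl fun τ _ => ?_
    rw [Finset.sum_comm]

/-- The value of a crease encoded by a state. -/
def edgeSign (b : Bool) : ℤ := if b then 1 else -1

theorem edgeSign_injective : Function.Injective edgeSign := by decide

theorem edgeSign_eq (b : Bool) : edgeSign b = 1 ∨ edgeSign b = -1 := by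
  cases b <;> decide

/-- A choice of states for the vertical and horizontal edges of a grid of `N × N` vertices. -/
abbrev EdgeStates (N : ℕ) : Type :=
  (Fin (N + 1) → Fin N → Bool) × (Fin N → Fin (N + 1) → Bool)

/-- The assignment of a choice of states, with every other row of vertical creases flipped. -/
def EdgeStates.toAssignment {N : ℕ} (x : EdgeStates N) : Crease (N + 1) (N + 1) → ℤ
  | .vert i j hi hj => (-1) ^ i * edgeSign (x.1 ⟨i, hi⟩ ⟨j, by omega⟩)
  | .horiz i j hi hj => edgeSign (x.2 ⟨i, by omega⟩ ⟨j, hj⟩)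

/-- The ice rule. -/
def IsIce (p q σ τ : Bool) : Prop := (p = q ∧ σ = τ) ∨ (p = σ ∧ q = τ)

instance IsIce.instDecidable (p q : Bool) : DecidableRel (IsIce p q) := fun _ _ => inferInstanceAs (Decidable (_ ∨ _))

theorem site_one {R : Type*} [Zero R] [One R] (p q σ τ : Bool) :
    site (1 : R) 1 1 p q σ τ = if IsIce p q σ τ then 1 else 0 := by
  simp only [site, IsIce, ite_self]
  by_cases h : p = q ∧ σ = τ <;> by_cases h' : p = σ ∧ q = τ <;> simp [h, h']

theorem isIce_iff (p q σ τ : Bool) : IsIce p q σ τ ↔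
    edgeSign σ + edgeSign q = edgeSign τ + edgeSign p := by
  revert p q σ τ
  decide

theorem EdgeStates.toAssignment_injective (N : ℕ) :
    Function.Injective (toAssignment (N := N)) := by
  rintro ⟨v, h⟩ ⟨v', h'⟩ e
  congr 1
  · funext i j
    have := congrFun e (.vert i j i.2 (by omega))
    exact edgeSign_injective (mul_left_cancel₀ (pow_ne_zero _ (by decide)) this)
  · funext i j
    exact edgeSign_injective (congrFun e (.horiz i j (by omega) j.2))

theorem EdgeStates.isMV_toAssignment {N : ℕ} (x : EdgeStates N) : IsMV x.toAssignment := by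
  rintro (⟨i, j, hi, hj⟩ | ⟨i, j, hi, hj⟩) <;> simp only [toAssignment]
  · rcases neg_one_pow_eq_or ℤ i with h | h <;> rw [h] <;>
      rcases edgeSign_eq (x.1 ⟨i, hi⟩ ⟨j, by omega⟩) with h' | h' <;> rw [h'] <;> decide
  · exact edgeSign_eq _

theorem EdgeStates.exists_toAssignment_eq {N : ℕ} {μ : Crease (N + 1) (N + 1) → ℤ} (h : IsMV μ) :
    ∃ x : EdgeStates N, x.toAssignment = μ := by
  refine ⟨(fun i j => decide (μ (.vert i j i.2 (by omega)) = (-1) ^ i.1),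
    fun i j => decide (μ (.horiz i j (by omega) j.2) = 1)), ?_⟩
  funext e
  rcases e with ⟨i, j, hi, hj⟩ | ⟨i, j, hi, hj⟩
  · rcases h (.vert i j hi hj) with h | h <;> rcases neg_one_pow_eq_or ℤ i with h' | h' <;>
      simp [toAssignment, h, h', edgeSign]
  · rcases h (.horiz i j hi hj) with h | h <;> simp [toAssignment, h, edgeSign]

theorem EdgeStates.flatFoldable_toAssignment_iff {N : ℕ} (x : EdgeStates N) :
    FlatFoldable x.toAssignment ↔ ∀ i j : Fin N,
      IsIce (x.2 i j.castSucc) (x.2 i j.succ) (x.1 i.castSucc j) (x.1 i.succ j) := by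
  constructor
  · rintro ⟨-, h⟩ i j
    have := (h i j (by omega) (by omega)).2
    rw [isIce_iff]
    change edgeSign (x.1 ⟨i, _⟩ ⟨j, _⟩) + edgeSign (x.2 ⟨i, _⟩ ⟨j + 1, _⟩) =
      edgeSign (x.1 ⟨i + 1, _⟩ ⟨j, _⟩) + edgeSign (x.2 ⟨i, _⟩ ⟨j, _⟩)
    rcases Nat.even_or_odd i.1 with hi | hi
    · rw [if_pos (Nat.even_iff.1 hi)] at this
      simp only [toAssignment, pow_succ, hi.neg_one_pow] at this
      linarith
    · rw [if_neg (by rw [Nat.odd_iff.1 hi]; decide)] at this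
      simp only [toAssignment, pow_succ, hi.neg_one_pow] at this
      linarith
  · intro h
    refine ⟨x.isMV_toAssignment, fun i j hi hj => ?_⟩
    have := h ⟨i, by omega⟩ ⟨j, by omega⟩
    rw [isIce_iff] at this
    change edgeSign (x.1 ⟨i, _⟩ ⟨j, _⟩) + edgeSign (x.2 ⟨i, _⟩ ⟨j + 1, _⟩) =
      edgeSign (x.1 ⟨i + 1, _⟩ ⟨j, _⟩) + edgeSign (x.2 ⟨i, _⟩ ⟨j, _⟩) at this
    refine (and_iff_right_of_imp fun h => ?_).2 ?_
    · rw [← h]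
      rcases x.isMV_toAssignment (if i % 2 = 0 then Crease.horiz i j hi (by omega)
        else Crease.horiz i (j+1) hi hj) with h | h <;> rw [h] <;> decide
    · rcases Nat.even_or_odd i with hi | hi
      · rw [if_pos (Nat.even_iff.1 hi)]
        simp only [toAssignment, pow_succ, hi.neg_one_pow]
        linarith
      · rw [if_neg (by rw [Nat.odd_iff.1 hi]; decide)]
        simp only [toAssignment, pow_succ, hi.neg_one_pow]
        linarith

open Classical in
/-- The number of locally flat-foldable assignments as a partition function. -/
theorem card_flatFoldable {R : Type*} [CommSemiring R] (N : ℕ) :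
    (Nat.card {μ : Crease (N + 1) (N + 1) → ℤ // FlatFoldable μ} : R) =
      ∑ σ, ∑ τ, ((∑ p, ∑ q, mono (site (1 : R) 1 1) N p q) ^ N) σ τ := by
  have e : {x : EdgeStates N // ∀ i j : Fin N,
      IsIce (x.2 i j.castSucc) (x.2 i j.succ) (x.1 i.castSucc j) (x.1 i.succ j)} ≃
      {μ : Crease (N + 1) (N + 1) → ℤ // FlatFoldable μ} := by
    refine Equiv.ofBijective (fun x => ⟨x.1.toAssignment, x.1.flatFoldable_toAssignment_iff.2 x.2⟩)
      ⟨fun x y h => Subtype.ext (EdgeStates.toAssignment_injective N (congrArg Subtype.val h)),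
        fun μ => ?_⟩
    obtain ⟨x, hx⟩ := EdgeStates.exists_toAssignment_eq μ.2.1
    exact ⟨⟨x, x.flatFoldable_toAssignment_iff.1 (hx ▸ μ.2)⟩, Subtype.ext hx⟩
  rw [← Nat.card_congr e, Nat.card_eq_fintype_card, Fintype.card_subtype,
    Finset.card_filter, Nat.cast_sum, Fintype.sum_prod_type]
  have h1 := sum_mul_pow (∑ p, ∑ q, mono (site (1 : R) 1 1) N p q) N fun _ => 1
  simp only [one_mul] at h1
  rw [h1, ← (Equiv.arrowCongr (Equiv.refl (Fin (N + 1))) (rowEquiv N)).sum_comp]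
  refine Finset.sum_congr rfl fun v _ => ?_
  have h2 : ∀ i : Fin N, (∑ p, ∑ q, mono (site (1 : R) 1 1) N p q)
      (rowEquiv N (v i.castSucc)) (rowEquiv N (v i.succ)) = ∑ h : Fin (N + 1) → Bool,
        ∏ j : Fin N, site (1 : R) 1 1 (h j.castSucc) (h j.succ) (v i.castSucc j) (v i.succ j) := by
    intro i
    have := sum_mul_mono (site (1 : R) 1 1) N (v i.castSucc) (v i.succ) fun _ => 1
    simp only [one_mul] at this
    rw [← this]
    simp only [Matrix.sum_apply]
  simp only [Equiv.arrowCongr_apply, Equiv.refl_symm, Equiv.coe_refl, Function.comp_apply, id, h2]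
  rw [Finset.prod_univ_sum, Fintype.piFinset_univ]
  refine Finset.sum_congr rfl fun h _ => ?_
  simp only [site_one, Finset.prod_boole, Finset.mem_univ, true_imp_iff]
  split_ifs <;> simp

end Counting

section Strip

theorem norm_sin_sq (z : ℂ) :
    ‖Complex.sin z‖ ^ 2 = Real.sin z.re ^ 2 + Real.sinh z.im ^ 2 := by
  rw [← Complex.normSq_eq_norm_sq, Complex.normSq_apply, Complex.sin_eq]
  simp only [← Complex.ofReal_sin, ← Complex.ofReal_cos, ← Complex.ofReal_sinh,
    ← Complex.ofReal_cosh, Complex.add_re, Complex.add_im, Complex.mul_re, Complex.mul_im,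
    Complex.ofReal_re, Complex.ofReal_im, Complex.I_re, Complex.I_im]
  have h1 := Real.cosh_sq z.im
  have h2 := Real.sin_sq_add_cos_sq z.re
  ring_nf
  rw [h1]
  linear_combination (Real.sinh z.im ^ 2) * h2

theorem norm_cos_sq (z : ℂ) :
    ‖Complex.cos z‖ ^ 2 = Real.cos z.re ^ 2 + Real.sinh z.im ^ 2 := by
  rw [← Complex.sin_add_pi_div_two, norm_sin_sq]
  simp [← Complex.ofReal_ofNat, ← Complex.ofReal_div, Real.sin_add_pi_div_two]

theorem norm_sin_le (z : ℂ) : ‖Complex.sin z‖ ≤ Real.exp |z.im| := by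
  refine (abs_le_of_sq_le_sq' ?_ (Real.exp_pos _).le).2
  have h1 := Real.sin_sq_le_one z.re
  have h2 := Real.cosh_sq z.im
  have h3 : Real.cosh z.im ≤ Real.exp |z.im| := by
    rw [← Real.cosh_abs, Real.cosh_eq]
    have : Real.exp (-|z.im|) ≤ Real.exp |z.im| := Real.exp_le_exp.2 (by linarith [abs_nonneg z.im])
    linarith
  have h4 := Real.cosh_pos z.im
  rw [norm_sin_sq]
  nlinarith

/-- Phragmén–Lindelöf on the strip `|re z| ≤ π / 3`. -/
theorem norm_le_of_strip {f : ℂ → ℂ} {C D K : ℝ}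
    (hf : ∀ z : ℂ, |z.re| ≤ Real.pi / 3 → DifferentiableAt ℂ f z)
    (hK : ∀ z : ℂ, |z.re| ≤ Real.pi / 3 → ‖f z‖ ≤ D * Real.exp (K * |z.im|))
    (hC : ∀ z : ℂ, |z.re| = Real.pi / 3 → ‖f z‖ ≤ C) : ‖f 0‖ ≤ C := by
  have hpi := Real.pi_pos
  refine PhragmenLindelof.vertical_strip (a := -(Real.pi / 3)) (b := Real.pi / 3) ?_ ?_
    (fun z hz => hC z ?_) (fun z hz => hC z ?_) ?_ ?_
  · refine DifferentiableOn.diffContOnCl fun z hz => (hf z ?_).differentiableWithinAt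
    have := closure_minimal (Set.preimage_mono (f := Complex.re) Set.Ioo_subset_Icc_self)
      (isClosed_Icc.preimage Complex.continuous_re) hz
    exact abs_le.2 this
  · refine ⟨1, ?_, |K|, ?_⟩
    · rw [lt_div_iff₀ (by linarith)]
      linarith
    · refine Asymptotics.IsBigO.of_bound |D| ?_
      refine Filter.eventually_inf_principal.2 (Filter.Eventually.of_forall fun z hz => ?_)
      rw [Real.norm_of_nonneg (Real.exp_pos _).le]
      refine (hK z (abs_le.2 ⟨hz.1.le, hz.2.le⟩)).trans ?_
      gcongr
      · exact le_abs_self D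
      · exact le_abs_self K
      · rw [one_mul]
        linarith [Real.add_one_le_exp |z.im|]
  · rw [hz, abs_neg, abs_of_pos (by positivity)]
  · rw [hz, abs_of_pos (by positivity)]
  · simp; positivity
  · simp; positivity

/-- The comparison function: the inverse bulk partition function per site, up to normalization. -/
noncomputable def bulk (w : ℂ) : ℂ :=
  2 * Complex.cos (w / 2) * (Complex.cos (w / 2) + 1) * (2 * Complex.cos (w / 2) - 1) /
    (2 * Complex.cos (w / 2) + 1)

theorem bulk_zero : bulk 0 = 4 / 3 := by
  simp [bulk]
  norm_num

theorem le_re_cos_half {w : ℂ} (h : |w.re| ≤ Real.pi / 3) :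
    Real.sqrt 3 / 2 ≤ (Complex.cos (w / 2)).re := by
  have h1 : (Complex.cos (w / 2)).re = Real.cos (w.re / 2) * Real.cosh (w.im / 2) := by
    rw [Complex.cos_eq]
    have h1 : (w / 2).re = w.re / 2 := by simp
    have h2 : (w / 2).im = w.im / 2 := by simp
    rw [h1, h2]
    simp only [← Complex.ofReal_sin, ← Complex.ofReal_cos, ← Complex.ofReal_sinh,
      ← Complex.ofReal_cosh, Complex.sub_re, Complex.mul_re, Complex.mul_im,
    Complex.ofReal_re, Complex.ofReal_im, Complex.I_re, Complex.I_im]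
    ring
  have h2 : Real.sqrt 3 / 2 ≤ Real.cos (w.re / 2) := by
    rw [← Real.cos_pi_div_six, ← Real.cos_abs (w.re / 2)]
    have := Real.pi_pos
    apply Real.cos_le_cos_of_nonneg_of_le_pi (abs_nonneg _) (by linarith)
    rw [abs_div, abs_two]
    linarith
  have h3 := Real.one_le_cosh (w.im / 2)
  have h4 : 0 ≤ Real.sqrt 3 / 2 := by positivity
  rw [h1]
  nlinarith

theorem three_halves_lt_sqrt_three : 3 / 2 < Real.sqrt 3 := by
  rw [Real.lt_sqrt (by norm_num)]; norm_num

theorem norm_inv_bulk_le {w : ℂ} (h : |w.re| ≤ Real.pi / 3) : ‖(bulk w)⁻¹‖ ≤ 4 := by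
  have h1 := le_re_cos_half h
  have h2 := three_halves_lt_sqrt_three
  set c := Complex.cos (w / 2) with hc
  have e1 : c.re ≤ ‖c‖ := Complex.re_le_norm _
  have e2 : (c + 1).re ≤ ‖c + 1‖ := Complex.re_le_norm _
  have e3 : (2 * c - 1).re ≤ ‖2 * c - 1‖ := Complex.re_le_norm _
  have e4 : ‖2 * c + 1‖ ≤ 2 * ‖c‖ + 1 := (norm_add_le _ _).trans (by simp)
  simp at e2 e3
  rw [bulk, ← hc, inv_div, norm_div, norm_mul, norm_mul, norm_mul, Complex.norm_two,
    div_le_iff₀ (by apply mul_pos (mul_pos _ _) <;> linarith)]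
  have e5 : 1 * (1 / 2) ≤ ‖c + 1‖ * ‖2 * c - 1‖ := by
    apply mul_le_mul <;> first | positivity | linarith
  nlinarith

theorem differentiableAt_inv_bulk {w : ℂ} (h : |w.re| ≤ Real.pi / 3) :
    DifferentiableAt ℂ (fun w => (bulk w)⁻¹) w := by
  have h1 := le_re_cos_half h
  have h2 := three_halves_lt_sqrt_three
  have hne : ∀ z : ℂ, 0 < z.re → z ≠ 0 := by
    rintro z hz rfl
    simp at hz
  have e1 : Complex.cos (w / 2) ≠ 0 := hne _ (by linarith)
  have e2 : Complex.cos (w / 2) + 1 ≠ 0 := hne _ (by simp; linarith)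
  have e3 : 2 * Complex.cos (w / 2) - 1 ≠ 0 := hne _ (by simp; linarith)
  simp only [bulk, inv_div]
  exact DifferentiableAt.div (by fun_prop) (by fun_prop)
    (mul_ne_zero (mul_ne_zero (mul_ne_zero two_ne_zero e1) e2) e3)

theorem bulk_ne_zero {w : ℂ} (h : |w.re| ≤ Real.pi / 3) : bulk w ≠ 0 := by
  have h1 := le_re_cos_half h
  have h2 := three_halves_lt_sqrt_three
  have hne : ∀ z : ℂ, 0 < z.re → z ≠ 0 := by
    rintro z hz rfl
    simp at hz
  have e1 : Complex.cos (w / 2) ≠ 0 := hne _ (by linarith)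
  have e2 : Complex.cos (w / 2) + 1 ≠ 0 := hne _ (by simp; linarith)
  have e3 : 2 * Complex.cos (w / 2) - 1 ≠ 0 := hne _ (by simp; linarith)
  have e4 : 2 * Complex.cos (w / 2) + 1 ≠ 0 := hne _ (by simp; linarith)
  exact div_ne_zero (mul_ne_zero (mul_ne_zero (mul_ne_zero two_ne_zero e1) e2) e3) e4

theorem bulk_mul_sin (w : ℂ) (h : 2 * Complex.cos (w / 2) + 1 ≠ 0) :
    bulk w * Complex.sin (3 * (w / 2)) = Complex.sin w * (1 + Complex.cos (3 * (w / 2))) := by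
  have h1 : Complex.sin w = 2 * Complex.sin (w / 2) * Complex.cos (w / 2) := by
    rw [← Complex.sin_two_mul]; ring_nf
  rw [h1, Complex.sin_three_mul, Complex.cos_three_mul, bulk, div_mul_eq_mul_div, div_eq_iff h]
  linear_combination (-8 * Complex.cos (w / 2) * (Complex.cos (w / 2) + 1) *
    (2 * Complex.cos (w / 2) - 1) * Complex.sin (w / 2)) * Complex.sin_sq_add_cos_sq (w / 2)

theorem norm_bulk_sq {w : ℂ} (h : |w.re| = Real.pi / 3) :
    ‖bulk w‖ ^ 2 = 3 / 4 + Real.sinh w.im ^ 2 := by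
  have hpi := Real.pi_pos
  have h1 := le_re_cos_half h.le
  have h2 := three_halves_lt_sqrt_three
  have hne : 2 * Complex.cos (w / 2) + 1 ≠ 0 := by
    intro h0
    have := congrArg Complex.re h0
    simp at this
    linarith
  have key := congrArg (fun z => ‖z‖ ^ 2) (bulk_mul_sin w hne)
  have h3 : |(3 * (w / 2)).re| = Real.pi / 2 := by
    have : (3 * (w / 2)).re = 3 / 2 * w.re := by simp; ring
    rw [this, abs_mul, h, abs_of_pos (by norm_num)]
    ring
  have h5 : Real.cos (3 * (w / 2)).re = 0 := by
    rw [← Real.cos_abs, h3, Real.cos_pi_div_two]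
  have h4 : Real.sin (3 * (w / 2)).re ^ 2 = 1 := by
    rw [Real.sin_sq, h5]
    norm_num
  have h6 : ‖1 + Complex.cos (3 * (w / 2))‖ ^ 2 = 1 + Real.sinh (3 * (w / 2)).im ^ 2 := by
    generalize 3 * (w / 2) = z at h4 h5
    rw [Complex.cos_eq, ← Complex.normSq_eq_norm_sq, Complex.normSq_apply]
    simp only [← Complex.ofReal_sin, ← Complex.ofReal_cos, ← Complex.ofReal_sinh,
      ← Complex.ofReal_cosh, h5, Complex.add_re, Complex.add_im, Complex.sub_re, Complex.sub_im,
      Complex.mul_re, Complex.mul_im, Complex.ofReal_re, Complex.ofReal_im, Complex.I_re,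
      Complex.I_im, Complex.one_re, Complex.one_im]
    linear_combination (Real.sinh z.im ^ 2) * h4
  have h7 : Real.sin w.re ^ 2 = 3 / 4 := by
    rw [Real.sin_sq, ← Real.cos_abs, h, Real.cos_pi_div_three]
    norm_num
  simp only [norm_mul, mul_pow] at key
  rw [h6, norm_sin_sq, norm_sin_sq, h4, h7] at key
  exact mul_right_cancel₀ (by positivity) key

end Strip

section UpperBound

open Matrix

/-- The family `M`, seen as an operator from right and incoming edges to left and outgoing edges,
has squared operator norm at most `s`. -/
def SqNormLE {S : Type*} [Fintype S] (M : Bool → Bool → Matrix S S ℂ) (s : ℝ) : Prop :=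
  ∀ v : Bool → S → ℂ, ∑ p, ∑ σ, ‖∑ q, (M p q *ᵥ v q) σ‖ ^ 2 ≤ s * ∑ q, ∑ τ, ‖v q τ‖ ^ 2

theorem SqNormLE.glue {S S' : Type*} [Fintype S] [Fintype S'] {l : Bool → Bool → Matrix S S ℂ}
    {M : Bool → Bool → Matrix S' S' ℂ} {s t : ℝ} (hs : 0 ≤ s) (hl : SqNormLE l s)
    (hM : SqNormLE M t) : SqNormLE (glue l M) (s * t) := by
  intro v
  have h1 : ∀ p (σ : S × S'), ∑ q, (Miura.glue l M p q *ᵥ v q) σ =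
      ∑ k, (l p k *ᵥ fun τ : S => ∑ q, (M k q *ᵥ fun τ' => v q (τ, τ')) σ.2) σ.1 := by
    intro p σ
    simp only [glue_mulVec]
    rw [Finset.sum_comm]
    refine Finset.sum_congr rfl fun k _ => ?_
    rw [Finset.sum_comm]
    simp only [mulVec, dotProduct, Finset.mul_sum]
  simp only [h1]
  calc _ = ∑ σ', ∑ p, ∑ σ, ‖∑ k, (l p k *ᵥ
            fun τ => ∑ q, (M k q *ᵥ fun τ' => v q (τ, τ')) σ') σ‖ ^ 2 := by
        rw [Finset.sum_comm (s := (Finset.univ : Finset S'))]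
        refine Finset.sum_congr rfl fun p _ => ?_
        rw [Fintype.sum_prod_type, Finset.sum_comm]
    _ ≤ ∑ σ', s * ∑ k, ∑ τ, ‖∑ q, (M k q *ᵥ fun τ' => v q (τ, τ')) σ'‖ ^ 2 :=
        Finset.sum_le_sum fun σ' _ => hl _
    _ = s * ∑ τ, ∑ k, ∑ σ', ‖∑ q, (M k q *ᵥ fun τ' => v q (τ, τ')) σ'‖ ^ 2 := by
        rw [← Finset.mul_sum, Finset.sum_comm, Finset.sum_comm (s := (Finset.univ : Finset S))]
        congr 1
        exact Finset.sum_congr rfl fun k _ => Finset.sum_comm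
    _ ≤ s * ∑ τ, t * ∑ q, ∑ τ', ‖v q (τ, τ')‖ ^ 2 := by
        gcongr
        exact hM _
    _ = _ := by
        rw [← Finset.mul_sum, ← mul_assoc]
        congr 1
        rw [Finset.sum_comm]
        simp only [Fintype.sum_prod_type]

theorem SqNormLE.mono {l : Bool → Bool → Matrix Bool Bool ℂ} {s : ℝ} (hs : 0 ≤ s)
    (hl : SqNormLE l s) (L : ℕ) : SqNormLE (mono l L) (s ^ L) := by
  induction L with
  | zero =>
    intro v
    simp only [Miura.mono, pow_zero, one_mul, Fintype.sum_bool]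
    simp
  | succ L ih =>
    rw [pow_succ']
    exact SqNormLE.glue (S' := Row L) hs hl ih

theorem sqNormLE_site {a b c : ℂ} {s : ℝ} (hb : ‖b‖ ^ 2 ≤ s)
    (h : ∀ x y : ℂ, ‖a * x + c * y‖ ^ 2 + ‖c * x + a * y‖ ^ 2 ≤ s * (‖x‖ ^ 2 + ‖y‖ ^ 2)) :
    SqNormLE (site a b c) s := by
  intro v
  have h1 := h (v true true) (v false false)
  simp [site, mulVec, dotProduct]
  have h2 := mul_le_mul_of_nonneg_right hb (sq_nonneg ‖v true false‖)
  have h3 := mul_le_mul_of_nonneg_right hb (sq_nonneg ‖v false true‖)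
  rw [← mul_pow] at h2 h3
  linarith

theorem norm_sq_add_norm_sq_swap {a c : ℂ} (ha : a.re = 0) (hc : c.im = 0) (x y : ℂ) :
    ‖a * x + c * y‖ ^ 2 + ‖c * x + a * y‖ ^ 2 = (‖a‖ ^ 2 + ‖c‖ ^ 2) * (‖x‖ ^ 2 + ‖y‖ ^ 2) := by
  simp only [← Complex.normSq_eq_norm_sq, Complex.normSq_apply, Complex.add_re, Complex.add_im,
    Complex.mul_re, Complex.mul_im, ha, hc]
  ring

theorem norm_sq_add_norm_sq_swap_le {a c : ℂ} {E : ℝ} (ha : ‖a‖ ≤ E) (hc : ‖c‖ ≤ E) (x y : ℂ) :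
    ‖a * x + c * y‖ ^ 2 + ‖c * x + a * y‖ ^ 2 ≤ (2 * E) ^ 2 * (‖x‖ ^ 2 + ‖y‖ ^ 2) := by
  have key : ∀ {a c : ℂ}, ‖a‖ ≤ E → ‖c‖ ≤ E → ‖a * x + c * y‖ ^ 2 ≤
      2 * E ^ 2 * (‖x‖ ^ 2 + ‖y‖ ^ 2) := by
    intro a c ha hc
    have h1 : ‖a * x + c * y‖ ≤ E * (‖x‖ + ‖y‖) := by
      refine (norm_add_le _ _).trans ?_
      rw [norm_mul, norm_mul, mul_add]
      gcongr
    refine (pow_le_pow_left₀ (norm_nonneg _) h1 2).trans ?_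
    rw [mul_pow]
    nlinarith [mul_nonneg (sq_nonneg E) (sq_nonneg (‖x‖ - ‖y‖))]
  linarith [key ha hc, key hc ha]

theorem sqNormLE_vertexOp_of_re {w : ℂ} (h : w.re = Real.pi / 3) :
    SqNormLE (vertexOp w) (3 / 4 + Real.sinh w.im ^ 2) := by
  have h3 : ‖(Real.sqrt 3 / 2 : ℂ)‖ ^ 2 = 3 / 4 := by
    rw [norm_div, div_pow, Complex.norm_real, Real.norm_eq_abs, sq_abs, Real.sq_sqrt (by norm_num)]
    norm_num
  have hr : (Real.pi / 3 : ℂ).re = Real.pi / 3 := by simp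
  have hi : (Real.pi / 3 : ℂ).im = 0 := by simp
  have ha : ‖Complex.sin (Real.pi / 3 - w)‖ ^ 2 = Real.sinh w.im ^ 2 := by
    rw [norm_sin_sq, Complex.sub_re, Complex.sub_im, hr, hi, h]
    simp
  refine sqNormLE_site ?_ fun x y => ?_
  · rw [norm_sin_sq, Complex.add_re, Complex.add_im, hr, hi, h, Real.sin_sq,
      show Real.pi / 3 + Real.pi / 3 = Real.pi - Real.pi / 3 by ring, Real.cos_pi_sub,
      Real.cos_pi_div_three, zero_add]
    norm_num
  · rw [norm_sq_add_norm_sq_swap, ha, h3, add_comm]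
    · rw [Complex.sin_eq]
      simp [-Complex.ofReal_sin, h]
    · simp

theorem sqNormLE_vertexOp (w : ℂ) : SqNormLE (vertexOp w) ((2 * Real.exp |w.im|) ^ 2) := by
  have h1 : ‖Complex.sin (Real.pi / 3 - w)‖ ≤ Real.exp |w.im| := by
    simpa using norm_sin_le (Real.pi / 3 - w)
  have h2 : ‖Complex.sin (Real.pi / 3 + w)‖ ≤ Real.exp |w.im| := by
    simpa using norm_sin_le (Real.pi / 3 + w)
  have h3 : ‖(Real.sqrt 3 / 2 : ℂ)‖ ≤ Real.exp |w.im| := by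
    have h1 := Real.one_le_exp (abs_nonneg w.im)
    have h2 : Real.sqrt 3 ≤ 2 := by rw [Real.sqrt_le_left (by norm_num)]; norm_num
    rw [norm_div, Complex.norm_real, Complex.norm_two, Real.norm_of_nonneg (Real.sqrt_nonneg 3)]
    linarith
  refine sqNormLE_site ?_ fun x y => norm_sq_add_norm_sq_swap_le h1 h3 x y
  refine pow_le_pow_left₀ (norm_nonneg _) (h2.trans ?_) 2
  linarith [Real.exp_pos |w.im|]

/-- The row-to-row transfer matrix with free horizontal boundary conditions. -/
noncomputable def freeTransfer (N : ℕ) (w : ℂ) : Matrix (Row N) (Row N) ℂ :=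
  ∑ p, ∑ q, chain N w p q

/-- The partition function with free boundary conditions. -/
noncomputable def freePartition (N : ℕ) (w : ℂ) : ℂ :=
  ∑ σ, ∑ τ, (freeTransfer N w ^ N) σ τ

theorem norm_sq_sum_le {ι : Type*} [Fintype ι] (f : ι → ℂ) :
    ‖∑ i, f i‖ ^ 2 ≤ Fintype.card ι * ∑ i, ‖f i‖ ^ 2 := by
  refine (pow_le_pow_left₀ (norm_nonneg _) (norm_sum_le _ _) 2).trans ?_
  exact sq_sum_le_card_mul_sum_sq

theorem card_row (L : ℕ) : Fintype.card (Row L) = 2 ^ L := by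
  rw [← Fintype.card_congr (rowEquiv L)]
  simp

theorem norm_freePartition_le {N : ℕ} {w : ℂ} {s : ℝ} (hs : 0 ≤ s)
    (h : SqNormLE (vertexOp w) (s ^ 2)) : ‖freePartition N w‖ ≤ (4 * s ^ N) ^ N := by
  have hT : ∀ v : Row N → ℂ, ∑ σ, ‖(freeTransfer N w *ᵥ v) σ‖ ^ 2 ≤
      (2 * s ^ N) ^ 2 * ∑ σ, ‖v σ‖ ^ 2 := by
    intro v
    have h1 := h.mono (sq_nonneg s) N fun _ => v
    have h2 : ∀ σ, ‖(freeTransfer N w *ᵥ v) σ‖ ^ 2 ≤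
        2 * ∑ p, ‖∑ q, (chain N w p q *ᵥ v) σ‖ ^ 2 := by
      intro σ
      have := norm_sq_sum_le fun p => ∑ q, (chain N w p q *ᵥ v) σ
      rw [Fintype.card_bool, Nat.cast_ofNat] at this
      convert this using 3
      simp only [freeTransfer, Fintype.sum_bool, add_mulVec, Pi.add_apply]
    calc _ ≤ ∑ σ, 2 * ∑ p, ‖∑ q, (chain N w p q *ᵥ v) σ‖ ^ 2 := Finset.sum_le_sum fun σ _ => h2 σ
      _ = 2 * ∑ p, ∑ σ, ‖∑ q, (chain N w p q *ᵥ v) σ‖ ^ 2 := by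
        rw [← Finset.mul_sum, Finset.sum_comm]
      _ ≤ 2 * ((s ^ 2) ^ N * ∑ q : Bool, ∑ τ, ‖v τ‖ ^ 2) := by gcongr; exact h1
      _ = _ := by simp; ring
  have hpow : ∀ R, ∑ σ, ‖(freeTransfer N w ^ R *ᵥ 1) σ‖ ^ 2 ≤ ((2 * s ^ N) ^ R) ^ 2 * 2 ^ N := by
    intro R
    induction R with
    | zero => simp [card_row]
    | succ R ih =>
      rw [pow_succ', ← mulVec_mulVec]
      refine (hT _).trans ?_
      calc _ ≤ (2 * s ^ N) ^ 2 * (((2 * s ^ N) ^ R) ^ 2 * 2 ^ N) := by gcongr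
        _ = _ := by ring
  refine le_of_sq_le_sq ?_ (by positivity)
  have h3 : freePartition N w = ∑ σ, (freeTransfer N w ^ N *ᵥ 1) σ := by
    simp [freePartition, mulVec, dotProduct]
  rw [h3]
  refine (norm_sq_sum_le _).trans ?_
  rw [card_row]
  push_cast
  calc _ ≤ (2 : ℝ) ^ N * (((2 * s ^ N) ^ N) ^ 2 * 2 ^ N) := by gcongr; exact hpow N
    _ = ((2 : ℝ) ^ N * (2 * s ^ N) ^ N) ^ 2 := by ring
    _ = _ := by rw [← mul_pow]; ring

/-- Arrow reversal of a row. -/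
def Row.flip : (L : ℕ) → Row L ≃ Row L
  | 0 => Equiv.refl _
  | L + 1 => (Equiv.boolNot.prodCongr (Row.flip L) : Bool × Row L ≃ Bool × Row L)

theorem site_not {R : Type*} [Zero R] (a b c : R) (p q σ τ : Bool) :
    site b a c p q (!σ) (!τ) = site a b c p q τ σ := by
  cases p <;> cases q <;> cases σ <;> cases τ <;> simp [site]

theorem mono_flip {R : Type*} [CommSemiring R] (a b c : R) (L : ℕ) (p q : Bool) (σ τ : Row L) :
    mono (site b a c) L p q (Row.flip L σ) (Row.flip L τ) = mono (site a b c) L p q τ σ := by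
  induction L generalizing p with
  | zero =>
    have : σ = τ := Subsingleton.elim (α := Unit) σ τ
    simp [mono, this, Row.flip]
  | succ L ih =>
    obtain ⟨σ, σ'⟩ : Bool × Row L := σ
    obtain ⟨τ, τ'⟩ : Bool × Row L := τ
    change mono _ (L + 1) p q (!σ, Row.flip L σ') (!τ, Row.flip L τ') = _
    simp only [mono_succ_apply, site_not, ih]

theorem freePartition_neg (N : ℕ) (w : ℂ) : freePartition N (-w) = freePartition N w := by
  have h1 : (freeTransfer N (-w)).submatrix (Row.flip N) (Row.flip N) = (freeTransfer N w)ᵀ := by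
    ext σ τ
    simp only [freeTransfer, submatrix_apply, transpose_apply, Matrix.sum_apply, chain, vertexOp]
    simp only [sub_neg_eq_add, ← sub_eq_add_neg, mono_flip]
  have h2 : ∀ R, (freeTransfer N (-w) ^ R).submatrix (Row.flip N) (Row.flip N) =
      ((freeTransfer N w)ᵀ) ^ R := by
    intro R
    induction R with
    | zero => simp
    | succ R ih => rw [pow_succ, pow_succ, ← ih, ← h1, submatrix_mul_equiv]
  have h3 := h2 N
  rw [← transpose_pow] at h3
  rw [freePartition, ← (Row.flip N).sum_comp]
  simp_rw [← (Row.flip N).sum_comp fun τ => (freeTransfer N (-w) ^ N) _ τ]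
  have h4 : ∀ σ τ, (freeTransfer N (-w) ^ N) (Row.flip N σ) (Row.flip N τ) =
    (freeTransfer N w ^ N) τ σ := fun σ τ => congrFun (congrFun h3 σ) τ
  simp only [h4]
  rw [Finset.sum_comm]
  rfl

theorem differentiable_vertexOp (p q σ τ : Bool) :
    Differentiable ℂ fun w => vertexOp w p q σ τ := by
  simp only [vertexOp, site]
  split_ifs <;> fun_prop

theorem differentiable_chain (L : ℕ) (p q : Bool) (σ τ : Row L) :
    Differentiable ℂ fun w => chain L w p q σ τ := by
  induction L generalizing p with
  | zero => exact differentiable_const _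
  | succ L ih =>
    obtain ⟨σ, σ'⟩ : Bool × Row L := σ
    obtain ⟨τ, τ'⟩ : Bool × Row L := τ
    have h1 : (fun w => chain (L + 1) w p q (σ, σ') (τ, τ')) =
        fun w => ∑ k, vertexOp w p k σ τ * chain L w k q σ' τ' :=
      funext fun w => mono_succ_apply _ L p q σ τ σ' τ'
    rw [h1]
    exact Differentiable.fun_sum fun k _ => (differentiable_vertexOp p k σ τ).mul (ih k σ' τ')

theorem differentiable_pow_apply {S : Type*} [Fintype S] [DecidableEq S] {A : ℂ → Matrix S S ℂ}
    (h : ∀ σ τ, Differentiable ℂ fun w => A w σ τ) (R : ℕ) (σ τ : S) :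
    Differentiable ℂ fun w => (A w ^ R) σ τ := by
  induction R generalizing σ with
  | zero => simp only [pow_zero]; exact differentiable_const _
  | succ R ih =>
    simp only [pow_succ', mul_apply]
    exact Differentiable.fun_sum fun k _ => (h σ k).mul (ih k)

theorem differentiable_freePartition (N : ℕ) : Differentiable ℂ (freePartition N) := by
  refine Differentiable.fun_sum fun σ _ => Differentiable.fun_sum fun τ _ =>
    differentiable_pow_apply (fun σ τ => ?_) N σ τ
  simp only [freeTransfer, Matrix.sum_apply]
  exact Differentiable.fun_sum fun p _ => Differentiable.fun_sum fun q _ =>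
    differentiable_chain N p q σ τ

theorem mono_smul {R : Type*} [CommSemiring R] (c : R) (l : Bool → Bool → Matrix Bool Bool R)
    (L : ℕ) (p q : Bool) : mono (fun p q => c • l p q) L p q = c ^ L • mono l L p q := by
  induction L generalizing p with
  | zero => simp [mono]
  | succ L ih =>
    ext σ τ
    obtain ⟨σ, σ'⟩ : Bool × Row L := σ
    obtain ⟨τ, τ'⟩ : Bool × Row L := τ
    change _ = c ^ (L + 1) * mono l (L + 1) p q (σ, σ') (τ, τ')
    rw [mono_succ_apply, mono_succ_apply, Finset.mul_sum]
    refine Finset.sum_congr rfl fun k _ => ?_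
    rw [ih]
    simp only [Matrix.smul_apply, smul_eq_mul]
    ring

theorem chain_zero (L : ℕ) (p q : Bool) :
    chain L 0 p q = (Real.sqrt 3 / 2 : ℂ) ^ L • mono (site 1 1 1) L p q := by
  rw [chain, ← mono_smul]
  congr 1
  funext p q
  ext σ τ
  simp [vertexOp, site, sin_pi_div_three]

theorem freePartition_zero (N : ℕ) : freePartition N 0 = ((Real.sqrt 3 / 2 : ℂ) ^ N) ^ N *
    (Nat.card {μ : Crease (N + 1) (N + 1) → ℤ // FlatFoldable μ} : ℂ) := by
  rw [card_flatFoldable, freePartition, freeTransfer]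
  simp only [chain_zero, ← Finset.smul_sum, smul_pow, Matrix.smul_apply]
  rfl

theorem card_flatFoldable_le (N : ℕ) :
    (Nat.card {μ : Crease (N + 1) (N + 1) → ℤ // FlatFoldable μ} : ℝ) ≤
      (4 * (8 / (3 * Real.sqrt 3)) ^ N) ^ N := by
  have key := norm_le_of_strip (f := fun w => freePartition N w * ((bulk w)⁻¹ ^ N) ^ N)
    (C := 4 ^ N) (D := ((4 * 2 ^ N) * 4 ^ N) ^ N) (K := N * N)
    (fun z hz => (differentiable_freePartition N z).mul
      (((differentiableAt_inv_bulk hz).pow N).pow N)) ?_ ?_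
  · simp only [freePartition_zero, bulk_zero, norm_mul, norm_pow, Complex.norm_natCast, norm_inv,
      norm_div, Complex.norm_real, Complex.norm_ofNat] at key
    rw [Real.norm_of_nonneg (Real.sqrt_nonneg 3)] at key
    have h3 : Real.sqrt 3 ^ 2 = 3 := Real.sq_sqrt (by norm_num)
    have h4 : 0 < Real.sqrt 3 := by positivity
    have h5 : Real.sqrt 3 / 2 * (4 / 3)⁻¹ * (8 / (3 * Real.sqrt 3)) = 1 := by
      field_simp
      norm_num
    calc _ = ((Real.sqrt 3 / 2) ^ N) ^ N *
          (Nat.card {μ : Crease (N + 1) (N + 1) → ℤ // FlatFoldable μ} : ℝ) *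
          (((4 / 3)⁻¹) ^ N) ^ N * ((8 / (3 * Real.sqrt 3)) ^ N) ^ N := by
          trans (Nat.card {μ : Crease (N + 1) (N + 1) → ℤ // FlatFoldable μ} : ℝ) *
            ((Real.sqrt 3 / 2 * (4 / 3)⁻¹ * (8 / (3 * Real.sqrt 3))) ^ N) ^ N
          · rw [h5, one_pow, one_pow, mul_one]
          · simp only [mul_pow]; ring
      _ ≤ 4 ^ N * ((8 / (3 * Real.sqrt 3)) ^ N) ^ N := by gcongr
      _ = _ := by rw [mul_pow]
  · intro z hz
    have h1 := norm_freePartition_le (N := N) (by positivity) (sqNormLE_vertexOp z)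
    rw [norm_mul, norm_pow, norm_pow]
    calc _ ≤ (4 * (2 * Real.exp |z.im|) ^ N) ^ N * (4 ^ N) ^ N := by
          gcongr
          exact norm_inv_bulk_le hz
      _ = _ := by
          rw [mul_assoc (N : ℝ), Real.exp_nat_mul, Real.exp_nat_mul, ← mul_pow, ← mul_pow]
          congr 1
          ring
  · intro z hz
    have h1 : ‖freePartition N z‖ ≤ (4 * ‖bulk z‖ ^ N) ^ N := by
      have h2 : ∀ w : ℂ, w.re = Real.pi / 3 → ‖freePartition N w‖ ≤ (4 * ‖bulk w‖ ^ N) ^ N := by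
        intro w hw
        refine norm_freePartition_le (norm_nonneg _) ?_
        rw [norm_bulk_sq (by rw [hw, abs_of_pos (by positivity)])]
        exact sqNormLE_vertexOp_of_re hw
      rcases eq_or_eq_neg_of_abs_eq hz with h | h
      · exact h2 z h
      · have := h2 (-z) (by simp [h])
        rw [freePartition_neg] at this
        simpa [bulk, neg_div] using this
    have h2 := norm_pos_iff.2 (bulk_ne_zero hz.le)
    rw [norm_mul, norm_pow, norm_pow, norm_inv]
    calc _ ≤ (4 * ‖bulk z‖ ^ N) ^ N * ((‖bulk z‖⁻¹) ^ N) ^ N := by gcongr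
      _ = _ := by
        rw [← mul_pow, mul_assoc, ← mul_pow, mul_inv_cancel₀ h2.ne', one_pow, mul_one]

end UpperBound

section YangYang

open Filter Topology

theorem sum_sign_sub {n : ℕ} (k : Fin n) :
    ∑ j : Fin n, ((SignType.sign ((k : ℝ) - (j : ℝ)) : SignType) : ℝ) = 2 * k - (n - 1) := by
  have h : ∀ m : ℕ, ∑ j ∈ Finset.range m, ((SignType.sign ((k : ℝ) - (j : ℝ)) : SignType) : ℝ) =
      if m ≤ k then (m : ℝ) else 2 * k - (m - 1) := by
    intro m
    induction m with
    | zero => simp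
    | succ m ih =>
      rw [Finset.sum_range_succ, ih]
      rcases lt_trichotomy m (k : ℕ) with h | h | h
      · have : (0 : ℝ) < k - m := by simpa using h
        rw [sign_pos this, if_pos h.le, if_pos (by omega)]
        simp
      · rw [if_pos h.le, if_neg (by omega), h]
        simp
        ring
      · have : (k : ℝ) - m < 0 := by simpa using h
        rw [sign_neg this, if_neg (by omega), if_neg (by omega)]
        simp
        ring
  rw [Fin.sum_univ_eq_sum_range (fun j => ((SignType.sign ((k : ℝ) - (j : ℝ)) : SignType) : ℝ)), h,
    if_neg (by omega)]

theorem two_mul_sum_le_sum_abs_sub {n : ℕ} (α : Fin n → ℝ) :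
    ∑ k, (2 * k - (n - 1)) * α k ≤ ∑ j, ∑ k, |α j - α k| / 2 := by
  have h1 : ∑ k, (2 * k - (n - 1)) * α k =
      ∑ k : Fin n, ∑ j : Fin n, ((SignType.sign ((k : ℝ) - (j : ℝ)) : SignType) : ℝ) * α k := by
    refine Finset.sum_congr rfl fun k _ => ?_
    rw [← Finset.sum_mul, sum_sign_sub]
  have h2 : ∑ k : Fin n, ∑ j : Fin n, ((SignType.sign ((k : ℝ) - (j : ℝ)) : SignType) : ℝ) * α k =
      ∑ k : Fin n, ∑ j : Fin n, -(((SignType.sign ((k : ℝ) - (j : ℝ)) : SignType) : ℝ) * α j) := by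
    rw [Finset.sum_comm]
    refine Finset.sum_congr rfl fun k _ => Finset.sum_congr rfl fun j _ => ?_
    rw [← neg_sub (k : ℝ), Left.sign_neg]
    simp
  have h3 : ∑ k : Fin n, ∑ j : Fin n, ((SignType.sign ((k : ℝ) - (j : ℝ)) : SignType) : ℝ) * α k =
      ∑ k : Fin n, ∑ j : Fin n, ((SignType.sign ((k : ℝ) - (j : ℝ)) : SignType) : ℝ) * (α k - α j) / 2 := by
    have : ∀ a b : ℝ, a = b → a = (a + b) / 2 := by intros; linarith
    rw [this _ _ h2, ← Finset.sum_add_distrib, Finset.sum_div]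
    refine Finset.sum_congr rfl fun k _ => ?_
    rw [← Finset.sum_add_distrib, Finset.sum_div]
    refine Finset.sum_congr rfl fun j _ => ?_
    ring
  rw [h1, h3]
  refine Finset.sum_le_sum fun k _ => Finset.sum_le_sum fun j _ => ?_
  gcongr
  rcases lt_trichotomy ((k : ℝ) - j) 0 with h | h | h
  · rw [sign_neg h]
    simpa using neg_le_abs (α k - α j)
  · simp [h]
  · simp [sign_pos h, le_abs_self]

section

variable {ϑ : ℝ → ℝ}

theorem le_integral_of_monotone (hc : Continuous ϑ) (hm : Monotone ϑ) (s t : ℝ) :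
    (∫ x in (0 : ℝ)..t, ϑ x) + ϑ t * (s - t) ≤ ∫ x in (0 : ℝ)..s, ϑ x := by
  have hi : ∀ a b, IntervalIntegrable ϑ MeasureTheory.volume a b := fun a b =>
    hc.intervalIntegrable a b
  rw [← intervalIntegral.integral_add_adjacent_intervals (hi 0 t) (hi t s)]
  gcongr
  rcases le_total t s with h | h
  · have := intervalIntegral.integral_mono_on h (f := fun _ => ϑ t) (by simp) (hi t s)
      (fun x hx => hm hx.1)
    simpa [mul_comm] using this
  · have := intervalIntegral.integral_mono_on h (g := fun _ => ϑ t) (hi s t) (by simp)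
      (fun x hx => hm hx.2)
    rw [intervalIntegral.integral_symm]
    simp only [intervalIntegral.integral_const, smul_eq_mul] at this
    linarith

theorem exists_mul_abs_sub_le_integral (hc : Continuous ϑ) (hm : Monotone ϑ)
    (ho : ∀ t, ϑ (-t) = -ϑ t) (t : ℝ) :
    ∃ C, ∀ s, ϑ t * |s| - C ≤ ∫ x in (0 : ℝ)..s, ϑ x := by
  refine ⟨max (ϑ t * t - ∫ x in (0 : ℝ)..t, ϑ x) (ϑ t * t - ∫ x in (0 : ℝ)..(-t), ϑ x),
    fun s => ?_⟩
  have h1 := le_integral_of_monotone hc hm s t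
  have h2 := le_integral_of_monotone hc hm s (-t)
  rw [ho] at h2
  rcases le_total 0 s with h | h
  · rw [abs_of_nonneg h]
    linarith [le_max_left (ϑ t * t - ∫ x in (0 : ℝ)..t, ϑ x)
      (ϑ t * t - ∫ x in (0 : ℝ)..(-t), ϑ x)]
  · rw [abs_of_nonpos h]
    linarith [le_max_right (ϑ t * t - ∫ x in (0 : ℝ)..t, ϑ x)
      (ϑ t * t - ∫ x in (0 : ℝ)..(-t), ϑ x)]

/-- The Yang–Yang action of the logarithmic Bethe equations. -/
noncomputable def yangYang (ϑ : ℝ → ℝ) (L n : ℕ) (α : Fin n → ℝ) : ℝ :=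
  L * ∑ j, (∫ x in (0 : ℝ)..α j, ϑ x) + ∑ j, ∑ k, (∫ x in (0 : ℝ)..(α j - α k), ϑ x) / 2 -
    Real.pi / 2 * ∑ k, (2 * k - (n - 1)) * α k

theorem hasDerivAt_primitive (hc : Continuous ϑ) (t : ℝ) :
    HasDerivAt (fun s => ∫ x in (0 : ℝ)..s, ϑ x) (ϑ t) t :=
  intervalIntegral.integral_hasDerivAt_right (hc.intervalIntegrable _ _)
    (hc.stronglyMeasurableAtFilter _ _) hc.continuousAt

theorem continuous_yangYang (hc : Continuous ϑ) (L n : ℕ) : Continuous (yangYang ϑ L n) := by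
  have h : Continuous (fun s => ∫ x in (0 : ℝ)..s, ϑ x) :=
    continuous_iff_continuousAt.2 fun t => (hasDerivAt_primitive hc t).continuousAt
  unfold yangYang
  have h1 : ∀ j : Fin n, Continuous fun α : Fin n → ℝ => ∫ x in (0 : ℝ)..α j, ϑ x :=
    fun j => h.comp (continuous_apply j)
  have h2 : ∀ j k : Fin n, Continuous fun α : Fin n → ℝ => ∫ x in (0 : ℝ)..(α j - α k), ϑ x :=
    fun j k => h.comp ((continuous_apply j).sub (continuous_apply k))
  fun_prop

theorem hasDerivAt_yangYang (hc : Continuous ϑ) (ho : ∀ t, ϑ (-t) = -ϑ t) (L n : ℕ)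
    (α : Fin n → ℝ) (j : Fin n) :
    HasDerivAt (fun t : ℝ => yangYang ϑ L n (α + t • Pi.single j 1))
      (L * ϑ (α j) + ∑ k, ϑ (α j - α k) - Real.pi / 2 * (2 * j - (n - 1))) 0 := by
  set e : Fin n → ℝ := Pi.single j 1 with he
  have hd : ∀ i, HasDerivAt (fun t : ℝ => (α + t • e) i) (e i) 0 := fun i => by
    simpa using ((hasDerivAt_id (0 : ℝ)).mul_const (e i)).const_add (α i)
  have h0 : ∀ i, (α + (0 : ℝ) • e) i = α i := by simp
  have h1 : ∀ i, HasDerivAt (fun t : ℝ => ∫ x in (0 : ℝ)..(α + t • e) i, ϑ x)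
      (ϑ (α i) * e i) 0 := fun i =>
    HasDerivAt.comp (h₂ := fun s => ∫ x in (0 : ℝ)..s, ϑ x) (0 : ℝ) (by rw [h0]; exact hasDerivAt_primitive hc (α i)) (hd i)
  have h2 : ∀ i k, HasDerivAt (fun t : ℝ => (∫ x in (0 : ℝ)..(α + t • e) i - (α + t • e) k, ϑ x) / 2)
      (ϑ (α i - α k) * (e i - e k) / 2) 0 := fun i k =>
    (HasDerivAt.comp (h₂ := fun s => ∫ x in (0 : ℝ)..s, ϑ x) (0 : ℝ) (by simp only [h0]; exact hasDerivAt_primitive hc (α i - α k))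
      ((hd i).fun_sub (hd k))).div_const 2
  have h3 := (((HasDerivAt.fun_sum (u := Finset.univ) fun i _ => h1 i).const_mul (L : ℝ)).add
    (HasDerivAt.fun_sum (u := Finset.univ) fun i _ => HasDerivAt.fun_sum (u := Finset.univ)
      fun k _ => h2 i k)).sub
    ((HasDerivAt.fun_sum (u := Finset.univ) fun (i : Fin n) _ => (hd i).const_mul
      (2 * (i : ℝ) - (n - 1))).const_mul (Real.pi / 2))
  refine h3.congr_deriv ?_
  have h4 : ∑ i, ∑ k, ϑ (α i - α k) * (e i - e k) / 2 = ∑ k, ϑ (α j - α k) := by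
    simp only [mul_sub, sub_div, Finset.sum_sub_distrib]
    have h5 : ∑ i, ∑ k, ϑ (α i - α k) * e k / 2 = -∑ i, ∑ k, ϑ (α i - α k) * e i / 2 := by
      rw [Finset.sum_comm, ← Finset.sum_neg_distrib]
      refine Finset.sum_congr rfl fun k _ => ?_
      rw [← Finset.sum_neg_distrib]
      refine Finset.sum_congr rfl fun i _ => ?_
      rw [← neg_sub (α k), ho]
      ring
    rw [h5, sub_neg_eq_add]
    simp [he, Pi.single_apply, ← Finset.sum_div]
  rw [h4]
  simp [he, Pi.single_apply]

theorem exists_yangYang_coercive (hc : Continuous ϑ) (hm : Monotone ϑ) (ho : ∀ t, ϑ (-t) = -ϑ t)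
    (hlim : Tendsto ϑ atTop (𝓝 (Real.pi / 6))) {L n : ℕ} (hL : 2 * n ≤ L) :
    ∃ ε > 0, ∃ C, ∀ α : Fin n → ℝ, ε * ∑ j, |α j| - C ≤ yangYang ϑ L n α := by
  rcases Nat.eq_zero_or_pos n with rfl | hn
  · exact ⟨1, one_pos, 0, fun α => by simp [yangYang]⟩
  have hpi := Real.pi_pos
  have hn' : (1 : ℝ) ≤ n := by exact_mod_cast hn
  have hL' : (2 * n : ℝ) ≤ L := by exact_mod_cast hL
  have hev : ∀ᶠ t in atTop, 0 < ϑ t * (L + (n - 1)) - Real.pi / 2 * (n - 1) := by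
    refine ((hlim.mul_const (L + (n - 1) : ℝ)).sub_const (Real.pi / 2 * (n - 1))).eventually_const_lt
      ?_
    nlinarith
  obtain ⟨t, ht⟩ := hev.exists
  have hle : ϑ t ≤ Real.pi / 6 := hm.ge_of_tendsto hlim t
  obtain ⟨C, hC⟩ := exists_mul_abs_sub_le_integral hc hm ho t
  have ht0 : 0 ≤ ϑ t := by
    by_contra! h
    nlinarith
  refine ⟨_, ht, L * (n * C) + n * (n * (C / 2)), fun α => ?_⟩
  have h1 : ∑ j, (ϑ t * |α j| - C) ≤ ∑ j, ∫ x in (0 : ℝ)..α j, ϑ x :=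
    Finset.sum_le_sum fun j _ => hC _
  have h2 : ∑ j, ∑ k, (ϑ t * |α j - α k| - C) / 2 ≤
      ∑ j, ∑ k, (∫ x in (0 : ℝ)..(α j - α k), ϑ x) / 2 :=
    Finset.sum_le_sum fun j _ => Finset.sum_le_sum fun k _ => by gcongr; exact hC _
  have h3 := two_mul_sum_le_sum_abs_sub α
  have h4 : ∑ k, (2 * k - (n - 1)) * α k ≤ (n - 1) * ∑ k, |α k| := by
    rw [Finset.mul_sum]
    refine Finset.sum_le_sum fun k _ => ?_
    refine (le_abs_self _).trans ?_
    rw [abs_mul]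
    gcongr
    have : (k : ℝ) ≤ n - 1 := by
      rw [le_sub_iff_add_le]
      exact_mod_cast k.2
    have : (0 : ℝ) ≤ k := by positivity
    exact abs_le.2 ⟨by linarith, by linarith⟩
  have h5 : ∑ j, ∑ k, (ϑ t * |α j - α k| - C) / 2 =
      ϑ t * (∑ j, ∑ k, |α j - α k| / 2) - n * (n * (C / 2)) := by
    simp [Finset.mul_sum, sub_div, Finset.sum_sub_distrib, mul_div_assoc]
  have h6 : ∑ j, (ϑ t * |α j| - C) = ϑ t * ∑ j, |α j| - n * C := by
    simp [Finset.mul_sum, Finset.sum_sub_distrib]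
  rw [h5] at h2
  rw [h6] at h1
  unfold yangYang
  have h7 : (L : ℝ) * (ϑ t * ∑ j, |α j| - n * C) ≤ L * ∑ j, ∫ x in (0 : ℝ)..α j, ϑ x := by gcongr
  have h8 := mul_le_mul_of_nonneg_left h3 ht0
  have h9 := mul_le_mul_of_nonneg_left h4 (show 0 ≤ Real.pi / 2 - ϑ t by linarith)
  linarith

theorem exists_log_bethe (hc : Continuous ϑ) (hm : Monotone ϑ) (ho : ∀ t, ϑ (-t) = -ϑ t)
    (hlim : Tendsto ϑ atTop (𝓝 (Real.pi / 6))) {L n : ℕ} (hL : 2 * n ≤ L) :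
    ∃ α : Fin n → ℝ, ∀ j, L * ϑ (α j) + ∑ k, ϑ (α j - α k) = Real.pi / 2 * (2 * j - (n - 1)) := by
  obtain ⟨ε, hε, C, hC⟩ := exists_yangYang_coercive hc hm ho hlim hL
  have hco : Tendsto (yangYang ϑ L n) (cocompact _) atTop := by
    refine tendsto_atTop_mono (f := fun α : Fin n → ℝ => ε * ‖α‖ - C) (fun α => ?_) ?_
    · refine le_trans ?_ (hC α)
      gcongr
      exact (pi_norm_le_iff_of_nonneg (by positivity)).2 fun i =>
        Finset.single_le_sum (f := fun j => |α j|) (fun j _ => abs_nonneg _) (Finset.mem_univ i)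
    · exact tendsto_atTop_add_const_right _ _ ((tendsto_norm_cocompact_atTop).const_mul_atTop hε)
  obtain ⟨α, hα⟩ := (continuous_yangYang hc L n).exists_forall_le hco
  refine ⟨α, fun j => ?_⟩
  have hmin : IsLocalMin (fun t : ℝ => yangYang ϑ L n (α + t • Pi.single j 1)) 0 :=
    Eventually.of_forall fun t => by simpa using hα (α + t • Pi.single j 1)
  have := hmin.hasDerivAt_eq_zero (hasDerivAt_yangYang hc ho L n α j)
  linarith

end

end YangYang

section BetheRoots

open Filter Topology

theorem tanh_strictMono : StrictMono Real.tanh := by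
  intro a b h
  rw [Real.tanh_eq_sinh_div_cosh, Real.tanh_eq_sinh_div_cosh,
    div_lt_div_iff₀ (Real.cosh_pos _) (Real.cosh_pos _)]
  have := Real.sinh_pos_iff.2 (sub_pos.2 h)
  rw [Real.sinh_sub] at this
  linarith

theorem continuous_tanh : Continuous Real.tanh := by
  simp only [funext Real.tanh_eq_sinh_div_cosh]
  exact Real.continuous_sinh.div Real.continuous_cosh fun x => (Real.cosh_pos x).ne'

theorem tendsto_tanh_atTop : Tendsto Real.tanh atTop (𝓝 1) := by
  refine tendsto_atTop_isLUB tanh_strictMono.monotone ?_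
  rw [← Set.image_univ, Real.tanh_bijOn.image_eq]
  exact isLUB_Ioo (by norm_num)

/-- The phase of `sin (π / 3 + i t)`. -/
noncomputable def phase (t : ℝ) : ℝ := Real.arctan (Real.tanh t / Real.sqrt 3)

theorem continuous_phase : Continuous phase :=
  Real.continuous_arctan.comp (continuous_tanh.div_const _)

theorem phase_strictMono : StrictMono phase := fun _ _ h =>
  Real.arctan_strictMono (div_lt_div_of_pos_right (tanh_strictMono h) (by positivity))

theorem phase_neg (t : ℝ) : phase (-t) = -phase t := by
  rw [phase, phase, Real.tanh_neg, neg_div, Real.arctan_neg]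

theorem tendsto_phase_atTop : Tendsto phase atTop (𝓝 (Real.pi / 6)) := by
  rw [← Real.arctan_inv_sqrt_three, ← one_div]
  exact (Real.continuous_arctan.tendsto _).comp (tendsto_tanh_atTop.div_const _)

theorem abs_phase_le (t : ℝ) : |phase t| ≤ Real.pi / 6 := by
  have h := fun t => phase_strictMono.monotone.ge_of_tendsto tendsto_phase_atTop t
  have h1 := h (-t)
  rw [phase_neg] at h1
  exact abs_le.2 ⟨by linarith, h t⟩

/-- The modulus of `sin (π / 3 + i t)`. -/
noncomputable def modulus (t : ℝ) : ℝ :=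
  Real.sqrt 3 / 2 * Real.cosh t * Real.sqrt (1 + (Real.tanh t / Real.sqrt 3) ^ 2)

theorem modulus_pos (t : ℝ) : 0 < modulus t := by
  have := Real.cosh_pos t
  unfold modulus
  positivity

theorem modulus_neg (t : ℝ) : modulus (-t) = modulus t := by
  simp [modulus, neg_div]

theorem sin_add_I_mul (t : ℝ) : Complex.sin (Real.pi / 3 + Complex.I * t) =
    modulus t * Complex.exp (phase t * Complex.I) := by
  have h1 := (Real.cosh_pos t).ne'
  have h2 : Real.sqrt (1 + (Real.tanh t / Real.sqrt 3) ^ 2) ≠ 0 := by positivity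
  have h3 : Real.sqrt 3 ≠ 0 := by positivity
  rw [Complex.exp_mul_I, ← Complex.ofReal_cos, ← Complex.ofReal_sin, phase, Real.cos_arctan,
    Real.sin_arctan, Complex.sin_add, mul_comm Complex.I, Complex.sin_mul_I, Complex.cos_mul_I,
    ← Complex.ofReal_ofNat, ← Complex.ofReal_div, ← Complex.ofReal_sin, ← Complex.ofReal_cos,
    Real.sin_pi_div_three, Real.cos_pi_div_three, ← Complex.ofReal_sinh, ← Complex.ofReal_cosh]
  have e1 : modulus t * (1 / Real.sqrt (1 + (Real.tanh t / Real.sqrt 3) ^ 2)) =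
      Real.sqrt 3 / 2 * Real.cosh t := by
    rw [modulus]
    field_simp
  have e2 : modulus t * (Real.tanh t / Real.sqrt 3 /
      Real.sqrt (1 + (Real.tanh t / Real.sqrt 3) ^ 2)) = 1 / 2 * Real.sinh t := by
    rw [div_eq_mul_one_div _ (Real.sqrt (1 + _)), mul_left_comm, e1, Real.tanh_eq_sinh_div_cosh]
    field_simp
  have f1 := congrArg Complex.ofReal e1
  have f2 := congrArg Complex.ofReal e2
  rw [Complex.ofReal_mul, Complex.ofReal_mul] at f1 f2
  linear_combination -f1 - Complex.I * f2

theorem sin_sub_I_mul (t : ℝ) : Complex.sin (Real.pi / 3 - Complex.I * t) =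
    modulus t * Complex.exp (-(phase t * Complex.I)) := by
  have := sin_add_I_mul (-t)
  rw [modulus_neg, phase_neg] at this
  simpa [sub_eq_add_neg] using this

/-- The numerator of the Bethe ansatz eigenvalue. -/
noncomputable def numer {ι : Type*} [Fintype ι] (L : ℕ) (x : ι → ℂ) (u : ℂ) : ℂ :=
  Complex.sin (Real.pi / 3 - u) ^ L * ∏ j, -Complex.sin (Real.pi / 3 - (u - x j)) +
    Complex.sin (Real.pi / 3 + u) ^ L * ∏ j, Complex.sin (Real.pi / 3 + (u - x j))

/-- The total phase of the two terms of `numer` on the imaginary axis. -/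
noncomputable def totalPhase {n : ℕ} (L : ℕ) (α : Fin n → ℝ) (t : ℝ) : ℝ :=
  L * phase t + ∑ j, phase (t - α j)

theorem numer_I_mul {n : ℕ} (L : ℕ) (α : Fin n → ℝ) (t : ℝ) :
    ∃ r : ℂ, r ≠ 0 ∧ numer L (fun j => Complex.I * α j) (Complex.I * t) =
      r * (Complex.exp (2 * totalPhase L α t * Complex.I) -
        Complex.exp ((n + 1) * Real.pi * Complex.I)) := by
  have hm : ∀ t, (modulus t : ℂ) ≠ 0 := fun t => by exact_mod_cast (modulus_pos t).ne'
  refine ⟨modulus t ^ L * (∏ j, (modulus (t - α j) : ℂ)) *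
    Complex.exp (-(totalPhase L α t * Complex.I)), mul_ne_zero (mul_ne_zero (pow_ne_zero _ (hm t))
      (Finset.prod_ne_zero_iff.2 fun j _ => hm _)) (Complex.exp_ne_zero _), ?_⟩
  have h1 : Complex.exp ((n + 1) * Real.pi * Complex.I) = -(-1) ^ n := by
    rw [add_mul, add_mul, Complex.exp_add, one_mul, Complex.exp_pi_mul_I, mul_assoc,
      Complex.exp_nat_mul, Complex.exp_pi_mul_I]
    ring
  have h2 : Complex.exp (2 * totalPhase L α t * Complex.I) =
      Complex.exp (totalPhase L α t * Complex.I) * Complex.exp (totalPhase L α t * Complex.I) := by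
    rw [← Complex.exp_add]
    ring_nf
  have h3 : Complex.exp (totalPhase L α t * Complex.I) =
      Complex.exp (phase t * Complex.I) ^ L * ∏ j, Complex.exp (phase (t - α j) * Complex.I) := by
    rw [← Complex.exp_nat_mul, ← Complex.exp_sum, ← Complex.exp_add, totalPhase]
    push_cast
    rw [add_mul, Finset.sum_mul, mul_assoc]
  have h4 : Complex.exp (-(totalPhase L α t * Complex.I)) =
      Complex.exp (-(phase t * Complex.I)) ^ L *
        ∏ j, Complex.exp (-(phase (t - α j) * Complex.I)) := by
    simp only [Complex.exp_neg, h3, Finset.prod_inv_distrib, mul_inv, inv_pow]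
  have h5 : Complex.exp (-(totalPhase L α t * Complex.I)) *
      Complex.exp (totalPhase L α t * Complex.I) = 1 := by
    rw [← Complex.exp_add, neg_add_cancel, Complex.exp_zero]
  have h6 : ∀ j, Complex.I * (t : ℂ) - Complex.I * α j = Complex.I * ((t - α j : ℝ) : ℂ) :=
    fun j => by push_cast; ring
  simp only [numer, h6, sin_add_I_mul, sin_sub_I_mul, Finset.prod_mul_distrib, mul_pow,
    Finset.prod_neg, Finset.card_univ, Fintype.card_fin]
  rw [h1, h2, mul_sub, mul_assoc _ (Complex.exp (-_)), ← mul_assoc (Complex.exp (-_)), h5, one_mul,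
    h3, h4]
  ring

theorem totalPhase_strictMono {n L : ℕ} (hL : L ≠ 0) (α : Fin n → ℝ) :
    StrictMono (totalPhase L α) := fun s t h => by
  have hL' : (0 : ℝ) < L := by positivity
  refine add_lt_add_of_lt_of_le (mul_lt_mul_of_pos_left (phase_strictMono h) hL')
    (Finset.sum_le_sum fun j _ => (phase_strictMono.monotone ?_))
  linarith

theorem abs_totalPhase_le {n : ℕ} (L : ℕ) (α : Fin n → ℝ) (t : ℝ) :
    |totalPhase L α t| ≤ (L + n) * (Real.pi / 6) := by
  refine (abs_add_le _ _).trans ?_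
  rw [add_mul, abs_mul, Nat.abs_cast]
  gcongr
  · exact abs_phase_le t
  · refine (Finset.abs_sum_le_sum_abs _ _).trans ?_
    refine (Finset.sum_le_sum fun j _ => abs_phase_le _).trans ?_
    simp

theorem exists_bethe_roots {L n : ℕ} (h1 : 2 * n ≤ L) (h2 : L ≤ 2 * n + 1) :
    ∃ α : Fin n → ℝ, Function.Injective α ∧ ∀ t : ℝ,
      numer L (fun j => Complex.I * α j) (Complex.I * t) = 0 ↔ ∃ j, t = α j := by
  obtain ⟨α, hα⟩ := exists_log_bethe continuous_phase phase_strictMono.monotone phase_neg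
    tendsto_phase_atTop h1
  have hpi := Real.pi_pos
  refine ⟨α, fun i j hij => ?_, fun t => ?_⟩
  · have := hα i
    rw [hij, hα j] at this
    have : (i : ℝ) = j := by
      have := mul_left_cancel₀ (by positivity) this
      linarith
    exact Fin.ext (by exact_mod_cast this)
  obtain ⟨r, hr, h⟩ := numer_I_mul L α t
  rw [h, mul_eq_zero, or_iff_right hr, sub_eq_zero, Complex.exp_eq_exp_iff_exists_int]
  constructor
  · rintro ⟨k, hk⟩
    have h3 : 2 * totalPhase L α t = Real.pi * (n + 1 + 2 * k) := by
      have : ((2 * totalPhase L α t : ℝ) : ℂ) = (Real.pi * (n + 1 + 2 * k) : ℝ) := by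
        apply mul_right_cancel₀ Complex.I_ne_zero
        push_cast
        linear_combination hk
      exact_mod_cast this
    have h4 := abs_totalPhase_le L α t
    have h5 : ((L : ℝ) + n) ≤ 3 * n + 1 := by
      have : (L : ℝ) ≤ 2 * n + 1 := by exact_mod_cast h2
      linarith
    have h6 : |totalPhase L α t| < (n + 1) * Real.pi / 2 := by
      refine h4.trans_lt ?_
      nlinarith
    rw [abs_lt] at h6
    have h7 : ((n : ℝ) + 1 + 2 * k) < n + 1 := by
      by_contra! hc
      nlinarith
    have h8 : -((n : ℝ) + 1) < n + 1 + 2 * k := by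
      by_contra! hc
      nlinarith
    have h9 : (n : ℤ) + 1 + 2 * k < n + 1 := by exact_mod_cast h7
    have h10 : -((n : ℤ) + 1) < n + 1 + 2 * k := by exact_mod_cast h8
    obtain ⟨m, hm⟩ := Int.eq_ofNat_of_zero_le (show 0 ≤ n + k by omega)
    have hmn : m < n := by omega
    refine ⟨⟨m, hmn⟩, (totalPhase_strictMono (L := L) (by omega) α).injective ?_⟩
    have := hα ⟨m, hmn⟩
    have hm' : (n : ℝ) + k = m := by exact_mod_cast hm
    simp only [← hm'] at this
    unfold totalPhase at h3 ⊢
    linarith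
  · rintro ⟨j, rfl⟩
    refine ⟨j - n, ?_⟩
    have h3 : (totalPhase L α (α j) : ℂ) = (Real.pi / 2 * (2 * j - (n - 1)) : ℝ) := by
      rw [← hα j, totalPhase]
    rw [h3]
    push_cast
    ring

end BetheRoots

section Eigenvalue

open Filter Topology Matrix

theorem eq_zero_of_sin_eq_zero {z : ℂ} (hz : Complex.sin z = 0) (h : |z.re| < Real.pi) :
    z = 0 := by
  have h1 := norm_sin_sq z
  rw [hz, norm_zero, zero_pow two_ne_zero] at h1
  have h2 : Real.sin z.re = 0 := by nlinarith [sq_nonneg (Real.sin z.re), sq_nonneg (Real.sinh z.im)]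
  have h3 : Real.sinh z.im = 0 := by
    nlinarith [sq_nonneg (Real.sin z.re), sq_nonneg (Real.sinh z.im)]
  rw [abs_lt] at h
  exact Complex.ext ((Real.sin_eq_zero_iff_of_lt_of_lt h.1 h.2).1 h2) (Real.sinh_eq_zero.1 h3)

theorem norm_sin_sub_lt_norm_sin_add {z : ℂ} (h0 : 0 < z.re) (h1 : z.re ≤ Real.pi / 3) :
    ‖Complex.sin (Real.pi / 3 - z)‖ < ‖Complex.sin (Real.pi / 3 + z)‖ := by
  have hpi := Real.pi_pos
  have h3 : Real.sqrt 3 ^ 2 = 3 := Real.sq_sqrt (by norm_num)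
  have h4 : 0 < Real.sqrt 3 := by positivity
  refine lt_of_pow_lt_pow_left₀ 2 (norm_nonneg _) ?_
  rw [norm_sin_sq, norm_sin_sq]
  have e : ((Real.pi : ℂ) / 3) = ((Real.pi / 3 : ℝ) : ℂ) := by push_cast; rfl
  rw [e]
  simp only [Complex.sub_re, Complex.add_re, Complex.sub_im, Complex.add_im, Complex.ofReal_re,
    Complex.ofReal_im, zero_sub, zero_add, Real.sinh_neg, neg_sq, Real.sin_sub, Real.sin_add,
    Real.sin_pi_div_three, Real.cos_pi_div_three]
  have h5 := Real.sin_pos_of_pos_of_lt_pi h0 (by linarith)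
  have h6 : 0 < Real.cos z.re := Real.cos_pos_of_mem_Ioo ⟨by linarith, by linarith⟩
  have h7 : 0 < Real.sqrt 3 * (Real.sin z.re * Real.cos z.re) := by positivity
  nlinarith

theorem norm_pow_mul_prod_lt {ι : Type*} [Fintype ι] {L : ℕ} (hL : L ≠ 0) {a b : ℂ}
    {f g : ι → ℂ} (h : ‖a‖ < ‖b‖) (hfg : ∀ j, ‖f j‖ < ‖g j‖) :
    ‖a ^ L * ∏ j, f j‖ < ‖b ^ L * ∏ j, g j‖ := by
  simp only [norm_mul, norm_pow, norm_prod]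
  exact (mul_le_mul_of_nonneg_left (Finset.prod_le_prod (fun _ _ => norm_nonneg _)
    fun j _ => (hfg j).le) (by positivity)).trans_lt (mul_lt_mul_of_pos_right
      (pow_lt_pow_left₀ h (norm_nonneg _) hL)
      (Finset.prod_pos fun j _ => (norm_nonneg _).trans_lt (hfg j)))

theorem numer_ne_zero {ι : Type*} [Fintype ι] {L : ℕ} (hL : L ≠ 0) {x : ι → ℂ}
    (hx : ∀ j, (x j).re = 0) {u : ℂ} (h0 : u.re ≠ 0) (h1 : |u.re| ≤ Real.pi / 3) :
    numer L x u ≠ 0 := by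
  intro h
  rw [numer, add_eq_zero_iff_eq_neg] at h
  have h := congrArg norm h
  rw [norm_neg] at h
  rw [abs_le] at h1
  rcases lt_or_gt_of_ne h0 with h2 | h2
  · have key : ∀ z : ℂ, z.re = u.re →
        ‖Complex.sin (Real.pi / 3 + z)‖ < ‖Complex.sin (Real.pi / 3 - z)‖ := fun z hz => by
      have := norm_sin_sub_lt_norm_sin_add (z := -z) (by simpa [hz] using h2)
        (by simp [hz]; linarith)
      rwa [sub_neg_eq_add, ← sub_eq_add_neg] at this
    refine (norm_pow_mul_prod_lt hL (key u rfl) fun j => ?_).ne' h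
    rw [norm_neg]
    exact key _ (by simp [hx])
  · have key : ∀ z : ℂ, z.re = u.re →
        ‖Complex.sin (Real.pi / 3 - z)‖ < ‖Complex.sin (Real.pi / 3 + z)‖ := fun z hz =>
      norm_sin_sub_lt_norm_sin_add (by rwa [hz]) (by rw [hz]; exact h1.2)
    refine (norm_pow_mul_prod_lt hL (key u rfl) fun j => ?_).ne h
    rw [norm_neg]
    exact key _ (by simp [hx])

theorem hasDerivAt_pow_mul_prod {ι : Type*} [Fintype ι] {f : ℂ → ℂ} {g : ι → ℂ → ℂ} {c u : ℂ}
    {d : ι → ℂ} (L : ℕ) (hf : HasDerivAt f (c * f u) u)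
    (hg : ∀ j, HasDerivAt (g j) (d j * g j u) u) :
    HasDerivAt (fun z => f z ^ L * ∏ j, g j z)
      ((L * c + ∑ j, d j) * (f u ^ L * ∏ j, g j u)) u := by
  classical
  have h1 : HasDerivAt (fun z => f z ^ L) (L * c * f u ^ L) u := by
    refine (hf.pow L).congr_deriv ?_
    rcases L with _ | L
    · simp
    · simp; ring
  have h2 : ∀ s : Finset ι, HasDerivAt (fun z => ∏ j ∈ s, g j z)
      ((∑ j ∈ s, d j) * ∏ j ∈ s, g j u) u := by
    intro s
    induction s using Finset.induction_on with
    | empty => simpa using hasDerivAt_const u (1 : ℂ)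
    | insert i s hi ih =>
      simp only [Finset.prod_insert hi, Finset.sum_insert hi]
      exact ((hg i).mul ih).congr_deriv (by ring)
  exact (h1.mul (h2 Finset.univ)).congr_deriv (by ring)

theorem cot_add_cot_pos (t : ℝ) : ∃ r : ℝ, 0 < r ∧
    Complex.cos (Real.pi / 3 + Complex.I * t) / Complex.sin (Real.pi / 3 + Complex.I * t) +
    Complex.cos (Real.pi / 3 - Complex.I * t) / Complex.sin (Real.pi / 3 - Complex.I * t) = r := by
  have hm := modulus_pos t
  refine ⟨Real.sqrt 3 / 2 / modulus t ^ 2, by positivity, ?_⟩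
  have hm' : (modulus t : ℂ) ≠ 0 := by exact_mod_cast hm.ne'
  have h1 : Complex.sin (Real.pi / 3 + Complex.I * t) ≠ 0 := by
    rw [sin_add_I_mul]
    exact mul_ne_zero hm' (Complex.exp_ne_zero _)
  have h2 : Complex.sin (Real.pi / 3 - Complex.I * t) ≠ 0 := by
    rw [sin_sub_I_mul]
    exact mul_ne_zero hm' (Complex.exp_ne_zero _)
  have h3 : Complex.sin (Real.pi / 3 + Complex.I * t) * Complex.sin (Real.pi / 3 - Complex.I * t) =
      modulus t ^ 2 := by
    rw [sin_add_I_mul, sin_sub_I_mul, Complex.exp_neg]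
    field_simp
  have h4 : Complex.sin ((Real.pi / 3 + Complex.I * t) + (Real.pi / 3 - Complex.I * t)) =
      Real.sqrt 3 / 2 := by
    rw [show (Real.pi / 3 + Complex.I * t) + (Real.pi / 3 - Complex.I * t) =
      Real.pi - (Real.pi / 3 : ℂ) by ring, Complex.sin_pi_sub, sin_pi_div_three]
  rw [Complex.sin_add] at h4
  rw [div_add_div _ _ h1 h2, h3]
  push_cast
  rw [← h4]
  ring

theorem exists_hasDerivAt_numer {n : ℕ} {L : ℕ} (hL : L ≠ 0) (α : Fin n → ℝ) {t : ℝ}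
    (h : numer L (fun j => Complex.I * α j) (Complex.I * t) = 0) :
    ∃ c ≠ 0, HasDerivAt (numer L (fun j => Complex.I * α j)) c (Complex.I * t) := by
  have hs1 : ∀ t : ℝ, Complex.sin (Real.pi / 3 + Complex.I * t) ≠ 0 := fun t => by
    rw [sin_add_I_mul]
    exact mul_ne_zero (by exact_mod_cast (modulus_pos t).ne') (Complex.exp_ne_zero _)
  have hs2 : ∀ t : ℝ, Complex.sin (Real.pi / 3 - Complex.I * t) ≠ 0 := fun t => by
    simpa [sub_eq_add_neg] using hs1 (-t)
  have h6 : ∀ j, Complex.I * (t : ℂ) - Complex.I * α j = Complex.I * ((t - α j : ℝ) : ℂ) :=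
    fun j => by push_cast; ring
  have h7 : ∀ j, Complex.sin (Real.pi / 3 + (Complex.I * (t : ℂ) - Complex.I * α j)) ≠ 0 :=
    fun j => by rw [h6]; exact hs1 _
  have h8 : ∀ j, Complex.sin (Real.pi / 3 - (Complex.I * (t : ℂ) - Complex.I * α j)) ≠ 0 :=
    fun j => by rw [h6]; exact hs2 _
  choose r hr hrt using cot_add_cot_pos
  have d1 : ∀ y : ℂ, Complex.sin (Real.pi / 3 + (Complex.I * t - y)) ≠ 0 →
      HasDerivAt (fun u => Complex.sin (Real.pi / 3 + (u - y)))
        (Complex.cos (Real.pi / 3 + (Complex.I * t - y)) /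
          Complex.sin (Real.pi / 3 + (Complex.I * t - y)) *
          Complex.sin (Real.pi / 3 + (Complex.I * t - y))) (Complex.I * t) := fun y hy => by
    rw [div_mul_cancel₀ _ hy]
    simpa using (((hasDerivAt_id (Complex.I * t)).sub_const y).const_add (Real.pi / 3 : ℂ)).csin
  have d2 : ∀ y : ℂ, Complex.sin (Real.pi / 3 - (Complex.I * t - y)) ≠ 0 →
      HasDerivAt (fun u => Complex.sin (Real.pi / 3 - (u - y)))
        (-(Complex.cos (Real.pi / 3 - (Complex.I * t - y)) /
          Complex.sin (Real.pi / 3 - (Complex.I * t - y))) *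
          Complex.sin (Real.pi / 3 - (Complex.I * t - y))) (Complex.I * t) := fun y hy => by
    rw [neg_mul, div_mul_cancel₀ _ hy]
    simpa using (((hasDerivAt_id (Complex.I * t)).sub_const y).const_sub (Real.pi / 3 : ℂ)).csin
  have d3 := d1 0 (by simpa using hs1 t)
  have d4 := d2 0 (by simpa using hs2 t)
  simp only [sub_zero] at d3 d4
  have dA := hasDerivAt_pow_mul_prod L d4
    (fun j => (d2 _ (h8 j)).fun_neg.congr_deriv (mul_neg _ _).symm)
  have dB := hasDerivAt_pow_mul_prod L d3 (fun j => d1 _ (h7 j))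
  refine ⟨_, ?_, dA.add dB⟩
  rw [numer, add_eq_zero_iff_eq_neg] at h
  rw [h, mul_neg, neg_add_eq_sub, ← sub_mul]
  refine mul_ne_zero ?_ (mul_ne_zero (pow_ne_zero _ (hs1 t)) (Finset.prod_ne_zero_iff.2
    fun j _ => h7 j))
  have e : ∀ a b c d : ℂ, a + b - (c + d) = (a - c) + (b - d) := by intros; ring
  simp only [h6]
  rw [e, ← mul_sub, ← Finset.sum_sub_distrib]
  simp only [sub_neg_eq_add, hrt]
  have : 0 < L * r t + ∑ j, r (t - α j) := by
    have := hr t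
    have := Finset.sum_nonneg fun j (_ : j ∈ Finset.univ) => (hr (t - α j)).le
    have : (0 : ℝ) < L := by positivity
    positivity
  exact_mod_cast this.ne'

end Eigenvalue

section Eigenvalue

open Filter Topology Matrix

theorem sin_sub_I_mul_eq_zero_iff {u : ℂ} (hu : |u.re| ≤ Real.pi / 3) (a : ℝ) :
    Complex.sin (u - Complex.I * a) = 0 ↔ u = Complex.I * a := by
  have hpi := Real.pi_pos
  constructor
  · intro h
    refine sub_eq_zero.1 (eq_zero_of_sin_eq_zero h ?_)
    simp
    linarith
  · rintro rfl
    simp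

theorem exists_chain_eigenvalue {L n : ℕ} (hL : L ≠ 0) (h1 : 2 * n ≤ L) (h2 : L ≤ 2 * n + 1) :
    ∃ (α : Fin n → ℝ) (V : Row L → ℂ) (Λ : ℂ → ℂ), V ≠ 0 ∧ Differentiable ℂ Λ ∧
      (∀ u : ℂ, |u.re| ≤ Real.pi / 3 → numer L (fun j => Complex.I * α j) u =
        Λ u * ∏ j, Complex.sin (u - Complex.I * α j)) ∧
      (chain L 0 false false + chain L 0 true true) *ᵥ V = Λ 0 • V ∧
      ∀ u : ℂ, |u.re| ≤ Real.pi / 3 → Λ u ≠ 0 := by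
  have hpi := Real.pi_pos
  obtain ⟨α, hα, hroot⟩ := exists_bethe_roots h1 h2
  set x : Fin n → ℂ := fun j => Complex.I * α j with hx
  set V := betheVec (chain_isYangBaxter L) (vacuum L) x Finset.univ with hV
  set e := stackedRow n L
  have hVe : V e ≠ 0 := betheVec_chain_ne_zero hα (fun _ => rfl) n L _ (by simp; omega)
  set T : ℂ → Matrix (Row L) (Row L) ℂ := fun u => chain L u false false + chain L u true true
  have hTd : ∀ σ, Differentiable ℂ fun u => (T u *ᵥ V) σ := fun σ =>
    Differentiable.fun_sum fun τ _ => ((differentiable_chain L _ _ σ τ).add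
      (differentiable_chain L _ _ σ τ)).mul_const _
  set Λ : ℂ → ℂ := fun u => (T u *ᵥ V) e / V e
  have hΛ : Differentiable ℂ Λ := (hTd e).div_const _
  have hbethe : ∀ j, numer L x (x j) = 0 := fun j => (hroot (α j)).2 ⟨j, rfl⟩
  have heigen : ∀ u, (∀ j, Complex.sin (u - x j) ≠ 0) →
      T u *ᵥ V = (numer L x u / ∏ j, Complex.sin (u - x j)) • V := fun u hu =>
    betheVec_eigen (chain_isYangBaxter L) (chain_isVacuum L).false_false
      (chain_isVacuum L).true_true (fun i j hij => by
        rw [hx, Ne, sin_sub_I_mul_eq_zero_iff (by simp; positivity)]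
        simpa using hα.ne hij) Finset.univ (fun k _ => hbethe k) u fun i _ => hu i
  have hfac : ∀ u : ℂ, |u.re| ≤ Real.pi / 3 →
      numer L x u = Λ u * ∏ j, Complex.sin (u - x j) := fun u hu => by
    by_cases h : ∀ j, Complex.sin (u - x j) ≠ 0
    · have h3 : Λ u = numer L x u / ∏ j, Complex.sin (u - x j) := by
        simp only [Λ, heigen u h, Pi.smul_apply, smul_eq_mul]
        exact mul_div_cancel_right₀ _ hVe
      rw [h3, div_mul_cancel₀ _ (Finset.prod_ne_zero_iff.2 fun j _ => h j)]
    · push Not at h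
      obtain ⟨j, hj⟩ := h
      rw [Finset.prod_eq_zero (Finset.mem_univ j) hj, mul_zero,
        (sin_sub_I_mul_eq_zero_iff hu _).1 hj]
      exact hbethe j
  refine ⟨α, V, Λ, fun h => hVe (congrFun h e), hΛ, hfac, ?_, fun u hu h0 => ?_⟩
  · funext σ
    have hc1 : Tendsto (fun r : ℝ => (T (r : ℂ) *ᵥ V) σ) (𝓝[>] 0) (𝓝 ((T 0 *ᵥ V) σ)) :=
      ((hTd σ).continuous.comp Complex.continuous_ofReal).continuousWithinAt (x := (0 : ℝ))
    have hc2 : Tendsto (fun r : ℝ => Λ (r : ℂ) * V σ) (𝓝[>] 0) (𝓝 (Λ 0 * V σ)) :=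
      ((hΛ.continuous.comp Complex.continuous_ofReal).mul_const _).continuousWithinAt (x := (0 : ℝ))
    refine tendsto_nhds_unique_of_eventuallyEq hc1 hc2 ?_
    filter_upwards [Ioo_mem_nhdsGT (show (0 : ℝ) < 1 by norm_num)] with r hr
    have hre : |(r : ℂ).re| ≤ Real.pi / 3 := by
      rw [Complex.ofReal_re, abs_of_pos hr.1]
      linarith [hr.2, Real.pi_gt_three]
    have hne : ∀ j, Complex.sin (r - x j) ≠ 0 := fun j => by
      rw [hx, Ne, sin_sub_I_mul_eq_zero_iff hre]
      intro h
      have := congrArg Complex.re h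
      simp at this
      exact hr.1.ne' this
    rw [heigen r hne, hfac r hre,
      mul_div_cancel_right₀ _ (Finset.prod_ne_zero_iff.2 fun j _ => hne j)]
    rfl
  · have hnum : numer L x u = 0 := by rw [hfac u hu, h0, zero_mul]
    by_cases hre : u.re = 0
    · have hu' : u = Complex.I * (u.im : ℂ) := by
        conv_lhs => rw [← Complex.re_add_im u, hre]
        simp [mul_comm]
      rw [hu'] at hnum
      obtain ⟨c, hc, hd⟩ := exists_hasDerivAt_numer hL α hnum
      obtain ⟨j, hj⟩ := (hroot _).1 hnum
      rw [← hu'] at hd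
      have hQ : ∏ j, Complex.sin (u - x j) = 0 :=
        Finset.prod_eq_zero (Finset.mem_univ j) ((sin_sub_I_mul_eq_zero_iff hu _).2 (hj ▸ hu'))
      have hQd : DifferentiableAt ℂ (fun u => ∏ j, Complex.sin (u - x j)) u := by fun_prop
      have hd2 := (hΛ u).hasDerivAt.fun_mul hQd.hasDerivAt
      rw [hQ, h0, mul_zero, zero_mul, add_zero] at hd2
      have hev : numer L x =ᶠ[𝓝 u] fun u => Λ u * ∏ j, Complex.sin (u - x j) := by
        have : {z : ℂ | |z.re| < Real.pi / 3} ∈ 𝓝 u :=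
          (isOpen_lt (by fun_prop) (by fun_prop)).mem_nhds (by simp [hre]; positivity)
        filter_upwards [this] with z hz using hfac z (le_of_lt hz)
      exact hc (hd.unique (hd2.congr_of_eventuallyEq hev))
    · exact numer_ne_zero hL (fun j => by simp [hx]) hre hu hnum

end Eigenvalue

section Growth

open Filter Topology Polynomial

theorem exists_mul_norm_pow_le_eval {P : ℂ[X]} (hP : P ≠ 0) :
    ∃ c > 0, ∃ δ > 0, ∃ k : ℕ, ∀ y : ℂ, ‖y‖ < δ → c * ‖y‖ ^ k ≤ ‖P.eval y‖ := by
  generalize hk : P.rootMultiplicity 0 = k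
  obtain ⟨q, hq, hdvd⟩ := P.exists_eq_pow_rootMultiplicity_mul_and_not_dvd hP 0
  rw [hk] at hq
  have hq0 : 0 < ‖q.eval 0‖ := norm_pos_iff.2 fun h => hdvd (dvd_iff_isRoot.2 h)
  have hev : ∀ᶠ y in 𝓝 (0 : ℂ), ‖q.eval 0‖ / 2 < ‖q.eval y‖ :=
    (q.continuous.norm.tendsto 0).eventually_const_lt (by linarith)
  obtain ⟨δ, hδ, hball⟩ := Metric.eventually_nhds_iff.1 hev
  refine ⟨_, half_pos hq0, δ, hδ, k, fun y hy => ?_⟩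
  rw [hq, eval_mul, eval_pow, norm_mul, norm_pow, mul_comm]
  simp only [map_zero, sub_zero, eval_X]
  gcongr
  exact (hball (by simpa using hy)).le

section

variable {ι : Type*} [Fintype ι] (L : ℕ) (x : ι → ℂ)

theorem numer_neg (u : ℂ) : numer L (-x) (-u) = (-1) ^ Fintype.card ι * numer L x u := by
  have h : ((-1 : ℂ) ^ Fintype.card ι) * (-1) ^ Fintype.card ι = 1 := by
    rw [← mul_pow]
    simp
  have e1 : ∀ j, (Real.pi / 3 : ℂ) - (-u - (-x) j) = Real.pi / 3 + (u - x j) := fun j => by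
    simp; ring
  have e2 : ∀ j, (Real.pi / 3 : ℂ) + (-u - (-x) j) = Real.pi / 3 - (u - x j) := fun j => by
    simp; ring
  simp only [numer, e1, e2, Finset.prod_neg, Finset.card_univ, sub_neg_eq_add, ← sub_eq_add_neg]
  linear_combination (-Complex.sin (Real.pi / 3 - u) ^ L *
    ∏ j, Complex.sin (Real.pi / 3 - (u - x j))) * h

theorem exists_polynomial_numer : ∃ P : ℂ[X], ∀ u, P.eval (Complex.exp (Complex.I * u) ^ 2) =
    numer L x u * Complex.exp (Complex.I * u) ^ (L + Fintype.card ι) := by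
  refine ⟨C ((-1) ^ L) * linFactor (-(Real.pi / 3)) ^ L *
      ∏ j, linFactor (-(Real.pi / 3) - x j) +
    linFactor (Real.pi / 3) ^ L * ∏ j, linFactor (Real.pi / 3 - x j), fun u => ?_⟩
  have e1 : ∀ z : ℂ, Complex.sin (Real.pi / 3 - z) = -Complex.sin (-(Real.pi / 3) + z) :=
    fun z => by rw [← Complex.sin_neg]; ring_nf
  have e2 : ∀ j, (Real.pi / 3 : ℂ) - x j + u = Real.pi / 3 + (u - x j) := fun j => by ring
  have e3 : ∀ j, -(Real.pi / 3 : ℂ) - x j + u = -(Real.pi / 3) + (u - x j) := fun j => by ring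
  simp only [numer, eval_add, eval_mul, eval_pow, eval_C, eval_prod, eval_linFactor, e1, e2, e3,
    Finset.prod_mul_distrib, mul_pow, Finset.prod_const, Finset.card_univ, neg_neg, pow_add,
    neg_pow (Complex.sin _)]
  ring

theorem norm_exp_I_mul (u : ℂ) : ‖Complex.exp (Complex.I * u)‖ = Real.exp (-u.im) := by
  rw [Complex.norm_exp]
  simp

theorem exists_exp_le_norm_numer_of_le_im {u₀ : ℂ} (h : numer L x u₀ ≠ 0) :
    ∃ c > 0, ∃ K Y : ℝ, ∀ u : ℂ, Y ≤ u.im → c * Real.exp (-(K * |u.im|)) ≤ ‖numer L x u‖ := by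
  obtain ⟨P, hP⟩ := exists_polynomial_numer L x
  have hP0 : P ≠ 0 := by
    rintro rfl
    have := hP u₀
    rw [eval_zero, eq_comm, mul_eq_zero] at this
    exact this.elim h (pow_ne_zero _ (Complex.exp_ne_zero _))
  obtain ⟨c, hc, δ, hδ, k, hk⟩ := exists_mul_norm_pow_le_eval hP0
  have hev : ∀ᶠ y : ℝ in atTop, Real.exp (-y) ^ 2 < δ := by
    have := (Real.tendsto_exp_neg_atTop_nhds_zero.pow 2)
    rw [zero_pow two_ne_zero] at this
    exact this.eventually_lt_const hδ
  obtain ⟨Y, hY⟩ := eventually_atTop.1 hev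
  refine ⟨c, hc, 2 * k, max Y 0, fun u hu => ?_⟩
  have h0 : 0 ≤ u.im := (le_max_right _ _).trans hu
  have h1 := hk (Complex.exp (Complex.I * u) ^ 2)
    (by rw [norm_pow, norm_exp_I_mul]; exact hY _ ((le_max_left _ _).trans hu))
  rw [hP, norm_mul, norm_pow, norm_pow, norm_exp_I_mul, ← pow_mul, ← Real.exp_nat_mul] at h1
  rw [abs_of_nonneg h0]
  have h2 : Real.exp (-u.im) ^ (L + Fintype.card ι) ≤ 1 :=
    pow_le_one₀ (Real.exp_pos _).le (Real.exp_le_one_iff.2 (by linarith))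
  push_cast at h1
  rw [mul_neg] at h1
  exact h1.trans (mul_le_of_le_one_right (norm_nonneg _) h2)

theorem exists_exp_le_norm_numer {u₀ : ℂ} (h : numer L x u₀ ≠ 0) :
    ∃ c > 0, ∃ K Y : ℝ, ∀ u : ℂ, Y ≤ |u.im| → c * Real.exp (-(K * |u.im|)) ≤ ‖numer L x u‖ := by
  obtain ⟨c₁, hc₁, K₁, Y₁, h₁⟩ := exists_exp_le_norm_numer_of_le_im L x h
  obtain ⟨c₂, hc₂, K₂, Y₂, h₂⟩ := exists_exp_le_norm_numer_of_le_im L (-x) (u₀ := -u₀)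
    (by rw [numer_neg]; exact mul_ne_zero (by simp) h)
  refine ⟨min c₁ c₂, lt_min hc₁ hc₂, max K₁ K₂, max Y₁ Y₂, fun u hu => ?_⟩
  have key : ∀ c K : ℝ, min c₁ c₂ ≤ c → K ≤ max K₁ K₂ →
      min c₁ c₂ * Real.exp (-(max K₁ K₂ * |u.im|)) ≤ c * Real.exp (-(K * |u.im|)) := by
    intro c K hc hK
    have := (lt_min hc₁ hc₂).trans_le hc
    gcongr
  rcases le_total 0 u.im with h0 | h0
  · refine (key _ _ (min_le_left _ _) (le_max_left _ _)).trans (h₁ u ?_)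
    rw [abs_of_nonneg h0] at hu
    exact (le_max_left _ _).trans hu
  · refine (key _ _ (min_le_right _ _) (le_max_right _ _)).trans ?_
    have := h₂ (-u) (by
      rw [abs_of_nonpos h0] at hu
      exact (le_max_right _ _).trans (by simpa using hu))
    rwa [numer_neg, norm_mul, norm_pow, norm_neg, norm_one, one_pow, one_mul, Complex.neg_im,
      abs_neg] at this

end

/-- At most exponential growth in the strip `|re z| ≤ π / 3`. -/
def ExpBounded (f : ℂ → ℂ) : Prop :=
  ∃ D K : ℝ, ∀ z : ℂ, |z.re| ≤ Real.pi / 3 → ‖f z‖ ≤ D * Real.exp (K * |z.im|)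

namespace ExpBounded

variable {f g : ℂ → ℂ}

theorem mul (hf : ExpBounded f) (hg : ExpBounded g) : ExpBounded fun z => f z * g z := by
  obtain ⟨D₁, K₁, h₁⟩ := hf
  obtain ⟨D₂, K₂, h₂⟩ := hg
  refine ⟨D₁ * D₂, K₁ + K₂, fun z hz => ?_⟩
  rw [norm_mul, add_mul, Real.exp_add]
  refine (mul_le_mul (h₁ z hz) (h₂ z hz) (norm_nonneg _)
    ((norm_nonneg _).trans (h₁ z hz))).trans_eq (by ring)

theorem of_le {D : ℝ} (h : ∀ z : ℂ, |z.re| ≤ Real.pi / 3 → ‖f z‖ ≤ D) : ExpBounded f :=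
  ⟨D, 0, by simpa using h⟩

theorem pow (hf : ExpBounded f) (n : ℕ) : ExpBounded fun z => f z ^ n := by
  induction n with
  | zero => exact of_le (D := 1) (by simp)
  | succ n ih => simpa only [pow_succ] using ih.mul hf

theorem prod {ι : Type*} (s : Finset ι) {f : ι → ℂ → ℂ} (hf : ∀ i, ExpBounded (f i)) :
    ExpBounded fun z => ∏ i ∈ s, f i z := by
  classical
  induction s using Finset.induction_on with
  | empty => exact of_le (D := 1) (by simp)
  | insert i s hi ih => simpa only [Finset.prod_insert hi] using (hf i).mul ih

theorem add (hf : ExpBounded f) (hg : ExpBounded g) : ExpBounded fun z => f z + g z := by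
  obtain ⟨D₁, K₁, h₁⟩ := hf
  obtain ⟨D₂, K₂, h₂⟩ := hg
  refine ⟨|D₁| + |D₂|, max K₁ K₂, fun z hz => ?_⟩
  rw [add_mul]
  refine (norm_add_le _ _).trans (add_le_add ((h₁ z hz).trans ?_) ((h₂ z hz).trans ?_))
  · gcongr
    exacts [le_abs_self _, le_max_left _ _]
  · gcongr
    exacts [le_abs_self _, le_max_right _ _]

theorem sin_sub (a : ℂ) : ExpBounded fun z => Complex.sin (z - a) := by
  refine ⟨Real.exp |a.im|, 1, fun z _ => (norm_sin_le _).trans ?_⟩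
  rw [← Real.exp_add, one_mul, Complex.sub_im]
  exact Real.exp_le_exp.2 ((abs_sub _ _).trans_eq (add_comm _ _))

theorem cos_half : ExpBounded fun z => Complex.cos (z / 2) := by
  refine ⟨1, 1, fun z _ => ?_⟩
  simp only [← Complex.sin_add_pi_div_two]
  refine (norm_sin_le _).trans ?_
  rw [one_mul, one_mul, Real.exp_le_exp]
  have : (z / 2 + (Real.pi : ℂ) / 2).im = z.im / 2 := by simp
  rw [this, abs_div, abs_two]
  linarith [abs_nonneg z.im]

end ExpBounded

theorem expBounded_bulk : ExpBounded bulk := by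
  have h2 : ∀ a : ℂ, ExpBounded fun _ => a := fun a => .of_le (D := ‖a‖) fun _ _ => le_rfl
  have h3 : ExpBounded fun w => (2 * Complex.cos (w / 2) + 1)⁻¹ := by
    refine .of_le (D := 1) fun z hz => ?_
    rw [norm_inv]
    refine inv_le_one_of_one_le₀ (le_trans ?_ (Complex.re_le_norm _))
    have := le_re_cos_half hz
    have := three_halves_lt_sqrt_three
    simp
    linarith
  have h := ((((h2 2).mul .cos_half).mul (.add .cos_half (h2 1))).mul
    (.add ((h2 2).mul .cos_half) (h2 (-1)))).mul h3
  simp only [← sub_eq_add_neg, ← div_eq_mul_inv] at h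
  exact h

theorem expBounded_inv {ι : Type*} [Fintype ι] {L : ℕ} {x : ι → ℂ} {Λ : ℂ → ℂ}
    (hΛ : Differentiable ℂ Λ) (hne : ∀ u : ℂ, |u.re| ≤ Real.pi / 3 → Λ u ≠ 0)
    (hfac : ∀ u : ℂ, |u.re| ≤ Real.pi / 3 → numer L x u = Λ u * ∏ j, Complex.sin (u - x j))
    {u₀ : ℂ} (h : numer L x u₀ ≠ 0) : ExpBounded fun z => (Λ z)⁻¹ := by
  obtain ⟨c, hc, K, Y, hY⟩ := exists_exp_le_norm_numer L x h
  obtain ⟨D, K', hQ⟩ := ExpBounded.prod Finset.univ fun j => ExpBounded.sin_sub (x j)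
  have hcomp : IsCompact (Set.Icc (-(Real.pi / 3)) (Real.pi / 3) ×ℂ Set.Icc (-Y) Y) :=
    isCompact_Icc.reProdIm isCompact_Icc
  obtain ⟨M, hM⟩ := hcomp.exists_bound_of_continuousOn (f := fun z => (Λ z)⁻¹)
    (hΛ.continuous.continuousOn.inv₀ fun z hz => hne z (abs_le.2 hz.1))
  refine ⟨max |M| (D / c), max 0 (K' + K), fun z hz => ?_⟩
  rcases le_total |z.im| Y with h1 | h1
  · refine (hM z ⟨abs_le.1 hz, abs_le.1 h1⟩).trans ?_
    refine ((le_abs_self _).trans (le_max_left _ (D / c))).trans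
      (le_mul_of_one_le_right ?_ ?_)
    · exact (abs_nonneg M).trans (le_max_left _ _)
    · exact Real.one_le_exp (mul_nonneg (le_max_left _ _) (abs_nonneg _))
  · have h2 := hY z h1
    rw [hfac z hz, norm_mul] at h2
    have h3 := norm_pos_iff.2 (hne z hz)
    have h4 : ‖(Λ z)⁻¹‖ ≤ D / c * Real.exp ((K' + K) * |z.im|) := by
      rw [norm_inv, inv_le_iff_one_le_mul₀' h3, add_mul, Real.exp_add, ← mul_assoc, ← mul_assoc,
        mul_div_assoc']
      have h5 := h2.trans (mul_le_mul_of_nonneg_left (hQ z hz) h3.le)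
      rw [Real.exp_neg, ← div_eq_mul_inv, div_le_iff₀ (Real.exp_pos _)] at h5
      rw [div_mul_eq_mul_div, div_mul_eq_mul_div, one_le_div hc]
      linarith
    have hD : 0 ≤ D := by
      have := (norm_nonneg _).trans (hQ 0 (by simp; positivity))
      simpa using this
    refine h4.trans ?_
    gcongr
    · exact le_max_right _ _
    · exact le_max_right _ _

end Growth

section Boundary

theorem le_norm_pow_mul_prod_add {ι : Type*} [Fintype ι] (M : ℕ) {a b : ℂ} {f g : ι → ℂ}
    {q : ι → ℝ} (hab : ‖a‖ ≤ ‖b‖) (hf : ∀ j, ‖f j‖ ≤ q j) (hg : ∀ j, ‖g j‖ = q j) :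
    ‖b‖ ^ M * (‖b‖ - ‖a‖) * ∏ j, q j ≤ ‖a ^ (M + 1) * ∏ j, f j + b ^ (M + 1) * ∏ j, g j‖ := by
  have h1 : ‖a ^ (M + 1) * ∏ j, f j‖ ≤ ‖b‖ ^ M * ‖a‖ * ∏ j, q j := by
    rw [norm_mul, norm_pow, norm_prod, pow_succ]
    exact mul_le_mul (by gcongr) (Finset.prod_le_prod (fun j _ => norm_nonneg _) fun j _ => hf j)
      (Finset.prod_nonneg fun j _ => norm_nonneg _) (by positivity)
  have h2 : ‖b ^ (M + 1) * ∏ j, g j‖ = ‖b‖ ^ M * ‖b‖ * ∏ j, q j := by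
    rw [norm_mul, norm_pow, norm_prod, pow_succ, Finset.prod_congr rfl fun j _ => hg j]
  have h3 := norm_sub_le (a ^ (M + 1) * ∏ j, f j + b ^ (M + 1) * ∏ j, g j)
    (a ^ (M + 1) * ∏ j, f j)
  rw [add_sub_cancel_left, h2] at h3
  linarith

theorem norm_sin_of_re_eq_zero {z : ℂ} (h : z.re = 0) : ‖Complex.sin z‖ = |Real.sinh z.im| := by
  rw [← Real.sqrt_sq (norm_nonneg _), norm_sin_sq, h, Real.sin_zero, ← Real.sqrt_sq_eq_abs]
  simp

theorem norm_sin_of_sin_sq_re {z : ℂ} (h : Real.sin z.re ^ 2 = 3 / 4) :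
    ‖Complex.sin z‖ = √(3 / 4 + Real.sinh z.im ^ 2) := by
  rw [← Real.sqrt_sq (norm_nonneg _), norm_sin_sq, h]

theorem sin_sq_pi_div_three : Real.sin (Real.pi / 3) ^ 2 = 3 / 4 := by
  rw [Real.sin_pi_div_three, div_pow, Real.sq_sqrt (by norm_num)]
  norm_num

theorem sin_sq_two_pi_div_three : Real.sin (Real.pi / 3 + Real.pi / 3) ^ 2 = 3 / 4 := by
  rw [show Real.pi / 3 + Real.pi / 3 = Real.pi - Real.pi / 3 by ring, Real.sin_pi_sub,
    sin_sq_pi_div_three]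

theorem abs_sinh_le_sqrt (t : ℝ) : |Real.sinh t| ≤ √(3 / 4 + Real.sinh t ^ 2) :=
  Real.abs_le_sqrt (by linarith)

theorem le_norm_numer {ι : Type*} [Fintype ι] (M : ℕ) {x : ι → ℂ} (hx : ∀ j, (x j).re = 0)
    {u : ℂ} (hu : |u.re| = Real.pi / 3) :
    ‖bulk u‖ ^ M * (‖bulk u‖ - |Real.sinh u.im|) * ∏ j, ‖Complex.sin (u - x j)‖ ≤
      ‖numer (M + 1) x u‖ := by
  have hb : ‖bulk u‖ = √(3 / 4 + Real.sinh u.im ^ 2) := by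
    rw [← norm_bulk_sq hu, Real.sqrt_sq (norm_nonneg _)]
  have hq : ∀ j, ‖Complex.sin (u - x j)‖ = √(3 / 4 + Real.sinh (u - x j).im ^ 2) := by
    intro j
    refine norm_sin_of_sin_sq_re ?_
    rw [Complex.sub_re, hx, sub_zero, ← sin_sq_pi_div_three]
    rcases (abs_eq (by positivity)).1 hu with h | h <;> simp [h]
  have hre : ((Real.pi : ℂ) / 3).re = Real.pi / 3 := by simp
  have him : ((Real.pi : ℂ) / 3).im = 0 := by simp
  -- the two terms of `numer` exchange roles between the two boundary lines
  have key : ∀ v : ℂ, |Real.sinh v.im| ≤ √(3 / 4 + Real.sinh v.im ^ 2) ∧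
      (v.re = Real.pi / 3 → ‖Complex.sin (Real.pi / 3 - v)‖ = |Real.sinh v.im| ∧
        ‖Complex.sin (Real.pi / 3 + v)‖ = √(3 / 4 + Real.sinh v.im ^ 2)) ∧
      (v.re = -(Real.pi / 3) → ‖Complex.sin (Real.pi / 3 + v)‖ = |Real.sinh v.im| ∧
        ‖Complex.sin (Real.pi / 3 - v)‖ = √(3 / 4 + Real.sinh v.im ^ 2)) := by
    refine fun v => ⟨abs_sinh_le_sqrt _, fun h => ⟨?_, ?_⟩, fun h => ⟨?_, ?_⟩⟩
    · rw [norm_sin_of_re_eq_zero (by rw [Complex.sub_re, hre, h, sub_self]), Complex.sub_im, him,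
        zero_sub, Real.sinh_neg, abs_neg]
    · rw [norm_sin_of_sin_sq_re (by rw [Complex.add_re, hre, h, sin_sq_two_pi_div_three]),
        Complex.add_im, him, zero_add]
    · rw [norm_sin_of_re_eq_zero (by rw [Complex.add_re, hre, h, add_neg_cancel]),
        Complex.add_im, him, zero_add]
    · rw [norm_sin_of_sin_sq_re (by
        rw [Complex.sub_re, hre, h, sub_neg_eq_add, sin_sq_two_pi_div_three]),
        Complex.sub_im, him, zero_sub, Real.sinh_neg, neg_sq]
  have hsub : ∀ j, (u - x j).re = u.re := fun j => by rw [Complex.sub_re, hx, sub_zero]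
  rcases (abs_eq (by positivity)).1 hu with h | h
  · obtain ⟨ha, hb'⟩ := (key u).2.1 h
    rw [hb, ← ha, ← hb', numer]
    refine le_norm_pow_mul_prod_add M ?_ (fun j => ?_) fun j => ?_
    · rw [ha, hb']
      exact abs_sinh_le_sqrt _
    · rw [norm_neg, ((key _).2.1 ((hsub j).trans h)).1, hq]
      exact abs_sinh_le_sqrt _
    · rw [((key _).2.1 ((hsub j).trans h)).2, hq]
  · obtain ⟨ha, hb'⟩ := (key u).2.2 h
    rw [hb, ← ha, ← hb', numer, add_comm (Complex.sin (Real.pi / 3 - u) ^ (M + 1) * _)]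
    refine le_norm_pow_mul_prod_add M ?_ (fun j => ?_) fun j => ?_
    · rw [ha, hb']
      exact abs_sinh_le_sqrt _
    · rw [((key _).2.2 ((hsub j).trans h)).1, hq]
      exact abs_sinh_le_sqrt _
    · rw [norm_neg, ((key _).2.2 ((hsub j).trans h)).2, hq]

theorem le_norm_cos_sq {z : ℂ} (h : |z.re| ≤ Real.pi / 3) :
    1 / 4 + Real.sinh z.im ^ 2 ≤ ‖Complex.cos z‖ ^ 2 := by
  have h1 : 1 / 2 ≤ Real.cos z.re := by
    rw [← Real.cos_pi_div_three, ← Real.cos_abs z.re]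
    exact Real.cos_le_cos_of_nonneg_of_le_pi (abs_nonneg _) (by linarith [Real.pi_pos]) h
  rw [norm_cos_sq]
  nlinarith

theorem norm_bulk_pow_le {ι : Type*} [Fintype ι] (M : ℕ) {x : ι → ℂ} (hx : ∀ j, (x j).re = 0)
    {Λ : ℂ → ℂ}
    (hfac : ∀ u : ℂ, |u.re| ≤ Real.pi / 3 → numer (M + 1) x u = Λ u * ∏ j, Complex.sin (u - x j))
    {u : ℂ} (hu : |u.re| = Real.pi / 3) :
    ‖bulk u‖ ^ (M + 1) ≤ 8 * (‖Λ u‖ * ‖Complex.cos u‖ ^ 2) := by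
  have hb := norm_bulk_sq hu
  have hQ : 0 < ∏ j, ‖Complex.sin (u - x j)‖ := by
    refine Finset.prod_pos fun j _ => ?_
    have h := norm_sin_sq (u - x j)
    rw [Complex.sub_re, hx, sub_zero, show Real.sin u.re ^ 2 = 3 / 4 by
      rw [← sin_sq_pi_div_three]
      rcases (abs_eq (by positivity)).1 hu with h | h <;> simp [h]] at h
    refine norm_pos_iff.2 fun h0 => ?_
    rw [h0, norm_zero] at h
    nlinarith [sq_nonneg (Real.sinh (u - x j).im)]
  have h1 := le_norm_numer M hx hu
  rw [hfac u hu.le, norm_mul, norm_prod, mul_le_mul_iff_left₀ hQ] at h1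
  have hc := le_norm_cos_sq hu.le
  set b := ‖bulk u‖
  set s := Real.sinh u.im
  have hb0 : 0 ≤ b := norm_nonneg _
  have hs : |s| ^ 2 = s ^ 2 := sq_abs s
  have hsb : |s| < b := abs_lt_of_sq_lt_sq (by linarith) hb0
  have h2 : b ≤ 8 * (b - |s|) * (1 / 4 + s ^ 2) := by
    have h3 : (b - |s|) * (b + |s|) = 3 / 4 := by nlinarith
    have h4 : b * (b + |s|) ≤ 6 * (1 / 4 + s ^ 2) := by nlinarith [abs_nonneg s]
    refine le_of_mul_le_mul_right ?_ (show 0 < b + |s| by linarith [abs_nonneg s])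
    nlinarith
  calc b ^ (M + 1) = b ^ M * b := pow_succ _ _
    _ ≤ b ^ M * (8 * (b - |s|) * (1 / 4 + s ^ 2)) := by gcongr
    _ = 8 * ((b ^ M * (b - |s|)) * (1 / 4 + s ^ 2)) := by ring
    _ ≤ _ := by gcongr

theorem le_norm_eigenvalue {ι : Type*} [Fintype ι] (M : ℕ) {x : ι → ℂ} (hx : ∀ j, (x j).re = 0)
    {Λ : ℂ → ℂ} (hΛ : Differentiable ℂ Λ) (hne : ∀ u : ℂ, |u.re| ≤ Real.pi / 3 → Λ u ≠ 0)
    (hfac : ∀ u : ℂ, |u.re| ≤ Real.pi / 3 →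
      numer (M + 1) x u = Λ u * ∏ j, Complex.sin (u - x j)) :
    (4 / 3 : ℝ) ^ (M + 1) ≤ 8 * ‖Λ 0‖ := by
  have hcos : ∀ z : ℂ, |z.re| ≤ Real.pi / 3 → 1 / 4 ≤ ‖Complex.cos z‖ ^ 2 := fun z hz =>
    le_trans (by nlinarith [sq_nonneg (Real.sinh z.im)]) (le_norm_cos_sq hz)
  have hcos0 : ∀ z : ℂ, |z.re| ≤ Real.pi / 3 → Complex.cos z ^ 2 ≠ 0 := fun z hz h => by
    have := hcos z hz
    rw [← norm_pow, h, norm_zero] at this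
    norm_num at this
  have hnum : numer (M + 1) x ((Real.pi / 3 : ℝ) : ℂ) ≠ 0 := by
    refine numer_ne_zero M.succ_ne_zero hx ?_ ?_
    · rw [Complex.ofReal_re]
      positivity
    · rw [Complex.ofReal_re, abs_of_pos (by positivity)]
  have hexp : ExpBounded fun z => bulk z ^ (M + 1) * (Λ z)⁻¹ * (Complex.cos z ^ 2)⁻¹ := by
    refine ((expBounded_bulk.pow _).mul (expBounded_inv hΛ hne hfac hnum)).mul
      (.of_le (D := 4) fun z hz => ?_)
    rw [norm_inv, norm_pow, inv_le_comm₀ (by linarith [hcos z hz]) (by norm_num)]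
    linarith [hcos z hz]
  obtain ⟨D, K, hDK⟩ := hexp
  have hbulk : ∀ z : ℂ, |z.re| ≤ Real.pi / 3 → DifferentiableAt ℂ bulk z := fun z hz => by
    have := (differentiableAt_inv_bulk hz).inv (inv_ne_zero (bulk_ne_zero hz))
    simpa [Pi.inv_def] using this
  have h := norm_le_of_strip (C := 8)
    (f := fun z => bulk z ^ (M + 1) * (Λ z)⁻¹ * (Complex.cos z ^ 2)⁻¹)
    (fun z hz => (((hbulk z hz).pow _).mul ((hΛ z).inv (hne z hz))).mul
      ((Complex.differentiable_cos.differentiableAt.pow 2).inv (hcos0 z hz))) hDK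
    (fun z hz => by
      have h1 : 0 < ‖Λ z‖ * ‖Complex.cos z‖ ^ 2 :=
        mul_pos (norm_pos_iff.2 (hne z hz.le)) (by linarith [hcos z hz.le])
      have h2 := norm_bulk_pow_le M hx hfac hz
      rw [norm_mul, norm_mul, norm_inv, norm_inv, norm_pow, norm_pow, mul_assoc, ← mul_inv,
        ← div_eq_mul_inv, div_le_iff₀ h1]
      exact h2)
  have h0 := norm_pos_iff.2 (hne 0 (by simp; positivity))
  rw [bulk_zero, Complex.cos_zero, one_pow, inv_one, mul_one, norm_mul, norm_inv,
    ← div_eq_mul_inv, div_le_iff₀ h0, norm_pow] at h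
  simpa using h

end Boundary

section LowerBound

open Matrix

theorem norm_pow_apply_le {S : Type*} [Fintype S] [DecidableEq S] {A : Matrix S S ℂ}
    {B : Matrix S S ℝ} (h : ∀ σ τ, ‖A σ τ‖ ≤ B σ τ) (N : ℕ) (σ τ : S) :
    ‖(A ^ N) σ τ‖ ≤ (B ^ N) σ τ := by
  induction N generalizing τ with
  | zero => by_cases hστ : σ = τ <;> simp [hστ]
  | succ N ih =>
    rw [pow_succ, pow_succ, Matrix.mul_apply, Matrix.mul_apply]
    refine (norm_sum_le _ _).trans (Finset.sum_le_sum fun ρ _ => ?_)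
    rw [norm_mul]
    exact mul_le_mul (ih ρ) (h ρ τ) (norm_nonneg _) ((norm_nonneg _).trans (ih ρ))

theorem norm_eigenvalue_le {S : Type*} [Fintype S] {A : Matrix S S ℂ} {V : S → ℂ} {c : ℂ}
    (hV : V ≠ 0) (h : A *ᵥ V = c • V) : ‖c‖ ≤ ∑ σ, ∑ τ, ‖A σ τ‖ := by
  obtain ⟨σ₀, hσ₀⟩ := Function.ne_iff.1 hV
  obtain ⟨σ, -, hσ⟩ := Finset.exists_max_image Finset.univ (fun σ => ‖V σ‖) ⟨σ₀, Finset.mem_univ _⟩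
  have hpos : 0 < ‖V σ‖ := (norm_pos_iff.2 hσ₀).trans_le (hσ σ₀ (Finset.mem_univ _))
  have h1 : ‖c‖ * ‖V σ‖ ≤ (∑ τ, ‖A σ τ‖) * ‖V σ‖ := by
    rw [← norm_mul, ← smul_eq_mul, ← Pi.smul_apply, ← h, Matrix.mulVec, dotProduct, Finset.sum_mul]
    refine (norm_sum_le _ _).trans (Finset.sum_le_sum fun τ _ => ?_)
    rw [norm_mul]
    gcongr
    exact hσ τ (Finset.mem_univ _)
  exact (le_of_mul_le_mul_right h1 hpos).trans (Finset.single_le_sum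
    (f := fun σ => ∑ τ, ‖A σ τ‖) (fun _ _ => Finset.sum_nonneg fun _ _ => norm_nonneg _)
    (Finset.mem_univ σ))

theorem pow_mulVec_of_mulVec {S : Type*} [Fintype S] [DecidableEq S] {A : Matrix S S ℂ} {V : S → ℂ}
    {c : ℂ} (h : A *ᵥ V = c • V) (N : ℕ) : (A ^ N) *ᵥ V = c ^ N • V := by
  induction N with
  | zero => simp
  | succ N ih => rw [pow_succ, ← Matrix.mulVec_mulVec, h, Matrix.mulVec_smul, ih, smul_smul, pow_succ']

theorem norm_mono_le {l : Bool → Bool → Matrix Bool Bool ℂ} {l' : Bool → Bool → Matrix Bool Bool ℝ}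
    (h : ∀ p q σ τ, ‖l p q σ τ‖ ≤ l' p q σ τ) (L : ℕ) (p q : Bool) (σ τ : Row L) :
    ‖mono l L p q σ τ‖ ≤ mono l' L p q σ τ := by
  induction L generalizing p with
  | zero =>
    have : σ = τ := Subsingleton.elim (α := Unit) σ τ
    subst this
    by_cases hpq : p = q <;> simp [mono, hpq]
  | succ L ih =>
    obtain ⟨σ, σ'⟩ : Bool × Row L := σ
    obtain ⟨τ, τ'⟩ : Bool × Row L := τ
    rw [mono_succ_apply, mono_succ_apply]
    refine (norm_sum_le _ _).trans (Finset.sum_le_sum fun k _ => ?_)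
    rw [norm_mul]
    exact mul_le_mul (h _ _ _ _) (ih _ _ _) (norm_nonneg _) ((norm_nonneg _).trans (h _ _ _ _))

theorem norm_periodic_le (N : ℕ) (σ τ : Row N) :
    ‖(chain N 0 false false + chain N 0 true true) σ τ‖ ≤
      ((Real.sqrt 3 / 2) ^ N • ∑ p, ∑ q, mono (site (1 : ℝ) 1 1) N p q) σ τ := by
  have hs : ‖(Real.sqrt 3 / 2 : ℂ) ^ N‖ = (Real.sqrt 3 / 2) ^ N := by
    rw [norm_pow, norm_div, Complex.norm_real, Complex.norm_ofNat,
      Real.norm_of_nonneg (Real.sqrt_nonneg 3)]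
  have h : ∀ p q, ‖mono (site (1 : ℂ) 1 1) N p q σ τ‖ ≤ mono (site (1 : ℝ) 1 1) N p q σ τ :=
    fun p q => norm_mono_le (fun p q σ τ => by
      rw [site_one, site_one]
      split_ifs <;> simp) N p q σ τ
  rw [chain_zero, chain_zero, ← smul_add, Matrix.smul_apply, Matrix.smul_apply, norm_smul, hs,
    smul_eq_mul]
  gcongr
  simp only [Matrix.add_apply, Fintype.sum_bool]
  have h1 := norm_add_le (mono (site (1 : ℂ) 1 1) N false false σ τ)
    (mono (site (1 : ℂ) 1 1) N true true σ τ)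
  have h2 := fun p q => (norm_nonneg _).trans (h p q)
  linarith [h true true, h false false, h2 true false, h2 false true]

theorem le_card_flatFoldable {N : ℕ} (hN : N ≠ 0) :
    ((8 / (3 * Real.sqrt 3)) ^ N / 8) ^ N ≤
      (Nat.card {μ : Crease (N + 1) (N + 1) → ℤ // FlatFoldable μ} : ℝ) := by
  obtain ⟨α, V, Λ, hV, hΛ, hfac, heig, hne⟩ :=
    exists_chain_eigenvalue (L := N) (n := N / 2) hN (by omega) (by omega)
  obtain ⟨M, rfl⟩ := Nat.exists_eq_succ_of_ne_zero hN
  have h1 := le_norm_eigenvalue M (x := fun j => Complex.I * α j) (by simp) hΛ hne hfac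
  rw [← Nat.succ_eq_add_one] at h1
  have h2 := norm_eigenvalue_le hV (pow_mulVec_of_mulVec heig M.succ)
  have h3 : ‖Λ 0 ^ M.succ‖ ≤ ((Real.sqrt 3 / 2) ^ M.succ) ^ M.succ *
      (Nat.card {μ : Crease (M.succ + 1) (M.succ + 1) → ℤ // FlatFoldable μ} : ℝ) := by
    refine h2.trans ((Finset.sum_le_sum fun σ _ => Finset.sum_le_sum fun τ _ =>
      norm_pow_apply_le (norm_periodic_le M.succ) M.succ σ τ).trans_eq ?_)
    simp only [card_flatFoldable (R := ℝ), smul_pow, Matrix.smul_apply, smul_eq_mul,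
      Finset.mul_sum]
  rw [norm_pow] at h3
  have h4 : 0 < Real.sqrt 3 := by positivity
  have h5 : Real.sqrt 3 / 2 * (8 / (3 * Real.sqrt 3)) = 4 / 3 := by
    field_simp
    norm_num
  refine le_of_mul_le_mul_left (le_trans ?_ h3)
    (show 0 < ((Real.sqrt 3 / 2) ^ M.succ) ^ M.succ by positivity)
  rw [← mul_pow, mul_div_assoc', ← mul_pow, h5]
  gcongr
  linarith

end LowerBound

section Limit

open Filter Topology

theorem eight_div_eq_rpow : 8 / (3 * Real.sqrt 3) = (4 / 3 : ℝ) ^ (3 / 2 : ℝ) := by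
  have h : Real.sqrt (4 / 3) = 2 / Real.sqrt 3 := by
    rw [Real.sqrt_div (by norm_num), show (4 : ℝ) = 2 ^ 2 by norm_num,
      Real.sqrt_sq (by norm_num)]
  rw [show (3 / 2 : ℝ) = 1 + 1 / 2 by norm_num, Real.rpow_add (by norm_num), Real.rpow_one,
    ← Real.sqrt_eq_rpow, h]
  field_simp
  norm_num

theorem tendsto_mul_pow_pow_rpow {a c : ℝ} (ha : 0 < a) (hc : 0 < c) :
    Tendsto (fun N : ℕ => ((c * a ^ N) ^ N) ^ ((((N + 1 : ℕ) : ℝ) ^ 2)⁻¹)) atTop (𝓝 a) := by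
  have h1 : Tendsto (fun N : ℕ => (N : ℝ) / ((N : ℝ) + 1)) atTop (𝓝 1) :=
    tendsto_natCast_div_add_atTop 1
  have h0 : Tendsto (fun N : ℕ => 1 / ((N : ℝ) + 1)) atTop (𝓝 0) :=
    tendsto_one_div_add_atTop_nhds_zero_nat
  have h2 := (tendsto_const_nhds (x := c)).rpow (h1.mul h0) (Or.inl hc.ne')
  have h3 := (tendsto_const_nhds (x := a)).rpow (h1.mul h1) (Or.inl ha.ne')
  have h := h2.mul h3
  rw [mul_zero, Real.rpow_zero, mul_one, Real.rpow_one, one_mul] at h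
  refine h.congr fun N => ?_
  rw [mul_pow, ← pow_mul, Real.mul_rpow (by positivity) (by positivity), ← Real.rpow_natCast c,
    ← Real.rpow_natCast a, ← Real.rpow_mul hc.le, ← Real.rpow_mul ha.le]
  congr 2 <;>
  · push_cast
    field_simp

end Limit

/-- letting `A n` be the number of locally flat-foldable MV-assignments of
the `n × n` Miura-ori (which has `N = n ^ 2` parallelogram cells), `A(n) ^ (1 / n²)`
converges to `(4/3) ^ (3/2)` as `n → ∞`; that is, the number of ways to locally flat-fold
a Miura-ori with `N` parallelograms grows like `(4/3) ^ (3N/2)` for `N` large. -/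
theorem flatFoldable_growth_rate :
    Filter.Tendsto
      (fun n : ℕ =>
        (Nat.card {μ : Crease n n → ℤ // FlatFoldable μ} : ℝ) ^ (((n : ℝ) ^ 2)⁻¹))
      Filter.atTop (nhds ((4 / 3 : ℝ) ^ ((3 : ℝ) / 2))) := by
  have hW : 0 < 8 / (3 * Real.sqrt 3) := by positivity
  rw [← Filter.tendsto_add_atTop_iff_nat 1, ← eight_div_eq_rpow]
  refine tendsto_of_tendsto_of_tendsto_of_le_of_le'
    (tendsto_mul_pow_pow_rpow (c := 1 / 8) hW (by norm_num))
    (tendsto_mul_pow_pow_rpow (c := 4) hW (by norm_num)) ?_ ?_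
  · filter_upwards [Filter.eventually_ne_atTop 0] with N hN
    rw [one_div_mul_eq_div]
    exact Real.rpow_le_rpow (by positivity) (le_card_flatFoldable hN) (by positivity)
  · exact Filter.Eventually.of_forall fun N =>
      Real.rpow_le_rpow (by positivity) (card_flatFoldable_le N) (by positivity)

end Miura
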